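/- Let n ≥ 2, α ∈ (1,2), and let D ⊂ ℝⁿ be a bounded open set of class C^{1,1}. Let F ⊂ D be relatively closed in D with cp_*F > 0. Then for every x ∈ D∖F, the α-Green balayage of the unit Dirac measure ε_x onto F satisfies (ε_x)^F_{g_α}(F) < 1. -/

import Mathlib

open MeasureTheory Filter Set Topology ENNReal CompactlySupported UniformConvergence

namespace Balayage
open scoped Classical

variable {X : Type*} [TopologicalSpace X] [MeasurableSpace X]

/-- A kernel: symmetric, lower semicontinuous, `[0,∞]`-valued. -/
structure IsKernel (κ : X → X → ℝ≥0∞) : Prop where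
  symm : ∀ x y, κ x y = κ y x
  lsc : LowerSemicontinuous fun p : X × X => κ p.1 p.2

/-- The potential `U^μ(x) = ∫ κ(x,y) dμ(y)`. -/
noncomputable def potential (κ : X → X → ℝ≥0∞) (μ : Measure X) (x : X) : ℝ≥0∞ :=
  ∫⁻ y, κ x y ∂μ

/-- The mutual energy `I(μ,ν) = ∫∫ κ(x,y) dν(y) dμ(x)` of two positive measures. -/
noncomputable def energy (κ : X → X → ℝ≥0∞) (μ ν : Measure X) : ℝ≥0∞ :=
  ∫⁻ x, potential κ ν x ∂μ

/-- A positive Radon measure (regular Borel measure, finite on compacts). -/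
def IsRadon (μ : Measure X) : Prop := μ.Regular

/-- Finite energy: `I(μ) < ∞`. -/
def FiniteEnergy (κ : X → X → ℝ≥0∞) (μ : Measure X) : Prop := energy κ μ μ < ⊤

/-- Membership in the cone `E⁺` of positive Radon measures of finite energy. -/
def memE (κ : X → X → ℝ≥0∞) (μ : Measure X) : Prop := IsRadon μ ∧ FiniteEnergy κ μ

/-- Membership in `E⁺(A)`: measures of `E⁺` concentrated on `A`
(i.e. the complement of `A` is negligible). -/
def memEOn (κ : X → X → ℝ≥0∞) (A : Set X) (μ : Measure X) : Prop :=
  memE κ μ ∧ μ Aᶜ = 0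

/-- The strong (energy) distance `‖μ-ν‖ = √(I(μ)+I(ν)-2I(μ,ν))`. -/
noncomputable def sDist (κ : X → X → ℝ≥0∞) (μ ν : Measure X) : ℝ :=
  Real.sqrt ((energy κ μ μ).toReal + (energy κ ν ν).toReal - 2 * (energy κ μ ν).toReal)

/-- Membership in `E'(A)`, the strong closure of `E⁺(A)` in `E⁺`. -/
def memEClos (κ : X → X → ℝ≥0∞) (A : Set X) (μ : Measure X) : Prop :=
  memE κ μ ∧ ∀ ε : ℝ, 0 < ε → ∃ ν, memEOn κ A ν ∧ sDist κ μ ν < ε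

/-- The capacity of a compact set: the inverse of the minimal energy of
probability measures concentrated on it. -/
noncomputable def capC (κ : X → X → ℝ≥0∞) (K : Set X) : ℝ≥0∞ :=
  (⨅ (μ : Measure X) (_ : IsProbabilityMeasure μ) (_ : μ Kᶜ = 0), energy κ μ μ)⁻¹

/-- The inner capacity `cp_* A`: supremum of capacities of compact subsets. -/
noncomputable def innerCap (κ : X → X → ℝ≥0∞) (A : Set X) : ℝ≥0∞ :=
  ⨆ (K : Set X) (_ : IsCompact K) (_ : K ⊆ A), capC κ K

/-- The outer capacity `cp^* A`: infimum of inner capacities of open supersets. -/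
noncomputable def outerCap (κ : X → X → ℝ≥0∞) (A : Set X) : ℝ≥0∞ :=
  ⨅ (D : Set X) (_ : IsOpen D) (_ : A ⊆ D), innerCap κ D

/-- Strict positive definiteness (energy principle), stated for pairs of positive
measures of finite energy: `I(μ-ν) ≥ 0`, with equality only for `μ = ν`. -/
def StrictlyPosDef (κ : X → X → ℝ≥0∞) : Prop :=
  ∀ μ ν : Measure X, IsRadon μ → IsRadon ν → FiniteEnergy κ μ → FiniteEnergy κ ν →
    (2 * energy κ μ ν ≤ energy κ μ μ + energy κ ν ν) ∧
    (2 * energy κ μ ν = energy κ μ μ + energy κ ν ν → μ = ν)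

/-- Vague convergence of a sequence of measures: convergence of integrals of
continuous compactly supported functions. -/
def VagueTendsto (μ : ℕ → Measure X) (μ₀ : Measure X) : Prop :=
  ∀ f : X → ℝ, Continuous f → HasCompactSupport f →
    Tendsto (fun j => ∫ x, f x ∂(μ j)) atTop (nhds (∫ x, f x ∂μ₀))

/-- A perfect kernel: strictly positive definite, `E⁺` strongly complete, and the strong
topology on `E⁺` finer than the vague topology (sequential formulation; sequences suffice
on second-countable spaces). -/
structure Perfect (κ : X → X → ℝ≥0∞) : Prop where
  posdef : StrictlyPosDef κ
  complete : ∀ μ : ℕ → Measure X, (∀ j, memE κ (μ j)) →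
    (∀ ε : ℝ, 0 < ε → ∃ N, ∀ m ≥ N, ∀ n ≥ N, sDist κ (μ m) (μ n) < ε) →
    ∃ μ₀, memE κ μ₀ ∧ Tendsto (fun j => sDist κ (μ j) μ₀) atTop (nhds 0)
  finerThanVague : ∀ (μ : ℕ → Measure X) (μ₀ : Measure X), (∀ j, memE κ (μ j)) →
    memE κ μ₀ → Tendsto (fun j => sDist κ (μ j) μ₀) atTop (nhds 0) → VagueTendsto μ μ₀

/-- The domination principle. -/
def Domination (κ : X → X → ℝ≥0∞) : Prop :=
  ∀ μ ν : Measure X, memE κ μ → IsRadon ν →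
    (∀ᵐ x ∂μ, potential κ μ x ≤ potential κ ν x) → ∀ x, potential κ μ x ≤ potential κ ν x

/-- `h`-Ugaheri's maximum principle; for `h = 1` this is Frostman's maximum principle. -/
def Ugaheri (κ : X → X → ℝ≥0∞) (h : ℝ) : Prop :=
  ∀ μ : Measure X, memE κ μ → ∀ c : ℝ, 0 < c →
    (∀ᵐ x ∂μ, potential κ μ x ≤ ENNReal.ofReal c) →
    ∀ x, potential κ μ x ≤ ENNReal.ofReal (h * c)

/-- Condition (R1): the kernel is perfect and satisfies the domination and
`h`-Ugaheri maximum principles for some `h ∈ [1, ∞)`. -/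
structure R1 (κ : X → X → ℝ≥0∞) : Prop where
  perfect : Perfect κ
  domination : Domination κ
  ugaheri : ∃ h : ℝ, 1 ≤ h ∧ Ugaheri κ h

/-- Condition (R2): `κ(x,y)` is continuous and finite off the diagonal. -/
def R2 (κ : X → X → ℝ≥0∞) : Prop :=
  ContinuousOn (fun p : X × X => κ p.1 p.2) {p : X × X | p.1 ≠ p.2} ∧
    ∀ x y : X, x ≠ y → κ x y ≠ ⊤

/-- Condition (R3): `κ(·,y) → 0` uniformly on compact sets as `y` tends to the
Alexandroff point of `X`. -/
def R3 (κ : X → X → ℝ≥0∞) : Prop :=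
  ∀ K : Set X, IsCompact K → ∀ ε : ℝ≥0∞, 0 < ε →
    ∃ K' : Set X, IsCompact K' ∧ ∀ y ∉ K', ∀ x ∈ K, κ x y < ε

/-- `μA` is the inner balayage of `ω` onto `A`: it belongs to `E'(A)` and its potential
coincides with that of `ω` nearly everywhere on `A` (up to a set of inner capacity zero). -/
def IsInnerBalayage (κ : X → X → ℝ≥0∞) (A : Set X) (ω μA : Measure X) : Prop :=
  memEClos κ A μA ∧ innerCap κ {x ∈ A | potential κ μA x ≠ potential κ ω x} = 0

/-- `μA` is the outer balayage of `ω` onto `A`: it belongs to `E'(A)` and its potential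
coincides with that of `ω` quasi-everywhere on `A` (up to a set of outer capacity zero). -/
def IsOuterBalayage (κ : X → X → ℝ≥0∞) (A : Set X) (ω μA : Measure X) : Prop :=
  memEClos κ A μA ∧ outerCap κ {x ∈ A | potential κ μA x ≠ potential κ ω x} = 0

/-- Membership in the class `Γ_{A,ω}` of positive finite-energy Radon measures whose
potential dominates that of `ω` nearly everywhere on `A`. -/
def memGamma (κ : X → X → ℝ≥0∞) (A : Set X) (ω ν : Measure X) : Prop :=
  memE κ ν ∧ innerCap κ {x ∈ A | ¬ potential κ ω x ≤ potential κ ν x} = 0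

/-- Euclidean space `ℝⁿ`. -/
abbrev Rn (n : ℕ) := EuclideanSpace ℝ (Fin n)

/-- The α-Riesz kernel `|x-y|^{α-n}` on `ℝⁿ` (with value `∞` on the diagonal). -/
noncomputable def riesz (n : ℕ) (α : ℝ) (x y : Rn n) : ℝ≥0∞ :=
  if x = y then ⊤ else ENNReal.ofReal (‖x - y‖ ^ (α - (n : ℝ)))

/-- `Q ⊆ ℝⁿ` is inner α-thin at infinity:
`Σ_j cp_*(Q_j)/q^{j(n-α)} < ∞` where `Q_j = Q ∩ {q^j ≤ |x| < q^{j+1}}`. -/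
def InnerThinAtInfinity (n : ℕ) (α : ℝ) (Q : Set (Rn n)) : Prop :=
  ∃ q : ℝ, 1 < q ∧
    (∑' j : ℕ, innerCap (riesz n α) (Q ∩ {x : Rn n | q ^ j ≤ ‖x‖ ∧ ‖x‖ < q ^ (j + 1)}) /
      ENNReal.ofReal (q ^ ((j : ℝ) * ((n : ℝ) - α)))) < ⊤

/-- An open set `D ⊆ ℝⁿ` is of class `C^{1,1}`: at each boundary point `y` there are two
open balls of a common radius `r > 0`, one inside `D` and one inside `Dᶜ`, tangent at `y`. -/
def C11 (n : ℕ) (D : Set (Rn n)) : Prop :=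
  ∀ y ∈ frontier D, ∃ (x x' : Rn n) (r : ℝ), 0 < r ∧
    Metric.ball x r ⊆ D ∧ Metric.ball x' r ⊆ Dᶜ ∧ dist y x = r ∧ dist y x' = r

/-- The α-Green kernel of `D`:
`g_α(x,y) = |x-y|^{α-n} - ∫ |x-z|^{α-n} d(ε_y)^{Dᶜ}(z)` for `x,y ∈ D` (extended by `0`
off `D × D`), where `εDc y` is the α-Riesz balayage of the Dirac measure `ε_y` onto `Dᶜ`. -/
noncomputable def green (n : ℕ) (α : ℝ) (D : Set (Rn n)) (εDc : Rn n → Measure (Rn n))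
    (x y : Rn n) : ℝ≥0∞ :=
  if x ∈ D ∧ y ∈ D then riesz n α x y - ∫⁻ z, riesz n α x z ∂(εDc y) else 0

/-- The Gauss–Weierstrass kernel `t^{-n/2} exp(-π|x|²/t)` on `ℝⁿ`, normalized to have mass one. -/
noncomputable def heat (n : ℕ) (t : ℝ) (x : Rn n) : ℝ≥0∞ :=
  ENNReal.ofReal (t ^ (-((n : ℝ) / 2)) * Real.exp (-(Real.pi / t) * ‖x‖ ^ 2))

lemma heat_neg (n : ℕ) (t : ℝ) (x : Rn n) : heat n t (-x) = heat n t x := by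
  simp [heat]

lemma measurable_heat (n : ℕ) : Measurable fun q : ℝ × Rn n => heat n q.1 q.2 := by
  unfold heat
  fun_prop

lemma lintegral_heat (n : ℕ) {t : ℝ} (ht : 0 < t) : ∫⁻ x, heat n t x = 1 := by
  have hb : 0 < Real.pi / t := by positivity
  have h1 := GaussianFourier.integral_rexp_neg_mul_sq_norm (V := Rn n) hb
  have h2 : ∫ x : Rn n, t ^ (-((n : ℝ) / 2)) * Real.exp (-(Real.pi / t) * ‖x‖ ^ 2) = 1 := by
    rw [integral_const_mul, h1, div_div_cancel₀ Real.pi_ne_zero]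
    simp only [finrank_euclideanSpace, Fintype.card_fin]
    rw [← Real.rpow_add ht]
    simp
  have h3 : Integrable fun x : Rn n => t ^ (-((n : ℝ) / 2)) *
      Real.exp (-(Real.pi / t) * ‖x‖ ^ 2) :=
    Integrable.of_integral_ne_zero (by rw [h2]; exact one_ne_zero)
  unfold heat
  rw [← ofReal_integral_eq_lintegral_ofReal h3 (ae_of_all _ fun x => by positivity), h2]
  simp

/-- Completing the square in a product of two heat kernels. -/
lemma heat_mul_heat (n : ℕ) {s t : ℝ} (hs : 0 < s) (ht : 0 < t) (a z : Rn n) :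
    heat n s (a - z) * heat n t z =
      heat n (s + t) a * heat n (s * t / (s + t)) (z - (t / (s + t)) • a) := by
  have hst : 0 < s + t := by positivity
  unfold heat
  rw [← ENNReal.ofReal_mul (by positivity), ← ENNReal.ofReal_mul (by positivity)]
  congr 1
  have e1 : ‖a - z‖ ^ 2 = ‖a‖ ^ 2 - 2 * inner ℝ a z + ‖z‖ ^ 2 := norm_sub_sq_real a z
  have e2 : ‖z - (t / (s + t)) • a‖ ^ 2 =
      ‖z‖ ^ 2 - 2 * ((t / (s + t)) * inner ℝ a z) + (t / (s + t)) ^ 2 * ‖a‖ ^ 2 := by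
    rw [norm_sub_sq_real, real_inner_smul_right, norm_smul, mul_pow, Real.norm_eq_abs, sq_abs,
      real_inner_comm]
  have e3 : -(Real.pi / s) * ‖a - z‖ ^ 2 + -(Real.pi / t) * ‖z‖ ^ 2 =
      -(Real.pi / (s + t)) * ‖a‖ ^ 2 +
        -(Real.pi / (s * t / (s + t))) * ‖z - (t / (s + t)) • a‖ ^ 2 := by
    rw [e1, e2]
    field_simp
    ring
  have e4 : s ^ (-((n : ℝ) / 2)) * t ^ (-((n : ℝ) / 2)) =
      (s + t) ^ (-((n : ℝ) / 2)) * (s * t / (s + t)) ^ (-((n : ℝ) / 2)) := by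
    rw [← Real.mul_rpow hs.le ht.le, ← Real.mul_rpow hst.le (by positivity)]
    congr 1
    field_simp
  calc _ = (s ^ (-((n : ℝ) / 2)) * t ^ (-((n : ℝ) / 2))) *
        Real.exp (-(Real.pi / s) * ‖a - z‖ ^ 2 + -(Real.pi / t) * ‖z‖ ^ 2) := by
        rw [Real.exp_add]; ring
    _ = _ := by rw [e3, e4, Real.exp_add]; ring

lemma lintegral_heat_mul_heat (n : ℕ) {s t : ℝ} (hs : 0 < s) (ht : 0 < t) (x y : Rn n) :
    ∫⁻ z, heat n s (x - z) * heat n t (z - y) = heat n (s + t) (x - y) := by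
  have h1 : ∫⁻ z, heat n s (x - z) * heat n t (z - y) =
      ∫⁻ z, heat n s ((x - y) - z) * heat n t z := by
    rw [← lintegral_add_right_eq_self (μ := volume) _ y]
    congr 1
    ext z
    congr 2
    · abel
    · abel
  have hm : Measurable fun z : Rn n => heat n (s * t / (s + t)) z :=
    (measurable_heat n).comp (measurable_const.prodMk measurable_id)
  rw [h1]
  simp_rw [heat_mul_heat n hs ht]
  rw [lintegral_const_mul (heat n (s + t) (x - y))
      (f := fun z => heat n (s * t / (s + t)) (z - (t / (s + t)) • (x - y)))
      (hm.comp (measurable_id.sub_const _)),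
    lintegral_sub_right_eq_self (μ := volume) (fun z => heat n (s * t / (s + t)) z),
    lintegral_heat n (by positivity), mul_one]

/-- The mixture `∫₀^∞ w(t) p_t(x) dt` of heat kernels with weight `w`. -/
noncomputable def heatMix (n : ℕ) (w : ℝ → ℝ≥0∞) (x : Rn n) : ℝ≥0∞ :=
  ∫⁻ t in Ioi 0, w t * heat n t x

lemma heatMix_neg (n : ℕ) (w : ℝ → ℝ≥0∞) (x : Rn n) : heatMix n w (-x) = heatMix n w x := by
  simp [heatMix, heat_neg]

lemma measurable_heatMix (n : ℕ) {w : ℝ → ℝ≥0∞} (hw : Measurable w) : Measurable (heatMix n w) := by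
  unfold heatMix
  apply Measurable.lintegral_prod_right' (f := fun q : Rn n × ℝ => w q.2 * heat n q.2 q.1)
  exact (hw.comp measurable_snd).mul ((measurable_heat n).comp measurable_swap)

lemma lintegral_heatMix_mul (n : ℕ) {w : ℝ → ℝ≥0∞} (hw : Measurable w) {f : Rn n → ℝ≥0∞}
    (hf : Measurable f) (x : Rn n) (μ : Measure (Rn n)) [SFinite μ] :
    ∫⁻ z, heatMix n w (x - z) * f z ∂μ =
      ∫⁻ t in Ioi 0, w t * ∫⁻ z, heat n t (x - z) * f z ∂μ := by
  have hh : Measurable fun q : Rn n × ℝ => heat n q.2 (x - q.1) :=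
    (measurable_heat n).comp (measurable_snd.prodMk (measurable_const.sub measurable_fst))
  unfold heatMix
  have h1 : ∀ z, (∫⁻ t in Ioi 0, w t * heat n t (x - z)) * f z =
      ∫⁻ t in Ioi 0, w t * (heat n t (x - z) * f z) := by
    intro z
    rw [← lintegral_mul_const]
    · simp_rw [mul_assoc]
    · exact hw.mul (hh.comp (measurable_const.prodMk measurable_id))
  simp_rw [h1]
  rw [lintegral_lintegral_swap]
  · congr 1
    ext t
    rw [lintegral_const_mul]
    exact (hh.comp (measurable_id.prodMk measurable_const)).mul hf
  · exact ((hw.comp measurable_snd).mul (hh.mul (hf.comp measurable_fst))).aemeasurable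

lemma lintegral_heatMix (n : ℕ) {w : ℝ → ℝ≥0∞} (hw : Measurable w) :
    ∫⁻ z, heatMix n w z = ∫⁻ t in Ioi 0, w t := by
  have h := lintegral_heatMix_mul n hw (f := fun _ => 1) measurable_const 0 volume
  simp only [mul_one, zero_sub, heatMix_neg, heat_neg] at h
  rw [h]
  apply setLIntegral_congr_fun measurableSet_Ioi
  intro t ht
  simp only [lintegral_heat n ht, mul_one]

lemma lintegral_heatMix_mul_heatMix (n : ℕ) {w₁ w₂ : ℝ → ℝ≥0∞} (h₁ : Measurable w₁)
    (h₂ : Measurable w₂) (x y : Rn n) :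
    ∫⁻ z, heatMix n w₁ (x - z) * heatMix n w₂ (z - y) =
      ∫⁻ s in Ioi 0, w₁ s * ∫⁻ t in Ioi 0, w₂ t * heat n (s + t) (x - y) := by
  rw [lintegral_heatMix_mul n h₁ (f := fun z => heatMix n w₂ (z - y))
    ((measurable_heatMix n h₂).comp (measurable_id.sub_const y)) x volume]
  apply setLIntegral_congr_fun measurableSet_Ioi
  intro s hs
  have h := lintegral_heatMix_mul n h₂ (f := fun z => heat n s (x - z))
    ((measurable_heat n).comp (measurable_const.prodMk (measurable_const.sub measurable_id))) y volume
  have h3 : ∫⁻ z, heat n s (x - z) * heatMix n w₂ (z - y) =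
      ∫⁻ z, heatMix n w₂ (y - z) * heat n s (x - z) := by
    congr 1
    ext z
    rw [mul_comm, ← heatMix_neg, neg_sub]
  simp only []
  rw [h3, h]
  congr 1
  apply setLIntegral_congr_fun measurableSet_Ioi
  intro t ht
  simp only []
  rw [← lintegral_heat_mul_heat n hs ht]
  congr 2
  ext z
  rw [mul_comm, ← heat_neg n t, neg_sub]

lemma lintegral_Ioi_rpow_mul_exp {a b : ℝ} (ha : 0 < a) (hb : 0 < b) :
    ∫⁻ t in Ioi (0 : ℝ), ENNReal.ofReal (t ^ (-a - 1) * Real.exp (-(b / t))) =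
      ENNReal.ofReal ((1 / b) ^ a * Real.Gamma a) := by
  have hg : IntegrableOn (fun u : ℝ => u ^ (a - 1) * Real.exp (-b * u)) (Ioi 0) := by
    have := integrableOn_rpow_mul_exp_neg_mul_rpow (p := 1) (s := a - 1) (b := b) (by linarith)
      one_pos hb
    simpa using this
  have hE : EqOn (fun x : ℝ => (|(-1 : ℝ)| * x ^ ((-1 : ℝ) - 1)) •
      ((x ^ (-1 : ℝ)) ^ (a - 1) * Real.exp (-b * x ^ (-1 : ℝ))))
      (fun t => t ^ (-a - 1) * Real.exp (-(b / t))) (Ioi 0) := by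
    intro x hx
    have hx : 0 < x := hx
    simp only [abs_neg, abs_one, one_mul, smul_eq_mul]
    rw [← Real.rpow_mul hx.le, ← mul_assoc, ← Real.rpow_add hx, Real.rpow_neg_one]
    congr 2
    · ring
    · field_simp
  have hi := (integrableOn_Ioi_comp_rpow_iff
    (fun u : ℝ => u ^ (a - 1) * Real.exp (-b * u)) (p := -1) (by norm_num)).2 hg
  have hv := integral_comp_rpow_Ioi
    (fun u : ℝ => u ^ (a - 1) * Real.exp (-b * u)) (p := -1) (by norm_num)
  rw [integrableOn_congr_fun hE measurableSet_Ioi] at hi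
  rw [setIntegral_congr_fun measurableSet_Ioi hE] at hv
  rw [← ofReal_integral_eq_lintegral_ofReal hi, hv]
  · congr 1
    rw [← Real.integral_rpow_mul_exp_neg_mul_Ioi ha hb]
    simp only [neg_mul]
  · filter_upwards [ae_restrict_mem measurableSet_Ioi] with t ht
    have : 0 < t := ht
    simp only [Pi.zero_apply]
    positivity

/-- The constant in `∫₀^∞ t^{γ-1} p_t(x) dt = rieszConst n γ * |x|^{2γ-n}`. -/
noncomputable def rieszConst (n : ℕ) (γ : ℝ) : ℝ :=
  (1 / Real.pi) ^ ((n : ℝ) / 2 - γ) * Real.Gamma ((n : ℝ) / 2 - γ)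

lemma rieszConst_pos {n : ℕ} {γ : ℝ} (hγ : γ < (n : ℝ) / 2) : 0 < rieszConst n γ := by
  have := Real.Gamma_pos_of_pos (sub_pos.2 hγ)
  unfold rieszConst
  positivity

lemma heatMix_rpow {n : ℕ} {γ : ℝ} (hγ : γ < (n : ℝ) / 2) {x : Rn n} (hx : x ≠ 0) :
    heatMix n (fun t => ENNReal.ofReal (t ^ (γ - 1))) x =
      ENNReal.ofReal (rieszConst n γ * ‖x‖ ^ (2 * γ - n)) := by
  have hx' : 0 < ‖x‖ := norm_pos_iff.2 hx
  have h := lintegral_Ioi_rpow_mul_exp (a := (n : ℝ) / 2 - γ) (b := Real.pi * ‖x‖ ^ 2)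
    (sub_pos.2 hγ) (by positivity)
  unfold heatMix heat
  calc _ = ∫⁻ t in Ioi (0 : ℝ), ENNReal.ofReal (t ^ (-((n : ℝ) / 2 - γ) - 1) *
        Real.exp (-(Real.pi * ‖x‖ ^ 2 / t))) := by
        apply setLIntegral_congr_fun measurableSet_Ioi
        intro t ht
        have ht : 0 < t := ht
        simp only []
        rw [← ENNReal.ofReal_mul (by positivity), ← mul_assoc, ← Real.rpow_add ht]
        congr 3
        · ring
        · ring
    _ = _ := by
        rw [h]
        congr 1
        unfold rieszConst
        rw [one_div, mul_inv, Real.mul_rpow (by positivity) (by positivity), ← Real.rpow_natCast,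
          ← Real.rpow_neg hx'.le, ← Real.rpow_mul hx'.le, one_div]
        have : -((2 : ℕ) : ℝ) * ((n : ℝ) / 2 - γ) = 2 * γ - n := by push_cast; ring
        rw [this]
        ring

lemma heatMix_rpow_zero {n : ℕ} (γ : ℝ) :
    heatMix n (fun t => ENNReal.ofReal (t ^ (γ - 1))) 0 = ⊤ := by
  unfold heatMix heat
  have h1 : ∫⁻ t in Ioi (0 : ℝ), ENNReal.ofReal (t ^ (γ - 1)) *
      ENNReal.ofReal (t ^ (-((n : ℝ) / 2)) * Real.exp (-(Real.pi / t) * ‖(0 : Rn n)‖ ^ 2)) =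
      ∫⁻ t in Ioi (0 : ℝ), ENNReal.ofReal (t ^ (γ - 1 - (n : ℝ) / 2)) := by
    apply setLIntegral_congr_fun measurableSet_Ioi
    intro t ht
    have ht : 0 < t := ht
    simp only []
    rw [← ENNReal.ofReal_mul (by positivity), ← mul_assoc, ← Real.rpow_add ht]
    simp [sub_eq_add_neg]
  rw [h1]
  by_contra hne
  apply not_integrableOn_Ioi_rpow (γ - 1 - (n : ℝ) / 2)
  refine ⟨by fun_prop, ?_⟩
  rw [hasFiniteIntegral_iff_ofReal]
  · exact lt_top_iff_ne_top.2 hne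
  · filter_upwards [ae_restrict_mem measurableSet_Ioi] with t ht
    have : 0 < t := ht
    simp only [Pi.zero_apply]
    positivity

/-- The Riesz kernel is a mixture of heat kernels. -/
lemma riesz_eq_heatMix {n : ℕ} {α : ℝ} (hα : α < n) (x y : Rn n) :
    riesz n α x y = ENNReal.ofReal (rieszConst n (α / 2))⁻¹ *
      heatMix n (fun t => ENNReal.ofReal (t ^ (α / 2 - 1))) (x - y) := by
  have hγ : α / 2 < (n : ℝ) / 2 := by linarith
  have hc := rieszConst_pos hγ
  unfold riesz
  split_ifs with h
  · rw [h, sub_self, heatMix_rpow_zero, ENNReal.mul_top]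
    simpa using hc
  · rw [heatMix_rpow hγ (sub_ne_zero.2 h), ← ENNReal.ofReal_mul (by positivity)]
    congr 1
    rw [inv_mul_cancel_left₀ hc.ne']
    congr 1
    ring

/-- The weight of the truncated Lévy kernel. -/
noncomputable def levyWeight (β ε : ℝ) (t : ℝ) : ℝ≥0∞ :=
  (Ioi ε).indicator (fun t => ENNReal.ofReal (t ^ (-1 - β))) t

/-- The weight of the residual kernel. -/
noncomputable def residualWeight (β ε : ℝ) (t : ℝ) : ℝ≥0∞ :=
  ENNReal.ofReal (ε ^ (-β) * (t ^ β - (max (t - ε) 0) ^ β) / (β * t))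

lemma measurable_levyWeight (β ε : ℝ) : Measurable (levyWeight β ε) := by
  unfold levyWeight
  exact Measurable.indicator (by fun_prop) measurableSet_Ioi

lemma measurable_residualWeight (β ε : ℝ) : Measurable (residualWeight β ε) := by
  unfold residualWeight
  fun_prop

lemma lintegral_levyWeight {β ε : ℝ} (hβ : 0 < β) (hε : 0 < ε) :
    ∫⁻ t in Ioi 0, levyWeight β ε t = ENNReal.ofReal (ε ^ (-β) / β) := by
  unfold levyWeight
  rw [lintegral_indicator measurableSet_Ioi, Measure.restrict_restrict measurableSet_Ioi,
    inter_eq_left.2 (Ioi_subset_Ioi hε.le)]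
  have hi := integrableOn_Ioi_rpow_of_lt (a := -1 - β) (by linarith) hε
  rw [← ofReal_integral_eq_lintegral_ofReal hi, integral_Ioi_rpow_of_lt (by linarith) hε]
  · congr 1
    rw [show -1 - β + 1 = -β by ring, neg_div_neg_eq]
  · filter_upwards [ae_restrict_mem measurableSet_Ioi] with t ht
    have : 0 < t := hε.trans ht
    simp only [Pi.zero_apply]
    positivity

lemma hasDerivAt_levy_primitive {β t s : ℝ} (hβ : 0 < β) (hs : 0 < s) (hst : s < t) :
    HasDerivAt (fun s => -((t / s - 1) ^ β / (β * t))) (s ^ (-1 - β) * (t - s) ^ (β - 1)) s := by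
  have ht : 0 < t := hs.trans hst
  have h0 : 0 < t / s - 1 := by rw [sub_pos, one_lt_div hs]; exact hst
  have h1 : HasDerivAt (fun s : ℝ => t / s - 1) (-t / s ^ 2) s := by
    have := ((hasDerivAt_inv hs.ne').const_mul t).sub_const 1
    exact this.congr_deriv (by field_simp)
  have h2 := ((h1.rpow_const (p := β) (Or.inl h0.ne')).div_const (β * t)).neg
  refine h2.congr_deriv ?_
  have e1 : t / s - 1 = (t - s) * s⁻¹ := by field_simp
  rw [e1, Real.mul_rpow (by linarith) (by positivity), Real.inv_rpow hs.le, ← Real.rpow_neg hs.le,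
    show -1 - β = -(β - 1) + (-2 : ℝ) by ring, Real.rpow_add hs,
    show s ^ (-2 : ℝ) = (s ^ 2)⁻¹ by rw [Real.rpow_neg hs.le]; norm_cast]
  field_simp

lemma lintegral_levyWeight_mul {β ε t : ℝ} (hβ : 0 < β) (hε : 0 < ε) (ht : 0 < t) :
    ∫⁻ s in Ioi 0, levyWeight β ε s * (Iio t).indicator (fun s => ENNReal.ofReal ((t - s) ^ (β - 1))) s =
      ENNReal.ofReal ((max (t / ε - 1) 0) ^ β / (β * t)) := by
  have h1 : ∀ s, levyWeight β ε s * (Iio t).indicator (fun s => ENNReal.ofReal ((t - s) ^ (β - 1))) s =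
      (Ioo ε t).indicator (fun s => ENNReal.ofReal (s ^ (-1 - β) * (t - s) ^ (β - 1))) s := by
    intro s
    unfold levyWeight
    rw [← Ioi_inter_Iio, ← inter_indicator_mul]
    by_cases hs : s ∈ Ioi ε ∩ Iio t
    · rw [indicator_of_mem hs, indicator_of_mem hs, ENNReal.ofReal_mul]
      have : 0 < s := hε.trans hs.1
      positivity
    · rw [indicator_of_notMem hs, indicator_of_notMem hs]
  simp_rw [h1]
  rw [lintegral_indicator measurableSet_Ioo, Measure.restrict_restrict measurableSet_Ioo,
    inter_eq_left.2 (show Ioo ε t ⊆ Ioi 0 from fun s hs => hε.trans hs.1)]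
  rcases le_or_gt t ε with hle | hlt
  · rw [Ioo_eq_empty (not_lt.2 hle), max_eq_right, Real.zero_rpow hβ.ne']
    · simp
    · rw [sub_nonpos, div_le_one hε]; exact hle
  · have hcont : ContinuousOn (fun s => -((t / s - 1) ^ β / (β * t))) (Icc ε t) := by
      apply ContinuousOn.neg
      apply ContinuousOn.div_const
      apply ContinuousOn.rpow_const
      · apply ContinuousOn.sub _ continuousOn_const
        exact continuousOn_const.div continuousOn_id (fun s hs => (hε.trans_le hs.1).ne')
      · intro s hs; right; exact hβ.le
    have hd : ∀ s ∈ Ioo ε t, HasDerivAt (fun s => -((t / s - 1) ^ β / (β * t)))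
        (s ^ (-1 - β) * (t - s) ^ (β - 1)) s :=
      fun s hs => hasDerivAt_levy_primitive hβ (hε.trans hs.1) hs.2
    have hpos : ∀ s ∈ Ioo ε t, 0 ≤ s ^ (-1 - β) * (t - s) ^ (β - 1) := fun s hs => by
      have := hε.trans hs.1
      have := sub_pos.2 hs.2
      positivity
    have hInt := intervalIntegral.integrableOn_deriv_of_nonneg hcont hd hpos
    have hval := intervalIntegral.integral_eq_sub_of_hasDerivAt_of_le hlt.le hcont hd
      ((intervalIntegrable_iff_integrableOn_Ioc_of_le hlt.le).2 hInt)
    rw [intervalIntegral.integral_of_le hlt.le] at hval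
    rw [Measure.restrict_congr_set Ioo_ae_eq_Ioc, ← ofReal_integral_eq_lintegral_ofReal hInt, hval,
      div_self ht.ne', sub_self, Real.zero_rpow hβ.ne', max_eq_left]
    · congr 1; ring
    · rw [sub_nonneg, one_le_div hε]; exact hlt.le
    · rw [← Measure.restrict_congr_set Ioo_ae_eq_Ioc]
      filter_upwards [ae_restrict_mem measurableSet_Ioo] with s hs using hpos s hs

lemma residual_identity {β ε t : ℝ} (hβ : 0 < β) (hε : 0 < ε) (ht : 0 < t) :
    ENNReal.ofReal (ε ^ (-β) / β) * ENNReal.ofReal (t ^ (β - 1)) =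
      (∫⁻ s in Ioi 0, levyWeight β ε s *
        (Iio t).indicator (fun s => ENNReal.ofReal ((t - s) ^ (β - 1))) s) +
      residualWeight β ε t := by
  rw [lintegral_levyWeight_mul hβ hε ht]
  unfold residualWeight
  have hle : (max (t - ε) 0) ^ β ≤ t ^ β :=
    Real.rpow_le_rpow (le_max_right _ _) (max_le (by linarith) ht.le) hβ.le
  rw [← ENNReal.ofReal_mul (by positivity), ← ENNReal.ofReal_add (by positivity)]
  · congr 1
    have e1 : max (t / ε - 1) 0 = max (t - ε) 0 * ε⁻¹ := by
      rw [max_mul_of_nonneg _ _ (by positivity)]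
      congr 1
      · field_simp
      · simp
    rw [e1, Real.mul_rpow (le_max_right _ _) (by positivity), Real.inv_rpow hε.le,
      Real.rpow_neg hε.le, Real.rpow_sub_one ht.ne']
    field_simp
    ring
  · exact div_nonneg (mul_nonneg (by positivity) (sub_nonneg.2 hle)) (by positivity)

/-- The admissible range of the order `α` of the Riesz kernel. -/
structure RieszRange (n : ℕ) (α : ℝ) : Prop where
  pos : 0 < α
  lt_two : α < 2
  two_le : 2 ≤ n

lemma RieszRange.lt_dim {n : ℕ} {α : ℝ} (h : RieszRange n α) : α < n := by
  have : (2 : ℝ) ≤ n := by exact_mod_cast h.two_le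
  linarith [h.lt_two]

lemma RieszRange.half_pos {n : ℕ} {α : ℝ} (h : RieszRange n α) : 0 < α / 2 := by
  linarith [h.pos]

lemma RieszRange.half_lt_one {n : ℕ} {α : ℝ} (h : RieszRange n α) : α / 2 < 1 := by
  linarith [h.lt_two]

lemma RieszRange.half_lt {n : ℕ} {α : ℝ} (h : RieszRange n α) : α / 2 < (n : ℝ) / 2 := by
  linarith [h.lt_dim]

lemma residualWeight_le {β ε t : ℝ} (hβ : 0 < β) (hε : 0 < ε) (ht : 0 < t) :
    residualWeight β ε t ≤ ENNReal.ofReal (ε ^ (-β) / β) * ENNReal.ofReal (t ^ (β - 1)) := by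
  rw [residual_identity hβ hε ht]
  exact le_add_self

lemma residualWeight_le' {β ε t : ℝ} (hβ : 0 < β) (hβ1 : β ≤ 1) (hε : 0 < ε) (ht : 0 < t) :
    residualWeight β ε t ≤ ENNReal.ofReal (ε ^ (1 - β) / β) * ENNReal.ofReal (t ^ (β - 2)) := by
  unfold residualWeight
  rw [← ENNReal.ofReal_mul (by positivity)]
  apply ENNReal.ofReal_le_ofReal
  have h1 : max (t - ε) 0 = t * max (1 - ε / t) 0 := by
    rw [mul_max_of_nonneg _ _ ht.le]
    congr 1
    · field_simp
    · simp
  have hu0 : 0 ≤ max (1 - ε / t) 0 := le_max_right _ _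
  have hu1 : max (1 - ε / t) 0 ≤ 1 := max_le (by linarith [div_pos hε ht]) zero_le_one
  have h2 : 1 - ε / t ≤ (max (1 - ε / t) 0) ^ β :=
    (le_max_left _ _).trans (by
      simpa using Real.rpow_le_rpow_of_exponent_ge' hu0 hu1 hβ.le hβ1)
  rw [h1, Real.mul_rpow ht.le hu0]
  have h3 : t ^ β - t ^ β * (max (1 - ε / t) 0) ^ β ≤ t ^ β * (ε / t) := by
    have : 0 < t ^ β := by positivity
    nlinarith
  calc _ ≤ ε ^ (-β) * (t ^ β * (ε / t)) / (β * t) := by gcongr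
    _ = _ := by
      rw [show (1 - β) = -β + 1 by ring, Real.rpow_add_one hε.ne',
        show (β - 2) = β - 1 - 1 by ring, Real.rpow_sub_one ht.ne', Real.rpow_sub_one ht.ne']
      field_simp

lemma residualWeight_scale {β ε t : ℝ} (hε : 0 < ε) (ht : 0 < t) :
    residualWeight β ε t = ENNReal.ofReal ε⁻¹ * residualWeight β 1 (ε⁻¹ * t) := by
  unfold residualWeight
  rw [← ENNReal.ofReal_mul (by positivity)]
  congr 1
  have h1 : max (ε⁻¹ * t - 1) 0 = ε⁻¹ * max (t - ε) 0 := by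
    rw [mul_max_of_nonneg _ _ (by positivity)]
    congr 1
    · field_simp
    · simp
  rw [h1, Real.mul_rpow (by positivity) ht.le, Real.mul_rpow (by positivity) (le_max_right _ _),
    Real.inv_rpow hε.le, Real.rpow_neg hε.le, Real.one_rpow]
  field_simp

lemma lintegral_Ioi_comp_mul {a : ℝ} (ha : 0 < a) {f : ℝ → ℝ≥0∞} (hf : Measurable f) :
    ∫⁻ t in Ioi 0, ENNReal.ofReal a * f (a * t) = ∫⁻ t in Ioi 0, f t := by
  have h := Real.smul_map_volume_mul_left ha.ne'
  rw [abs_of_pos ha] at h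
  calc _ = ENNReal.ofReal a * ∫⁻ t, (Ioi (0 : ℝ)).indicator f (a * t) := by
        rw [lintegral_const_mul _ (by fun_prop), ← lintegral_indicator measurableSet_Ioi]
        congr 2
        ext t
        by_cases ht : 0 < t
        · rw [indicator_of_mem (show t ∈ Ioi 0 from ht),
            indicator_of_mem (show a * t ∈ Ioi 0 from mul_pos ha ht)]
        · rw [indicator_of_notMem (show t ∉ Ioi 0 from ht), indicator_of_notMem]
          exact fun h => ht (pos_of_mul_pos_right h ha.le)
    _ = ENNReal.ofReal a * ∫⁻ t, (Ioi (0 : ℝ)).indicator f t ∂(Measure.map (a * ·) volume) := by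
        rw [lintegral_map (hf.indicator measurableSet_Ioi) (by fun_prop)]
    _ = ∫⁻ t, (Ioi (0 : ℝ)).indicator f t
          ∂(ENNReal.ofReal a • Measure.map (a * ·) volume) := by
        rw [lintegral_smul_measure, smul_eq_mul]
    _ = _ := by rw [h, lintegral_indicator measurableSet_Ioi]

lemma lintegral_residualWeight {β ε : ℝ} (hε : 0 < ε) :
    ∫⁻ t in Ioi 0, residualWeight β ε t = ∫⁻ t in Ioi 0, residualWeight β 1 t := by
  rw [← lintegral_Ioi_comp_mul (inv_pos.2 hε) (measurable_residualWeight β 1)]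
  apply setLIntegral_congr_fun measurableSet_Ioi
  intro t ht
  exact residualWeight_scale hε ht

lemma lintegral_residualWeight_ne_top {β : ℝ} (hβ : 0 < β) (hβ1 : β < 1) :
    ∫⁻ t in Ioi 0, residualWeight β 1 t ≠ ⊤ := by
  have h1 : ∫⁻ t in Ioc (0 : ℝ) 1, ENNReal.ofReal (t ^ (β - 1)) ≠ ⊤ := by
    have := intervalIntegral.intervalIntegrable_rpow' (a := 0) (b := 1) (r := β - 1) (by linarith)
    rw [intervalIntegrable_iff_integrableOn_Ioc_of_le zero_le_one] at this
    exact (this.lintegral_lt_top).ne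
  have h2 : ∫⁻ t in Ioi (1 : ℝ), ENNReal.ofReal (t ^ (β - 2)) ≠ ⊤ :=
    (integrableOn_Ioi_rpow_of_lt (a := β - 2) (by linarith) one_pos).lintegral_lt_top.ne
  rw [← Ioc_union_Ioi_eq_Ioi zero_le_one]
  refine ((lintegral_union_le _ _ _).trans_lt (ENNReal.add_lt_top.2 ⟨?_, ?_⟩)).ne
  · calc _ ≤ ∫⁻ t in Ioc (0 : ℝ) 1, ENNReal.ofReal (1 ^ (-β) / β) * ENNReal.ofReal (t ^ (β - 1)) :=
          setLIntegral_mono (by fun_prop) fun t ht => residualWeight_le hβ one_pos ht.1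
      _ < ⊤ := by
          rw [lintegral_const_mul _ (by fun_prop)]
          exact ENNReal.mul_lt_top ENNReal.ofReal_lt_top (lt_top_iff_ne_top.2 h1)
  · calc _ ≤ ∫⁻ t in Ioi (1 : ℝ), ENNReal.ofReal (1 ^ (1 - β) / β) * ENNReal.ofReal (t ^ (β - 2)) :=
          setLIntegral_mono (by fun_prop) fun t ht =>
            residualWeight_le' hβ hβ1.le one_pos (one_pos.trans ht)
      _ < ⊤ := by
          rw [lintegral_const_mul _ (by fun_prop)]
          exact ENNReal.mul_lt_top ENNReal.ofReal_lt_top (lt_top_iff_ne_top.2 h2)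

lemma residualWeight_pos {β ε t : ℝ} (hβ : 0 < β) (hε : 0 < ε) (ht : 0 < t) :
    0 < residualWeight β ε t := by
  unfold residualWeight
  rw [ENNReal.ofReal_pos]
  have : (max (t - ε) 0) ^ β < t ^ β :=
    Real.rpow_lt_rpow (le_max_right _ _) (max_lt (by linarith) ht) hβ
  have := sub_pos.2 this
  positivity

lemma heat_pos (n : ℕ) {t : ℝ} (ht : 0 < t) (x : Rn n) : 0 < heat n t x := by
  unfold heat
  rw [ENNReal.ofReal_pos]
  positivity

/-- The truncation parameters `1 / (j + 1)`. -/
noncomputable def trunc (j : ℕ) : ℝ := 1 / ((j : ℝ) + 1)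

lemma trunc_pos (j : ℕ) : 0 < trunc j := by unfold trunc; positivity

lemma tendsto_trunc : Tendsto trunc atTop (𝓝 0) := tendsto_one_div_add_atTop_nhds_zero_nat

lemma trunc_anti {i j : ℕ} (h : i ≤ j) : trunc j ≤ trunc i := Nat.one_div_le_one_div h

/-- Truncated Lévy kernel of the fractional Laplacian. -/
noncomputable def levyKer (n : ℕ) (α : ℝ) (j : ℕ) (x : Rn n) : ℝ≥0∞ :=
  heatMix n (levyWeight (α / 2) (trunc j)) x

/-- Residual kernel: the truncated fractional Laplacian of the Riesz kernel. -/
noncomputable def resKer (n : ℕ) (α : ℝ) (j : ℕ) (x : Rn n) : ℝ≥0∞ :=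
  ENNReal.ofReal (rieszConst n (α / 2))⁻¹ * heatMix n (residualWeight (α / 2) (trunc j)) x

/-- Total mass of the truncated Lévy kernel. -/
noncomputable def levyMass (α : ℝ) (j : ℕ) : ℝ≥0∞ :=
  ENNReal.ofReal (trunc j ^ (-(α / 2)) / (α / 2))

/-- Total mass of the residual kernels. -/
noncomputable def resMass (n : ℕ) (α : ℝ) : ℝ≥0∞ :=
  ENNReal.ofReal (rieszConst n (α / 2))⁻¹ * ∫⁻ t in Ioi 0, residualWeight (α / 2) 1 t

section kernels
variable {n : ℕ} {α : ℝ}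

lemma measurable_levyKer (j : ℕ) : Measurable (levyKer n α j) :=
  measurable_heatMix n (measurable_levyWeight _ _)

lemma measurable_resKer (j : ℕ) : Measurable (resKer n α j) :=
  (measurable_heatMix n (measurable_residualWeight _ _)).const_mul _

lemma levyKer_neg (j : ℕ) (x : Rn n) : levyKer n α j (-x) = levyKer n α j x := heatMix_neg _ _ _

lemma resKer_neg (j : ℕ) (x : Rn n) : resKer n α j (-x) = resKer n α j x := by
  simp [resKer, heatMix_neg]

lemma resKer_sub_comm (j : ℕ) (x y : Rn n) : resKer n α j (x - y) = resKer n α j (y - x) := by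
  rw [← resKer_neg, neg_sub]

lemma levyMass_ne_top (j : ℕ) : levyMass α j ≠ ⊤ := ENNReal.ofReal_ne_top

lemma lintegral_levyKer (h : RieszRange n α) (j : ℕ) : ∫⁻ x, levyKer n α j x = levyMass α j := by
  unfold levyKer levyMass
  rw [lintegral_heatMix n (measurable_levyWeight _ _), lintegral_levyWeight h.half_pos (trunc_pos j)]

lemma lintegral_resKer (j : ℕ) : ∫⁻ x, resKer n α j x = resMass n α := by
  unfold resKer resMass
  rw [lintegral_const_mul _ (measurable_heatMix n (measurable_residualWeight _ _)),
    lintegral_heatMix n (measurable_residualWeight _ _), lintegral_residualWeight (trunc_pos j)]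

lemma resMass_ne_top (h : RieszRange n α) : resMass n α ≠ ⊤ :=
  ENNReal.mul_ne_top ENNReal.ofReal_ne_top
    (lintegral_residualWeight_ne_top h.half_pos h.half_lt_one)

lemma resMass_ne_zero (h : RieszRange n α) : resMass n α ≠ 0 := by
  refine mul_ne_zero ?_ ?_
  · simpa using rieszConst_pos h.half_lt
  · apply ne_of_gt
    rw [setLIntegral_pos_iff (measurable_residualWeight _ _)]
    refine lt_of_lt_of_le (b := volume (Ioi (0 : ℝ))) (by simp) (measure_mono fun t ht => ?_)
    exact ⟨(residualWeight_pos h.half_pos one_pos ht).ne', ht⟩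

lemma levyKer_mono {i j : ℕ} (hij : i ≤ j) (x : Rn n) : levyKer n α i x ≤ levyKer n α j x := by
  unfold levyKer heatMix
  apply lintegral_mono
  intro t
  simp only []
  gcongr
  unfold levyWeight
  exact indicator_le_indicator_of_subset (Ioi_subset_Ioi (trunc_anti hij)) (fun _ => zero_le) _

lemma levyKer_pos (j : ℕ) (x : Rn n) : 0 < levyKer n α j x := by
  unfold levyKer heatMix
  have hm : Measurable fun t => levyWeight (α / 2) (trunc j) t * heat n t x :=
    (measurable_levyWeight _ _).mul ((measurable_heat n).comp (measurable_id.prodMk measurable_const))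
  rw [setLIntegral_pos_iff hm]
  refine lt_of_lt_of_le (b := volume (Ioi (trunc j))) (by simp) (measure_mono fun t ht => ?_)
  have ht0 : 0 < t := (trunc_pos j).trans ht
  refine ⟨?_, ht0⟩
  rw [Function.mem_support]
  refine mul_ne_zero ?_ (heat_pos n ht0 x).ne'
  unfold levyWeight
  rw [indicator_of_mem ht]
  simp only [ne_eq, ENNReal.ofReal_eq_zero, not_le]
  positivity

lemma riesz_comm (x y : Rn n) : riesz n α x y = riesz n α y x := by
  unfold riesz
  simp [norm_sub_rev, eq_comm]

lemma measurable_riesz (h : RieszRange n α) :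
    Measurable fun q : Rn n × Rn n => riesz n α q.1 q.2 := by
  simp_rw [riesz_eq_heatMix h.lt_dim]
  exact ((measurable_heatMix n (by fun_prop)).comp (measurable_fst.sub measurable_snd)).const_mul _

/-- The truncated fractional Laplacian maps the Riesz kernel to the residual kernel. -/
lemma levyMass_mul_riesz (h : RieszRange n α) (j : ℕ) (x y : Rn n) :
    levyMass α j * riesz n α x y =
      (∫⁻ z, levyKer n α j (x - z) * riesz n α z y) + resKer n α j (x - y) := by
  have hh : Measurable fun t => heat n t (x - y) :=
    (measurable_heat n).comp (measurable_id.prodMk measurable_const)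
  set w : ℝ → ℝ≥0∞ := fun t => ENNReal.ofReal (t ^ (α / 2 - 1)) with hw
  have hwm : Measurable w := by fun_prop
  have hlm := measurable_levyWeight (α / 2) (trunc j)
  have h1 : ∫⁻ z, levyKer n α j (x - z) * riesz n α z y =
      ENNReal.ofReal (rieszConst n (α / 2))⁻¹ *
        ∫⁻ t in Ioi 0, (∫⁻ s in Ioi 0, levyWeight (α / 2) (trunc j) s *
          (Iio t).indicator (fun s => ENNReal.ofReal ((t - s) ^ (α / 2 - 1))) s) *
            heat n t (x - y) := by
    simp_rw [riesz_eq_heatMix h.lt_dim]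
    have e1 : ∀ z, levyKer n α j (x - z) * (ENNReal.ofReal (rieszConst n (α / 2))⁻¹ *
        heatMix n w (z - y)) = ENNReal.ofReal (rieszConst n (α / 2))⁻¹ *
        (levyKer n α j (x - z) * heatMix n w (z - y)) := fun z => by ring
    simp_rw [← hw, e1]
    rw [lintegral_const_mul]
    swap
    · exact ((measurable_levyKer j).comp (measurable_const.sub measurable_id)).mul
        ((measurable_heatMix n hwm).comp (measurable_id.sub_const y))
    congr 1
    unfold levyKer
    rw [lintegral_heatMix_mul_heatMix n hlm hwm]
    have e2 : ∀ s ∈ Ioi (0 : ℝ), levyWeight (α / 2) (trunc j) s *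
        ∫⁻ t in Ioi 0, w t * heat n (s + t) (x - y) =
        ∫⁻ t in Ioi 0, levyWeight (α / 2) (trunc j) s *
          (Iio t).indicator (fun s => ENNReal.ofReal ((t - s) ^ (α / 2 - 1))) s *
            heat n t (x - y) := by
      intro s hs
      have hs : 0 < s := hs
      have e3 : ∫⁻ t in Ioi 0, w t * heat n (s + t) (x - y) =
          ∫⁻ t in Ioi 0, (Ioi (0 : ℝ)).indicator w (t - s) * heat n t (x - y) := by
        rw [← lintegral_indicator measurableSet_Ioi, ← lintegral_indicator measurableSet_Ioi,
          ← lintegral_sub_right_eq_self (μ := volume) _ s]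
        congr 1
        ext t
        by_cases hts : 0 < t - s
        · rw [indicator_of_mem (show t - s ∈ Ioi 0 from hts),
            indicator_of_mem (show t ∈ Ioi 0 by simp only [mem_Ioi]; linarith),
            indicator_of_mem (show t - s ∈ Ioi 0 from hts), add_sub_cancel]
        · rw [indicator_of_notMem (show t - s ∉ Ioi 0 from hts)]
          by_cases ht : 0 < t
          · rw [indicator_of_mem (show t ∈ Ioi 0 from ht),
              indicator_of_notMem (show t - s ∉ Ioi 0 from hts), zero_mul]
          · rw [indicator_of_notMem (show t ∉ Ioi 0 from ht)]
      rw [e3, ← lintegral_const_mul]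
      · congr 1
        ext t
        rw [mul_assoc]
        congr 2
        by_cases hts : s < t
        · rw [indicator_of_mem (show t - s ∈ Ioi 0 from sub_pos.2 hts),
            indicator_of_mem (show s ∈ Iio t from hts)]
        · rw [indicator_of_notMem (show t - s ∉ Ioi 0 from fun h => hts (sub_pos.1 h)),
            indicator_of_notMem (show s ∉ Iio t from hts)]
      · exact ((hwm.indicator measurableSet_Ioi).comp (measurable_id.sub_const s)).mul hh
    rw [setLIntegral_congr_fun measurableSet_Ioi e2]
    have hind : Measurable fun q : ℝ × ℝ =>
        (Iio q.2).indicator (fun s => ENNReal.ofReal ((q.2 - s) ^ (α / 2 - 1))) q.1 := by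
      have : (fun q : ℝ × ℝ =>
        (Iio q.2).indicator (fun s => ENNReal.ofReal ((q.2 - s) ^ (α / 2 - 1))) q.1) =
        {q : ℝ × ℝ | q.1 < q.2}.indicator
          (fun q => ENNReal.ofReal ((q.2 - q.1) ^ (α / 2 - 1))) := by
        ext q
        simp [indicator]
      rw [this]
      exact Measurable.indicator (by fun_prop) (measurableSet_lt measurable_fst measurable_snd)
    rw [lintegral_lintegral_swap]
    · congr 1
      ext t
      rw [lintegral_mul_const]
      exact hlm.mul (hind.comp (measurable_id.prodMk measurable_const))
    · exact (((hlm.comp measurable_fst).mul hind).mul (hh.comp measurable_snd)).aemeasurable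
  rw [h1]
  unfold resKer levyMass
  rw [riesz_eq_heatMix h.lt_dim, ← mul_add, mul_left_comm]
  congr 1
  unfold heatMix
  rw [← lintegral_const_mul _ (f := fun t => ENNReal.ofReal (t ^ (α / 2 - 1)) * heat n t (x - y))
    (hwm.mul hh), ← lintegral_add_right]
  · apply setLIntegral_congr_fun measurableSet_Ioi
    intro t ht
    simp only []
    rw [← mul_assoc, residual_identity h.half_pos (trunc_pos j) ht, add_mul]
  · exact (measurable_residualWeight _ _).mul hh

end kernels

section estimates
variable {n : ℕ} {α : ℝ}

lemma riesz_eq_enorm_rpow (h : RieszRange n α) (x y : Rn n) :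
    riesz n α x y = ‖x - y‖ₑ ^ (α - (n : ℝ)) := by
  unfold riesz
  have hneg : α - n < 0 := sub_neg.2 h.lt_dim
  split_ifs with hxy
  · rw [hxy, sub_self, enorm_zero, ENNReal.zero_rpow_of_neg hneg]
  · rw [← ofReal_norm, ENNReal.ofReal_rpow_of_pos (norm_pos_iff.2 (sub_ne_zero.2 hxy))]

lemma continuous_riesz (h : RieszRange n α) :
    Continuous fun q : Rn n × Rn n => riesz n α q.1 q.2 := by
  simp_rw [riesz_eq_enorm_rpow h]
  exact ENNReal.continuous_rpow_const.comp (continuous_fst.sub continuous_snd).enorm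

lemma riesz_self (x : Rn n) : riesz n α x x = ⊤ := by simp [riesz]

lemma riesz_ne_top {x y : Rn n} (hxy : x ≠ y) : riesz n α x y ≠ ⊤ := by
  simp [riesz, hxy]

lemma riesz_le_of_le_dist (h : RieszRange n α) {d : ℝ} (hd : 0 < d) {x y : Rn n}
    (hxy : d ≤ dist x y) : riesz n α x y ≤ ENNReal.ofReal (d ^ (α - (n : ℝ))) := by
  rw [dist_eq_norm] at hxy
  have hne : x ≠ y := by
    rintro rfl
    simp at hxy
    linarith
  simp only [riesz, hne, if_false]
  exact ENNReal.ofReal_le_ofReal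
    (Real.rpow_le_rpow_of_nonpos hd hxy (sub_neg.2 h.lt_dim).le)

/-- Coefficient in the decay estimate of the residual kernels. -/
noncomputable def resDecay (n : ℕ) (α : ℝ) (j : ℕ) : ℝ :=
  (rieszConst n (α / 2))⁻¹ * (trunc j ^ (1 - α / 2) / (α / 2)) * rieszConst n (α / 2 - 1)

lemma resDecay_nonneg (h : RieszRange n α) (j : ℕ) : 0 ≤ resDecay n α j := by
  have h1 := rieszConst_pos h.half_lt
  have h2 : 0 < rieszConst n (α / 2 - 1) := rieszConst_pos (by linarith [h.half_lt])
  have h3 := trunc_pos j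
  have h4 := h.half_pos
  unfold resDecay
  positivity

lemma tendsto_resDecay (h : RieszRange n α) : Tendsto (resDecay n α) atTop (𝓝 0) := by
  have hb : 0 < 1 - α / 2 := sub_pos.2 h.half_lt_one
  have h1 : Tendsto (fun j => trunc j ^ (1 - α / 2)) atTop (𝓝 0) := by
    have := (Real.continuousAt_rpow_const 0 (1 - α / 2) (Or.inr hb.le)).tendsto.comp tendsto_trunc
    rwa [Real.zero_rpow hb.ne'] at this
  have h2 := ((h1.div_const (α / 2)).const_mul (rieszConst n (α / 2))⁻¹).mul_const
    (rieszConst n (α / 2 - 1))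
  unfold resDecay
  simpa using h2

lemma resKer_le (h : RieszRange n α) (j : ℕ) {x : Rn n} (hx : x ≠ 0) :
    resKer n α j x ≤ ENNReal.ofReal (resDecay n α j * ‖x‖ ^ (α - 2 - n)) := by
  have h1 := rieszConst_pos h.half_lt
  have h2 : 0 < rieszConst n (α / 2 - 1) := rieszConst_pos (by linarith [h.half_lt])
  have h3 := trunc_pos j
  have h4 := h.half_pos
  have hm : Measurable fun t => heat n t x :=
    (measurable_heat n).comp (measurable_id.prodMk measurable_const)
  have key : heatMix n (residualWeight (α / 2) (trunc j)) x ≤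
      ENNReal.ofReal (trunc j ^ (1 - α / 2) / (α / 2)) *
        heatMix n (fun t => ENNReal.ofReal (t ^ ((α / 2 - 1) - 1))) x := by
    unfold heatMix
    rw [← lintegral_const_mul]
    · apply setLIntegral_mono (by fun_prop)
      intro t ht
      rw [← mul_assoc]
      gcongr
      rw [show α / 2 - 1 - 1 = α / 2 - 2 by ring]
      exact residualWeight_le' h4 h.half_lt_one.le h3 ht
    · fun_prop
  rw [heatMix_rpow (by linarith [h.half_lt]) hx] at key
  unfold resKer
  refine (mul_le_mul_right key _).trans (le_of_eq ?_)
  rw [← ENNReal.ofReal_mul (by positivity), ← ENNReal.ofReal_mul (by positivity)]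
  congr 1
  unfold resDecay
  rw [show 2 * (α / 2 - 1) - (n : ℝ) = α - 2 - n by ring]
  ring

lemma resKer_le_riesz (h : RieszRange n α) {r : ℝ} (hr : 0 < r) (j : ℕ) {x y : Rn n}
    (hxy : r ≤ dist x y) :
    resKer n α j (x - y) ≤ ENNReal.ofReal (resDecay n α j * r ^ (-2 : ℝ)) * riesz n α x y := by
  rw [dist_eq_norm] at hxy
  have hpos : 0 < ‖x - y‖ := hr.trans_le hxy
  have hne : x ≠ y := sub_ne_zero.1 (norm_pos_iff.1 hpos)
  have hd := resDecay_nonneg h j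
  refine (resKer_le h j (sub_ne_zero.2 hne)).trans ?_
  simp only [riesz, hne, if_false]
  rw [← ENNReal.ofReal_mul (by positivity)]
  apply ENNReal.ofReal_le_ofReal
  rw [show α - 2 - (n : ℝ) = -2 + (α - n) by ring, Real.rpow_add hpos, mul_assoc]
  gcongr ?_ * (?_ * ?_)
  exact Real.rpow_le_rpow_of_nonpos hr hxy (by norm_num)

lemma tendsto_ofReal_resDecay_mul (h : RieszRange n α) (c : ℝ) :
    Tendsto (fun j => ENNReal.ofReal (resDecay n α j * c)) atTop (𝓝 0) := by
  have := ENNReal.tendsto_ofReal ((tendsto_resDecay h).mul_const c)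
  simpa using this

lemma tendsto_resKer_tail (h : RieszRange n α) {r : ℝ} (hr : 0 < r) :
    Tendsto (fun j => ∫⁻ x in (Metric.ball (0 : Rn n) r)ᶜ, resKer n α j x) atTop (𝓝 0) := by
  set p : ℝ := n + 2 - α with hp
  have hfin := finite_integral_one_add_norm (E := Rn n) (μ := volume) (r := p) (by
    simp only [finrank_euclideanSpace, Fintype.card_fin]; linarith [h.lt_two])
  have hlim : Tendsto (fun j => ENNReal.ofReal (resDecay n α j * (r / (1 + r)) ^ (-p)) *
      ∫⁻ x : Rn n, ENNReal.ofReal ((1 + ‖x‖) ^ (-p))) atTop (𝓝 0) := by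
    have := ENNReal.Tendsto.mul_const (b := ∫⁻ x : Rn n, ENNReal.ofReal ((1 + ‖x‖) ^ (-p)))
      (tendsto_ofReal_resDecay_mul h ((r / (1 + r)) ^ (-p))) (Or.inr hfin.ne)
    simpa using this
  refine tendsto_of_tendsto_of_tendsto_of_le_of_le tendsto_const_nhds hlim (fun _ => zero_le) ?_
  intro j
  have hd := resDecay_nonneg h j
  simp only []
  rw [← lintegral_const_mul _ (by fun_prop)]
  refine (setLIntegral_mono (by fun_prop) fun x hx => ?_).trans (setLIntegral_le_lintegral _ _)
  have hx : r ≤ ‖x‖ := by simpa using hx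
  have hx0 : 0 < ‖x‖ := hr.trans_le hx
  refine (resKer_le h j (norm_pos_iff.1 hx0)).trans ?_
  rw [← ENNReal.ofReal_mul (by positivity)]
  apply ENNReal.ofReal_le_ofReal
  rw [mul_assoc, ← Real.mul_rpow (by positivity) (by positivity),
    show α - 2 - (n : ℝ) = -p by rw [hp]; ring]
  gcongr ?_ * ?_
  apply Real.rpow_le_rpow_of_nonpos (by positivity)
  · rw [div_mul_eq_mul_div, div_le_iff₀ (by positivity)]
    nlinarith
  · have : (2 : ℝ) ≤ n := by exact_mod_cast h.two_le
    linarith [h.lt_two]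

lemma heat_le (n : ℕ) (hn : 0 < n) {t : ℝ} (ht : 0 < t) {x : Rn n} (hx : x ≠ 0) :
    heat n t x ≤ ENNReal.ofReal ((n / 2) ^ ((n : ℝ) / 2) * ‖x‖ ^ (-(n : ℝ))) := by
  have hx' : 0 < ‖x‖ := norm_pos_iff.2 hx
  have hn' : (0 : ℝ) < n := by exact_mod_cast hn
  unfold heat
  apply ENNReal.ofReal_le_ofReal
  set m : ℝ := n / 2 with hm
  have hm0 : 0 < m := by positivity
  have hu : 0 < Real.pi / t * ‖x‖ ^ 2 := by positivity
  have h1 : (t⁻¹ * ‖x‖ ^ 2 / m) ^ m ≤ Real.exp (Real.pi / t * ‖x‖ ^ 2) := by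
    have e1 : t⁻¹ * ‖x‖ ^ 2 / m ≤ Real.exp (Real.pi / t * ‖x‖ ^ 2 / m) := by
      refine le_trans ?_ ((le_add_of_nonneg_right zero_le_one).trans (Real.add_one_le_exp _))
      rw [div_eq_mul_inv Real.pi t, mul_assoc]
      have hq : 0 ≤ t⁻¹ * ‖x‖ ^ 2 := by positivity
      have hpi : 1 ≤ Real.pi := by linarith [Real.pi_gt_three]
      exact div_le_div_of_nonneg_right (le_mul_of_one_le_left hq hpi) hm0.le
    calc _ ≤ Real.exp (Real.pi / t * ‖x‖ ^ 2 / m) ^ m := by gcongr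
      _ = _ := by rw [← Real.exp_mul, div_mul_cancel₀ _ hm0.ne']
  rw [neg_mul, Real.exp_neg, ← div_eq_mul_inv, div_le_iff₀ (by positivity)]
  calc t ^ (-m) = m ^ m * ‖x‖ ^ (-(n : ℝ)) * (t⁻¹ * ‖x‖ ^ 2 / m) ^ m := by
        rw [Real.div_rpow (by positivity) hm0.le, Real.mul_rpow (by positivity) (by positivity),
          Real.inv_rpow ht.le, ← Real.rpow_neg ht.le, ← Real.rpow_natCast, ← Real.rpow_mul hx'.le,
          show ((2 : ℕ) : ℝ) * m = n by rw [hm]; push_cast; ring, Real.rpow_neg hx'.le]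
        field_simp
    _ ≤ _ := by gcongr

lemma resKer_le_uniform (h : RieszRange n α) (j : ℕ) {x : Rn n} (hx : x ≠ 0) :
    resKer n α j x ≤
      resMass n α * ENNReal.ofReal ((n / 2) ^ ((n : ℝ) / 2) * ‖x‖ ^ (-(n : ℝ))) := by
  unfold resKer resMass heatMix
  rw [← lintegral_residualWeight (trunc_pos j), mul_assoc,
    ← lintegral_mul_const _ (measurable_residualWeight _ _)]
  refine mul_le_mul_right ?_ _
  apply setLIntegral_mono ((measurable_residualWeight _ _).mul_const _)
  intro t ht
  gcongr
  exact heat_le n (by linarith [h.two_le]) ht hx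

/-- The Riesz potential of the restriction of Lebesgue measure to a set. -/
lemma setLIntegral_riesz_le (h : RieszRange n α) {R : ℝ} (hR : 0 < R) (x : Rn n) (S : Set (Rn n)) :
    ∫⁻ z in S, riesz n α x z ≤ ENNReal.ofReal (rieszConst n (α / 2))⁻¹ *
      (ENNReal.ofReal (R ^ (α / 2) / (α / 2)) +
        volume S * ENNReal.ofReal (R ^ (α / 2 - n / 2) / (n / 2 - α / 2))) := by
  have hwm : Measurable fun t : ℝ => ENNReal.ofReal (t ^ (α / 2 - 1)) := by fun_prop
  have hb := h.half_pos
  have hnb : 0 < (n : ℝ) / 2 - α / 2 := sub_pos.2 h.half_lt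
  have hmx : Measurable fun z : Rn n => x - z := measurable_const.sub measurable_id
  simp_rw [riesz_eq_heatMix h.lt_dim]
  rw [lintegral_const_mul _ (f := fun z => heatMix n (fun t => ENNReal.ofReal (t ^ (α / 2 - 1)))
    (x - z)) ((measurable_heatMix n hwm).comp hmx)]
  gcongr
  have e := lintegral_heatMix_mul n hwm (f := fun _ => 1) measurable_const x (volume.restrict S)
  simp only [mul_one] at e
  have hI1 := intervalIntegral.intervalIntegrable_rpow' (a := 0) (b := R) (r := α / 2 - 1)
    (by linarith)
  rw [e, ← Ioc_union_Ioi_eq_Ioi hR.le]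
  refine (lintegral_union_le _ _ _).trans (add_le_add ?_ ?_)
  · calc _ ≤ ∫⁻ t in Ioc 0 R, ENNReal.ofReal (t ^ (α / 2 - 1)) := by
          apply setLIntegral_mono hwm
          intro t ht
          refine mul_le_of_le_one_right' ?_
          refine (setLIntegral_le_lintegral _ _).trans (le_of_eq ?_)
          rw [lintegral_sub_left_eq_self (μ := volume) (heat n t) x, lintegral_heat n ht.1]
      _ = _ := by
          have hInt := (intervalIntegrable_iff_integrableOn_Ioc_of_le hR.le).1 hI1
          rw [← ofReal_integral_eq_lintegral_ofReal hInt,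
            ← intervalIntegral.integral_of_le hR.le, integral_rpow (Or.inl (by linarith)),
            sub_add_cancel, Real.zero_rpow hb.ne', sub_zero]
          filter_upwards [ae_restrict_mem measurableSet_Ioc] with t ht
          have := ht.1
          simp only [Pi.zero_apply]
          positivity
  · calc _ ≤ ∫⁻ t in Ioi R, volume S * ENNReal.ofReal (t ^ (α / 2 - n / 2 - 1)) := by
          apply setLIntegral_mono (by fun_prop)
          intro t ht
          have ht0 : 0 < t := hR.trans ht
          have e2 : ∫⁻ z in S, heat n t (x - z) ≤ ENNReal.ofReal (t ^ (-((n : ℝ) / 2))) * volume S := by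
            refine (lintegral_mono (g := fun _ => ENNReal.ofReal (t ^ (-((n : ℝ) / 2)))) ?_).trans ?_
            · intro z
              apply ENNReal.ofReal_le_ofReal
              refine mul_le_of_le_one_right (by positivity) ?_
              rw [Real.exp_le_one_iff]
              have : 0 ≤ Real.pi / t * ‖x - z‖ ^ 2 := by positivity
              linarith
            · simp
          calc _ ≤ ENNReal.ofReal (t ^ (α / 2 - 1)) *
                (ENNReal.ofReal (t ^ (-((n : ℝ) / 2))) * volume S) := by gcongr
            _ = _ := by
                rw [← mul_assoc, ← ENNReal.ofReal_mul (by positivity), ← Real.rpow_add ht0, mul_comm]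
                congr 3
                ring
      _ = _ := by
          have hInt := integrableOn_Ioi_rpow_of_lt (a := α / 2 - n / 2 - 1) (by linarith) hR
          rw [lintegral_const_mul _ (by fun_prop), ← ofReal_integral_eq_lintegral_ofReal hInt,
            integral_Ioi_rpow_of_lt (by linarith) hR]
          · congr 2
            rw [sub_add_cancel, ← neg_sub ((n : ℝ) / 2) (α / 2), neg_div_neg_eq]
          · filter_upwards [ae_restrict_mem measurableSet_Ioi] with t ht
            have : 0 < t := hR.trans ht
            simp only [Pi.zero_apply]
            positivity

lemma exists_setLIntegral_riesz_ball_le (h : RieszRange n α) :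
    ∃ C : ℝ≥0∞, C ≠ ⊤ ∧ ∀ (x : Rn n) (d : ℝ), 0 < d →
      ∫⁻ z in Metric.ball x d, riesz n α x z ≤ C * ENNReal.ofReal (d ^ α) := by
  have hb := h.half_pos
  have hnb : 0 < (n : ℝ) / 2 - α / 2 := sub_pos.2 h.half_lt
  refine ⟨ENNReal.ofReal (rieszConst n (α / 2))⁻¹ * (ENNReal.ofReal (1 / (α / 2)) +
    volume (Metric.ball (0 : Rn n) 1) * ENNReal.ofReal (1 / (n / 2 - α / 2))), ?_, ?_⟩
  · exact ENNReal.mul_ne_top ENNReal.ofReal_ne_top (ENNReal.add_ne_top.2 ⟨ENNReal.ofReal_ne_top,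
      ENNReal.mul_ne_top measure_ball_lt_top.ne ENNReal.ofReal_ne_top⟩)
  · intro x d hd
    refine (setLIntegral_riesz_le h (R := d ^ 2) (by positivity) x _).trans (le_of_eq ?_)
    have e0 : ∀ p : ℝ, (d ^ 2) ^ p = d ^ (2 * p) := fun p => by
      rw [← Real.rpow_natCast, ← Real.rpow_mul hd.le]; norm_cast
    rw [mul_assoc, add_mul, Measure.addHaar_ball_of_pos _ _ hd, e0, e0]
    simp only [finrank_euclideanSpace, Fintype.card_fin]
    congr 2
    · rw [← ENNReal.ofReal_mul (by positivity)]
      congr 1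
      rw [show 2 * (α / 2) = α by ring]
      ring
    · rw [mul_comm (ENNReal.ofReal (d ^ n)), mul_assoc, mul_assoc,
        ← ENNReal.ofReal_mul (by positivity), ← ENNReal.ofReal_mul (by positivity)]
      congr 2
      rw [← Real.rpow_natCast, ← mul_div_assoc, ← Real.rpow_add hd]
      rw [show (n : ℝ) + 2 * (α / 2 - n / 2) = α by ring]
      ring

/-- The residual kernels keep a fixed amount of mass on balls of shrinking radius. -/
lemma exists_le_setLIntegral_resKer_ball (h : RieszRange n α) :
    ∃ θ : ℝ≥0∞, θ ≠ 0 ∧ ∃ s : ℕ → ℝ, (∀ j, 0 < s j) ∧ Tendsto s atTop (𝓝 0) ∧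
      ∀ j (y : Rn n), ‖y‖ ≤ s j → θ ≤ ∫⁻ z in Metric.ball y (s j), resKer n α j z := by
  have hA := rieszConst_pos h.half_lt
  have hb := h.half_pos
  set m : ℝ := (rieszConst n (α / 2))⁻¹ * (1 / (2 * (α / 2)) * Real.exp (-(8 * Real.pi))) with hm
  have hm0 : 0 < m := by positivity
  refine ⟨ENNReal.ofReal m * volume (Metric.ball (0 : Rn n) 1), ?_, fun j => √(trunc j),
    fun j => Real.sqrt_pos.2 (trunc_pos j), ?_, ?_⟩
  · exact mul_ne_zero (by simpa using hm0) (Metric.measure_ball_pos _ _ one_pos).ne'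
  · have := (Real.continuous_sqrt.tendsto 0).comp tendsto_trunc
    rwa [Real.sqrt_zero] at this
  · intro j y hy
    set ε := trunc j with hε
    have hε0 : 0 < ε := trunc_pos j
    have key : ∀ z ∈ Metric.ball y (√ε), ENNReal.ofReal (m * ε ^ (-((n : ℝ) / 2))) ≤ resKer n α j z := by
      intro z hz
      have hz2 : ‖z‖ ^ 2 ≤ 4 * ε := by
        have h1 : ‖z‖ ≤ 2 * √ε := by
          have := norm_sub_norm_le z y
          rw [mem_ball_iff_norm] at hz
          linarith
        have := Real.sq_sqrt hε0.le
        have := norm_nonneg z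
        nlinarith
      unfold resKer heatMix
      rw [← hε]
      have h2 : ENNReal.ofReal (1 / (2 * (α / 2)) * Real.exp (-(8 * Real.pi)) * ε ^ (-((n : ℝ) / 2))) ≤
          ∫⁻ t in Ioi 0, residualWeight (α / 2) ε t * heat n t z := by
        calc _ = ∫⁻ t in Ioc (ε / 2) ε, ENNReal.ofReal
              (ε⁻¹ / (α / 2) * (ε ^ (-((n : ℝ) / 2)) * Real.exp (-(8 * Real.pi)))) := by
              rw [lintegral_const, Measure.restrict_apply_univ, Real.volume_Ioc,
                ← ENNReal.ofReal_mul (by positivity)]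
              congr 1
              field_simp
              ring
          _ ≤ ∫⁻ t in Ioc (ε / 2) ε, residualWeight (α / 2) ε t * heat n t z := by
              apply setLIntegral_mono
              · exact (measurable_residualWeight _ _).mul
                  ((measurable_heat n).comp (measurable_id.prodMk measurable_const))
              intro t ht
              have ht0 : 0 < t := lt_trans (by positivity) ht.1
              rw [ENNReal.ofReal_mul (by positivity)]
              gcongr ?_ * ?_
              · unfold residualWeight
                apply ENNReal.ofReal_le_ofReal
                rw [max_eq_right (by linarith [ht.2]), Real.zero_rpow hb.ne', sub_zero]
                rw [mul_comm (α / 2) t, ← div_div]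
                gcongr
                rw [mul_div_assoc, ← Real.rpow_sub_one ht0.ne']
                calc ε⁻¹ = ε ^ (-(α / 2)) * ε ^ (α / 2 - 1) := by
                      rw [← Real.rpow_add hε0, ← Real.rpow_neg_one]; congr 1; ring
                  _ ≤ _ := by
                      gcongr ?_ * ?_
                      exact Real.rpow_le_rpow_of_nonpos ht0 ht.2 (by linarith [h.half_lt_one])
              · unfold heat
                apply ENNReal.ofReal_le_ofReal
                gcongr ?_ * ?_
                · exact Real.rpow_le_rpow_of_nonpos ht0 ht.2 (by
                    have : (0 : ℝ) ≤ n := Nat.cast_nonneg n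
                    linarith)
                · rw [Real.exp_le_exp, neg_mul, neg_le_neg_iff]
                  calc Real.pi / t * ‖z‖ ^ 2 ≤ Real.pi / (ε / 2) * (4 * ε) := by
                        gcongr
                        exact ht.1.le
                    _ = 8 * Real.pi := by field_simp; ring
          _ ≤ _ := lintegral_mono_set (fun t ht => lt_trans (by positivity) ht.1)
      refine le_trans (le_of_eq ?_) (mul_le_mul_right h2 _)
      rw [← ENNReal.ofReal_mul (by positivity)]
      congr 1
      rw [hm]
      ring
    calc _ = ∫⁻ z in Metric.ball y (√ε), ENNReal.ofReal (m * ε ^ (-((n : ℝ) / 2))) := by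
          rw [setLIntegral_const, Measure.addHaar_ball_of_pos _ _ (Real.sqrt_pos.2 hε0), ← mul_assoc,
            ← ENNReal.ofReal_mul (by positivity)]
          congr 2
          simp only [finrank_euclideanSpace, Fintype.card_fin]
          rw [mul_assoc, Real.sqrt_eq_rpow, ← Real.rpow_natCast, ← Real.rpow_mul hε0.le,
            ← Real.rpow_add hε0]
          rw [show -((n : ℝ) / 2) + 1 / 2 * n = 0 by ring, Real.rpow_zero, mul_one]
      _ ≤ _ := setLIntegral_mono (measurable_resKer j) key

end estimates

/-- Convolution of a kernel with a function. -/
noncomputable def kconv {n : ℕ} (K f : Rn n → ℝ≥0∞) (x : Rn n) : ℝ≥0∞ :=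
  ∫⁻ z, K (x - z) * f z

section convolution
variable {n : ℕ} {α : ℝ}

lemma kconv_mono {K f g : Rn n → ℝ≥0∞} (hfg : ∀ z, f z ≤ g z) (x : Rn n) :
    kconv K f x ≤ kconv K g x :=
  lintegral_mono fun z => mul_le_mul_right (hfg z) _

lemma kconv_congr {K f g : Rn n → ℝ≥0∞} (hfg : f =ᵐ[volume] g) (x : Rn n) :
    kconv K f x = kconv K g x :=
  lintegral_congr_ae (by filter_upwards [hfg] with z hz; rw [hz])

lemma measurable_kconv {K f : Rn n → ℝ≥0∞} (hK : Measurable K) (hf : Measurable f) :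
    Measurable (kconv K f) := by
  unfold kconv
  apply Measurable.lintegral_prod_right' (f := fun q : Rn n × Rn n => K (q.1 - q.2) * f q.2)
  exact (hK.comp (measurable_fst.sub measurable_snd)).mul (hf.comp measurable_snd)

lemma measurable_kernel_sub {K : Rn n → ℝ≥0∞} (hK : Measurable K) (x : Rn n) :
    Measurable fun z => K (x - z) :=
  hK.comp (measurable_const.sub measurable_id)

lemma kconv_add {K f g : Rn n → ℝ≥0∞} (hK : Measurable K) (hf : Measurable f) (x : Rn n) :
    kconv K (fun z => f z + g z) x = kconv K f x + kconv K g x := by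
  unfold kconv
  simp_rw [mul_add]
  exact lintegral_add_left ((measurable_kernel_sub hK x).mul hf) _

lemma lintegral_resKer_sub (j : ℕ) (p : Rn n) : ∫⁻ z, resKer n α j (p - z) = resMass n α := by
  rw [lintegral_sub_left_eq_self (μ := volume) (resKer n α j) p, lintegral_resKer]

lemma tendsto_resKer_sub_tail (h : RieszRange n α) {r : ℝ} (hr : 0 < r) (p : Rn n) :
    Tendsto (fun j => ∫⁻ z in (Metric.ball p r)ᶜ, resKer n α j (p - z)) atTop (𝓝 0) := by
  refine (tendsto_resKer_tail h hr).congr fun j => ?_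
  rw [← lintegral_indicator Metric.isOpen_ball.measurableSet.compl,
    ← lintegral_indicator Metric.isOpen_ball.measurableSet.compl,
    ← lintegral_sub_left_eq_self (μ := volume) _ p]
  congr 1
  ext z
  simp only [indicator, mem_compl_iff, Metric.mem_ball, sub_zero, dist_eq_norm,
    norm_sub_rev z p]

lemma tendsto_resKer_sub_ball (h : RieszRange n α) {r : ℝ} (hr : 0 < r) (p : Rn n) :
    Tendsto (fun j => ∫⁻ z in Metric.ball p r, resKer n α j (p - z)) atTop (𝓝 (resMass n α)) := by
  have h1 := ENNReal.Tendsto.sub (tendsto_const_nhds (x := resMass n α))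
    (tendsto_resKer_sub_tail h hr p) (Or.inl (resMass_ne_top h))
  rw [tsub_zero] at h1
  refine h1.congr fun j => ?_
  have h2 := lintegral_add_compl (μ := volume) (fun z => resKer n α j (p - z))
    (Metric.isOpen_ball (x := p) (ε := r)).measurableSet
  rw [lintegral_resKer_sub] at h2
  rw [← h2]
  refine ENNReal.add_sub_cancel_right ?_
  refine ne_top_of_le_ne_top (resMass_ne_top h) ?_
  rw [← h2]
  exact le_add_self

lemma le_liminf_kconv_resKer (h : RieszRange n α) {f : Rn n → ℝ≥0∞} {p : Rn n}
    (hf : LowerSemicontinuousAt f p) :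
    resMass n α * f p ≤ liminf (fun j => kconv (resKer n α j) f p) atTop := by
  rw [mul_comm, ← ENNReal.le_div_iff_mul_le (Or.inl (resMass_ne_zero h)) (Or.inl (resMass_ne_top h))]
  refine le_of_forall_lt_imp_le_of_dense fun a ha => ?_
  rw [ENNReal.le_div_iff_mul_le (Or.inl (resMass_ne_zero h)) (Or.inl (resMass_ne_top h))]
  obtain ⟨r, hr, hball⟩ := Metric.eventually_nhds_iff_ball.1 (lowerSemicontinuousAt_iff.1 hf a ha)
  have h1 := ENNReal.Tendsto.const_mul (tendsto_resKer_sub_ball h hr p)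
    (Or.inr (ne_top_of_lt ha))
  rw [← h1.liminf_eq]
  refine liminf_le_liminf (Eventually.of_forall fun j => ?_)
  rw [← lintegral_const_mul _ (measurable_kernel_sub (measurable_resKer j) p)]
  unfold kconv
  refine le_trans ?_ (setLIntegral_le_lintegral (Metric.ball p r) _)
  refine setLIntegral_mono' Metric.isOpen_ball.measurableSet fun z hz => ?_
  rw [mul_comm]
  gcongr
  exact (hball z hz).le

lemma limsup_kconv_resKer_le (h : RieszRange n α) {f : Rn n → ℝ≥0∞} {p : Rn n} {M a : ℝ≥0∞}
    (hM : M ≠ ⊤) (hfM : ∀ z, f z ≤ M) (hf : ∀ᶠ z in 𝓝 p, f z ≤ a) :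
    limsup (fun j => kconv (resKer n α j) f p) atTop ≤ resMass n α * a := by
  obtain ⟨r, hr, hball⟩ := Metric.eventually_nhds_iff_ball.1 hf
  have hms : MeasurableSet (Metric.ball p r) := Metric.isOpen_ball.measurableSet
  have h1 : Tendsto (fun j => resMass n α * a +
      (∫⁻ z in (Metric.ball p r)ᶜ, resKer n α j (p - z)) * M) atTop (𝓝 (resMass n α * a)) := by
    have := (tendsto_const_nhds (x := resMass n α * a)).add
      (ENNReal.Tendsto.mul_const (tendsto_resKer_sub_tail h hr p) (Or.inr hM))
    simpa using this
  rw [← h1.limsup_eq]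
  refine limsup_le_limsup (Eventually.of_forall fun j => ?_)
  have hmk := measurable_kernel_sub (measurable_resKer (α := α) j) p
  unfold kconv
  simp only []
  rw [← lintegral_add_compl _ hms, ← lintegral_resKer_sub j p, ← lintegral_mul_const _ hmk,
    ← lintegral_mul_const _ hmk]
  refine add_le_add ?_ ?_
  · refine le_trans ?_ (setLIntegral_le_lintegral (Metric.ball p r) _)
    exact setLIntegral_mono' hms fun z hz => mul_le_mul_right (hball z hz) _
  · exact lintegral_mono fun z => mul_le_mul_right (hfM z) _

lemma tendsto_kconv_resKer_of_bounded (h : RieszRange n α) {f : Rn n → ℝ≥0∞} {p : Rn n} {M : ℝ≥0∞}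
    (hM : M ≠ ⊤) (hfM : ∀ z, f z ≤ M) (hf : ContinuousAt f p) :
    Tendsto (fun j => kconv (resKer n α j) f p) atTop (𝓝 (resMass n α * f p)) := by
  refine tendsto_of_le_liminf_of_limsup_le (le_liminf_kconv_resKer h hf.lowerSemicontinuousAt) ?_
  rw [mul_comm]
  rw [← ENNReal.div_le_iff_le_mul (Or.inl (resMass_ne_zero h)) (Or.inl (resMass_ne_top h))]
  refine le_of_forall_gt_imp_ge_of_dense fun a ha => ?_
  rw [ENNReal.div_le_iff_le_mul (Or.inl (resMass_ne_zero h)) (Or.inl (resMass_ne_top h)), mul_comm]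
  refine limsup_kconv_resKer_le h hM hfM ?_
  filter_upwards [hf.eventually_lt_const ha] with z hz using hz.le

lemma tendsto_kconv_resKer_riesz (h : RieszRange n α) (x y : Rn n) :
    Tendsto (fun j => kconv (resKer n α j) (riesz n α y) x) atTop
      (𝓝 (resMass n α * riesz n α y x)) := by
  have hcont : Continuous (riesz n α y) :=
    (continuous_riesz h).comp (continuous_const.prodMk continuous_id)
  by_cases hxy : x = y
  · subst hxy
    have := le_liminf_kconv_resKer h (p := x) hcont.continuousAt.lowerSemicontinuousAt
    refine tendsto_of_le_liminf_of_limsup_le this ?_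
    rw [riesz_self, ENNReal.mul_top (resMass_ne_zero h)]
    exact le_top
  set d : ℝ := dist x y / 2 with hd
  have hd0 : 0 < d := by have := dist_pos.2 hxy; positivity
  set B := Metric.ball y d with hB
  have hms : MeasurableSet B := Metric.isOpen_ball.measurableSet
  have hfar : ∀ z ∈ B, d ≤ dist x z := fun z hz => by
    rw [hB, Metric.mem_ball] at hz
    have := dist_triangle x z y
    linarith
  have hxB : Bᶜ ∈ 𝓝 x := by
    have : (Metric.closedBall y d)ᶜ ∈ 𝓝 x := by
      refine Metric.isClosed_closedBall.isOpen_compl.mem_nhds ?_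
      simp only [mem_compl_iff, Metric.mem_closedBall, not_le]
      linarith
    exact mem_of_superset this (compl_subset_compl.2 Metric.ball_subset_closedBall)
  have h1 : Tendsto (fun j => kconv (resKer n α j) (Bᶜ.indicator (riesz n α y)) x) atTop
      (𝓝 (resMass n α * riesz n α y x)) := by
    have heq : Bᶜ.indicator (riesz n α y) =ᶠ[𝓝 x] riesz n α y := by
      filter_upwards [hxB] with z hz using indicator_of_mem hz _
    have := tendsto_kconv_resKer_of_bounded h (f := Bᶜ.indicator (riesz n α y)) (p := x)
      (M := ENNReal.ofReal (d ^ (α - (n : ℝ)))) ENNReal.ofReal_ne_top ?_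
      (hcont.continuousAt.congr heq.symm)
    · rwa [heq.self_of_nhds] at this
    · intro z
      refine indicator_le (s := Bᶜ) (g := fun _ => ENNReal.ofReal (d ^ (α - (n : ℝ)))) ?_ z
      intro z hz
      refine riesz_le_of_le_dist h hd0 ?_
      rw [dist_comm]
      simpa [hB] using hz
  have h2 : Tendsto (fun j => ∫⁻ z in B, resKer n α j (x - z) * riesz n α y z) atTop (𝓝 0) := by
    obtain ⟨C, hC, hCb⟩ := exists_setLIntegral_riesz_ball_le h
    have hlim : Tendsto (fun j => ENNReal.ofReal (resDecay n α j * d ^ (-2 : ℝ)) *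
        (ENNReal.ofReal (d ^ (α - (n : ℝ))) * (C * ENNReal.ofReal (d ^ α)))) atTop (𝓝 0) := by
      have := ENNReal.Tendsto.mul_const (tendsto_ofReal_resDecay_mul h (d ^ (-2 : ℝ)))
        (b := ENNReal.ofReal (d ^ (α - (n : ℝ))) * (C * ENNReal.ofReal (d ^ α)))
        (Or.inr (ENNReal.mul_ne_top ENNReal.ofReal_ne_top
          (ENNReal.mul_ne_top hC ENNReal.ofReal_ne_top)))
      simpa using this
    refine tendsto_of_tendsto_of_tendsto_of_le_of_le tendsto_const_nhds hlim (fun _ => zero_le) ?_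
    intro j
    simp only []
    rw [← mul_assoc]
    refine le_trans ?_ (mul_le_mul_right (hCb y d hd0) _)
    rw [← lintegral_const_mul _ hcont.measurable]
    refine setLIntegral_mono' hms fun z hz => ?_
    gcongr
    refine (resKer_le_riesz h hd0 j (hfar z hz)).trans ?_
    gcongr
    exact riesz_le_of_le_dist h hd0 (hfar z hz)
  have h3 := h1.add h2
  rw [add_zero] at h3
  refine h3.congr fun j => ?_
  unfold kconv
  have e := lintegral_add_compl (μ := volume) (fun z => resKer n α j (x - z) * riesz n α y z) hms
  rw [← e, add_comm]
  congr 1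
  rw [← lintegral_indicator hms.compl]
  refine lintegral_congr fun z => ?_
  by_cases hz : z ∈ Bᶜ
  · simp [indicator_of_mem hz]
  · simp [indicator_of_notMem hz]

lemma exists_kconv_resKer_riesz_le (h : RieszRange n α) :
    ∃ C : ℝ≥0∞, C ≠ ⊤ ∧ ∀ j (x y : Rn n),
      kconv (resKer n α j) (riesz n α y) x ≤ C * riesz n α y x := by
  obtain ⟨C, hC, hCb⟩ := exists_setLIntegral_riesz_ball_le h
  set c₁ : ℝ := (n / 2) ^ ((n : ℝ) / 2) with hc₁
  set c₂ : ℝ := (1 / 2) ^ (α - (n : ℝ)) with hc₂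
  have hc₁0 : 0 ≤ c₁ := by positivity
  have hc₂0 : 0 ≤ c₂ := by positivity
  refine ⟨resMass n α * (ENNReal.ofReal c₁ * C) * ENNReal.ofReal c₂ + resMass n α * ENNReal.ofReal c₂,
    ?_, ?_⟩
  · have := resMass_ne_top h
    finiteness
  intro j x y
  by_cases hxy : y = x
  · subst hxy
    rw [riesz_self, ENNReal.mul_top]
    · exact le_top
    · have h2 : ENNReal.ofReal c₂ ≠ 0 := by
        rw [hc₂]; simp only [ne_eq, ENNReal.ofReal_eq_zero, not_le]; positivity
      exact fun h0 => mul_ne_zero (resMass_ne_zero h) h2 (add_eq_zero.1 h0).2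
  set d : ℝ := dist y x / 2 with hd
  have hd0 : 0 < d := by have := dist_pos.2 hxy; positivity
  set B := Metric.ball y d with hB
  have hms : MeasurableSet B := Metric.isOpen_ball.measurableSet
  have hmk := measurable_kernel_sub (measurable_resKer (n := n) (α := α) j) x
  have hk : ENNReal.ofReal (d ^ (α - (n : ℝ))) = ENNReal.ofReal c₂ * riesz n α y x := by
    simp only [riesz, hxy, if_false]
    rw [← ENNReal.ofReal_mul hc₂0, hc₂, ← Real.mul_rpow (by norm_num) (norm_nonneg _), hd,
      dist_eq_norm]
    congr 2
    ring
  have hfar : ∀ z ∈ B, d ≤ dist x z := fun z hz => by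
    rw [hB, Metric.mem_ball] at hz
    have := dist_triangle x z y
    rw [dist_comm x y] at this
    linarith
  have h1 : ∫⁻ z in B, resKer n α j (x - z) * riesz n α y z ≤
      resMass n α * (ENNReal.ofReal c₁ * C) * ENNReal.ofReal (d ^ (α - (n : ℝ))) := by
    calc _ ≤ ∫⁻ z in B, resMass n α * ENNReal.ofReal (c₁ * d ^ (-(n : ℝ))) * riesz n α y z := by
          refine setLIntegral_mono' hms fun z hz => ?_
          gcongr
          have hf := hfar z hz
          rw [dist_eq_norm] at hf
          refine (resKer_le_uniform h j (norm_pos_iff.1 (hd0.trans_le hf))).trans ?_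
          refine mul_le_mul_right (ENNReal.ofReal_le_ofReal (mul_le_mul_of_nonneg_left ?_ hc₁0)) _
          exact Real.rpow_le_rpow_of_nonpos hd0 hf (neg_nonpos.2 (Nat.cast_nonneg n))
      _ = resMass n α * ENNReal.ofReal (c₁ * d ^ (-(n : ℝ))) * ∫⁻ z in B, riesz n α y z := by
          rw [lintegral_const_mul]
          exact ((continuous_riesz h).comp (continuous_const.prodMk continuous_id)).measurable
      _ ≤ resMass n α * ENNReal.ofReal (c₁ * d ^ (-(n : ℝ))) * (C * ENNReal.ofReal (d ^ α)) := by
          gcongr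
          exact hCb y d hd0
      _ = _ := by
          rw [show α - (n : ℝ) = -n + α by ring, Real.rpow_add hd0,
            ENNReal.ofReal_mul (by positivity), ENNReal.ofReal_mul (by positivity)]
          ring
  have h2 : ∫⁻ z in Bᶜ, resKer n α j (x - z) * riesz n α y z ≤
      resMass n α * ENNReal.ofReal (d ^ (α - (n : ℝ))) := by
    rw [← lintegral_resKer_sub j x, ← lintegral_mul_const _ hmk]
    refine le_trans ?_ (setLIntegral_le_lintegral Bᶜ _)
    refine setLIntegral_mono' hms.compl fun z hz => ?_
    gcongr
    refine riesz_le_of_le_dist h hd0 ?_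
    rw [dist_comm]
    simpa [hB] using hz
  unfold kconv
  rw [← lintegral_add_compl _ hms, add_mul]
  refine (add_le_add h1 h2).trans (le_of_eq ?_)
  rw [hk]
  ring

lemma measurable_potential_riesz (h : RieszRange n α) (μ : Measure (Rn n)) [SFinite μ] :
    Measurable (potential (riesz n α) μ) :=
  (measurable_riesz h).lintegral_prod_right'

lemma kconv_potential (h : RieszRange n α) {K : Rn n → ℝ≥0∞} (hK : Measurable K)
    (μ : Measure (Rn n)) [SFinite μ] (x : Rn n) :
    kconv K (potential (riesz n α) μ) x = ∫⁻ y, kconv K (riesz n α y) x ∂μ := by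
  unfold kconv potential
  have hm := measurable_kernel_sub hK x
  have hr (z : Rn n) : Measurable (riesz n α z) :=
    (measurable_riesz h).comp (measurable_const.prodMk measurable_id)
  simp_rw [← fun z => lintegral_const_mul (μ := μ) (K (x - z)) (hr z)]
  rw [lintegral_lintegral_swap]
  · simp_rw [fun z y => riesz_comm (α := α) (n := n) z y]
  · exact ((hm.comp measurable_fst).mul (measurable_riesz h)).aemeasurable

/-- A common domination constant for convolutions of Riesz potentials with residual kernels. -/
noncomputable def resBound {n : ℕ} {α : ℝ} (h : RieszRange n α) : ℝ≥0∞ :=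
  (exists_kconv_resKer_riesz_le h).choose

lemma resBound_ne_top (h : RieszRange n α) : resBound h ≠ ⊤ :=
  (exists_kconv_resKer_riesz_le h).choose_spec.1

lemma kconv_resKer_riesz_le (h : RieszRange n α) (j : ℕ) (x y : Rn n) :
    kconv (resKer n α j) (riesz n α y) x ≤ resBound h * riesz n α y x :=
  (exists_kconv_resKer_riesz_le h).choose_spec.2 j x y

lemma kconv_resKer_potential_le (h : RieszRange n α) (j : ℕ) (μ : Measure (Rn n)) [SFinite μ]
    (x : Rn n) : kconv (resKer n α j) (potential (riesz n α) μ) x ≤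
      resBound h * potential (riesz n α) μ x := by
  rw [kconv_potential h (measurable_resKer j)]
  unfold potential
  rw [← lintegral_const_mul' _ _ (resBound_ne_top h)]
  refine lintegral_mono fun y => ?_
  simp only []
  rw [riesz_comm x y]
  exact kconv_resKer_riesz_le h j x y

lemma tendsto_kconv_resKer_potential (h : RieszRange n α) (μ : Measure (Rn n)) [SFinite μ]
    {x : Rn n} (hx : potential (riesz n α) μ x ≠ ⊤) :
    Tendsto (fun j => kconv (resKer n α j) (potential (riesz n α) μ) x) atTop
      (𝓝 (resMass n α * potential (riesz n α) μ x)) := by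
  simp_rw [fun j => kconv_potential h (measurable_resKer (n := n) (α := α) j) μ x]
  unfold potential at hx ⊢
  rw [← lintegral_const_mul' _ _ (resMass_ne_top h)]
  refine tendsto_lintegral_of_dominated_convergence (fun y => resBound h * riesz n α x y) ?_ ?_ ?_ ?_
  · intro j
    have : Measurable fun q : Rn n × Rn n => resKer n α j (x - q.2) * riesz n α q.1 q.2 :=
      ((measurable_kernel_sub (measurable_resKer j) x).comp measurable_snd).mul (measurable_riesz h)
    exact this.lintegral_prod_right'
  · intro j
    refine ae_of_all _ fun y => ?_
    simp only []
    rw [riesz_comm x y]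
    exact kconv_resKer_riesz_le h j x y
  · rw [lintegral_const_mul' _ _ (resBound_ne_top h)]
    exact ENNReal.mul_ne_top (resBound_ne_top h) hx
  · refine ae_of_all _ fun y => ?_
    rw [riesz_comm x y]
    exact tendsto_kconv_resKer_riesz h x y

lemma levyMass_mul_potential (h : RieszRange n α) (j : ℕ) (μ : Measure (Rn n)) [SFinite μ]
    (x : Rn n) : levyMass α j * potential (riesz n α) μ x =
      kconv (levyKer n α j) (potential (riesz n α) μ) x + ∫⁻ y, resKer n α j (x - y) ∂μ := by
  rw [kconv_potential h (measurable_levyKer j),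
    ← lintegral_add_right _ (measurable_kernel_sub (measurable_resKer j) x)]
  unfold potential
  rw [← lintegral_const_mul' _ _ (levyMass_ne_top j)]
  congr 1
  ext y
  rw [levyMass_mul_riesz h]
  unfold kconv
  simp_rw [fun z => riesz_comm (α := α) (n := n) z y]

end convolution

section energy

lemma ENNReal.tsub_sq_add_two_mul_le (a b : ℝ≥0∞) : (a - b) ^ 2 + 2 * (a * b) ≤ a ^ 2 + b ^ 2 := by
  rcases le_total a b with hab | hab
  · obtain ⟨c, rfl⟩ := exists_add_of_le hab
    rw [tsub_eq_zero_of_le hab]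
    calc _ = a ^ 2 + (a ^ 2 + 2 * (a * c)) := by ring
      _ ≤ a ^ 2 + (a ^ 2 + 2 * (a * c)) + c ^ 2 := le_self_add
      _ = _ := by ring
  · obtain ⟨c, rfl⟩ := exists_add_of_le hab
    have : b + c - b ≤ c := tsub_le_iff_left.2 le_rfl
    calc (b + c - b) ^ 2 + 2 * ((b + c) * b) ≤ c ^ 2 + 2 * ((b + c) * b) := by gcongr
      _ = _ := by ring

lemma ENNReal.two_mul_mul_le_sq_add_sq (a b : ℝ≥0∞) : 2 * (a * b) ≤ a ^ 2 + b ^ 2 :=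
  le_add_self.trans (ENNReal.tsub_sq_add_two_mul_le a b)

lemma lintegral_mul_le_of_sq_distance {Ω : Type*} [MeasurableSpace Ω] (m : Measure Ω)
    {H F G : Ω → ℝ≥0∞} (hH : Measurable H) (hF : Measurable F) (hG : Measurable G)
    (hF2 : ∫⁻ q, F q * F q ∂m ≠ ⊤) (hG2 : ∫⁻ q, G q * G q ∂m ≠ ⊤) :
    ∫⁻ q, H q * F q ∂m ≤ (∫⁻ q, H q * G q ∂m) + (∫⁻ q, H q * H q ∂m) ^ (1 / 2 : ℝ) *
      ENNReal.ofReal (√((∫⁻ q, F q * F q ∂m).toReal + (∫⁻ q, G q * G q ∂m).toReal -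
        2 * (∫⁻ q, F q * G q ∂m).toReal)) := by
  have hsum : (∫⁻ q, (F q - G q) ^ 2 ∂m) + 2 * (∫⁻ q, F q * G q ∂m) ≤
      (∫⁻ q, F q * F q ∂m) + ∫⁻ q, G q * G q ∂m := by
    rw [← lintegral_const_mul _ (f := fun q => F q * G q) (hF.mul hG), ← lintegral_add_right _ (by fun_prop),
      ← lintegral_add_right _ (by fun_prop)]
    refine lintegral_mono fun q => ?_
    have := ENNReal.tsub_sq_add_two_mul_le (F q) (G q)
    simpa only [sq (F q), sq (G q)] using this
  have hfin : (∫⁻ q, F q * F q ∂m) + ∫⁻ q, G q * G q ∂m ≠ ⊤ := ENNReal.add_ne_top.2 ⟨hF2, hG2⟩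
  have hfin2 := ne_top_of_le_ne_top hfin hsum
  have hd : ∫⁻ q, (F q - G q) ^ 2 ∂m ≠ ⊤ := (ENNReal.add_ne_top.1 hfin2).1
  have hFG : ∫⁻ q, F q * G q ∂m ≠ ⊤ := fun h0 => by simp [h0] at hfin2
  have hreal : (∫⁻ q, (F q - G q) ^ 2 ∂m).toReal ≤
      (∫⁻ q, F q * F q ∂m).toReal + (∫⁻ q, G q * G q ∂m).toReal -
        2 * (∫⁻ q, F q * G q ∂m).toReal := by
    have := ENNReal.toReal_mono hfin hsum
    rw [ENNReal.toReal_add hd (ENNReal.mul_ne_top (by simp) hFG), ENNReal.toReal_add hF2 hG2,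
      ENNReal.toReal_mul] at this
    simp only [ENNReal.toReal_ofNat] at this
    linarith
  have hroot : (∫⁻ q, (F q - G q) ^ 2 ∂m) ^ (1 / 2 : ℝ) ≤
      ENNReal.ofReal (√((∫⁻ q, F q * F q ∂m).toReal + (∫⁻ q, G q * G q ∂m).toReal -
        2 * (∫⁻ q, F q * G q ∂m).toReal)) := by
    rw [← ENNReal.ofReal_toReal hd, ENNReal.ofReal_rpow_of_nonneg ENNReal.toReal_nonneg
      (by norm_num), ← Real.sqrt_eq_rpow]
    exact ENNReal.ofReal_le_ofReal (Real.sqrt_le_sqrt hreal)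
  have hCS := ENNReal.lintegral_mul_le_Lp_mul_Lq m (p := 2) (q := 2)
    ((Real.holderConjugate_iff).2 ⟨by norm_num, by norm_num⟩) hH.aemeasurable
    (hF.sub hG).aemeasurable
  calc ∫⁻ q, H q * F q ∂m ≤ ∫⁻ q, (H q * G q + H q * (F q - G q)) ∂m := by
        refine lintegral_mono fun q => ?_
        rw [← mul_add]
        exact mul_le_mul_right le_add_tsub _
    _ = (∫⁻ q, H q * G q ∂m) + ∫⁻ q, H q * (F q - G q) ∂m := lintegral_add_left (hH.mul hG) _
    _ ≤ _ := by
        refine add_le_add le_rfl (le_trans hCS ?_)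
        refine mul_le_mul' (le_of_eq ?_) (le_trans (le_of_eq ?_) hroot)
        · congr 1
          refine lintegral_congr fun q => ?_
          rw [ENNReal.rpow_two, sq]
        · congr 1
          refine lintegral_congr fun q => ?_
          rw [ENNReal.rpow_two]
          rfl

lemma energy_eq_of_factorization {Ω : Type*} [MeasurableSpace Ω] (m : Measure Ω) [SFinite m] {n : ℕ}
    {κ : Rn n → Rn n → ℝ≥0∞} {g : Ω → Rn n → ℝ≥0∞}
    (hg : Measurable fun q : Ω × Rn n => g q.1 q.2)
    (hκ : ∀ x y, κ x y = ∫⁻ q, g q x * g q y ∂m) (μ ν : Measure (Rn n)) [SFinite μ] [SFinite ν] :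
    energy κ μ ν = ∫⁻ q, (∫⁻ x, g q x ∂μ) * (∫⁻ y, g q y ∂ν) ∂m := by
  have hG : Measurable fun q => ∫⁻ y, g q y ∂ν := hg.lintegral_prod_right'
  have hpot : ∀ x, potential κ ν x = ∫⁻ q, g q x * ∫⁻ y, g q y ∂ν ∂m := by
    intro x
    unfold potential
    simp_rw [hκ]
    rw [lintegral_lintegral_swap]
    · refine lintegral_congr fun q => ?_
      exact lintegral_const_mul _ (hg.comp (measurable_const.prodMk measurable_id))
    · exact ((hg.comp (measurable_snd.prodMk measurable_const)).mul
        (hg.comp measurable_swap)).aemeasurable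
  unfold energy
  simp_rw [hpot]
  rw [lintegral_lintegral_swap]
  · refine lintegral_congr fun q => ?_
    exact lintegral_mul_const _ (hg.comp (measurable_const.prodMk measurable_id))
  · exact ((hg.comp measurable_swap).mul (hG.comp measurable_snd)).aemeasurable

variable {n : ℕ} {α : ℝ}

/-- The space-time measure on which the Riesz kernel is factorized by heat kernels. -/
noncomputable def heatMeasure (n : ℕ) (α : ℝ) : Measure (ℝ × Rn n) :=
  ((volume.restrict (Ioi (0 : ℝ))).withDensity
    (fun t => ENNReal.ofReal (rieszConst n (α / 2))⁻¹ * ENNReal.ofReal (t ^ (α / 2 - 1)))).prod volume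

instance : SFinite (heatMeasure n α) := by unfold heatMeasure; infer_instance

lemma measurable_heat_sub :
    Measurable fun q : (ℝ × Rn n) × Rn n => heat n (q.1.1 / 2) (q.1.2 - q.2) :=
  (measurable_heat n).comp ((measurable_fst.fst.div_const 2).prodMk
    (measurable_fst.snd.sub measurable_snd))

lemma riesz_eq_lintegral_heatMeasure (h : RieszRange n α) (x y : Rn n) :
    riesz n α x y =
      ∫⁻ q, heat n (q.1 / 2) (q.2 - x) * heat n (q.1 / 2) (q.2 - y) ∂(heatMeasure n α) := by
  have hm : Measurable fun q : ℝ × Rn n =>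
      heat n (q.1 / 2) (q.2 - x) * heat n (q.1 / 2) (q.2 - y) :=
    (measurable_heat_sub.comp (measurable_id.prodMk measurable_const)).mul
      (measurable_heat_sub.comp (measurable_id.prodMk measurable_const))
  have hw : Measurable fun t : ℝ =>
      ENNReal.ofReal (rieszConst n (α / 2))⁻¹ * ENNReal.ofReal (t ^ (α / 2 - 1)) := by fun_prop
  unfold heatMeasure
  rw [lintegral_prod _ hm.aemeasurable,
    lintegral_withDensity_eq_lintegral_mul _ hw hm.lintegral_prod_right', riesz_eq_heatMix h.lt_dim]
  unfold heatMix
  rw [← lintegral_const_mul' _ _ ENNReal.ofReal_ne_top]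
  refine setLIntegral_congr_fun measurableSet_Ioi fun t ht => ?_
  have ht2 : 0 < t / 2 := half_pos ht
  simp only [Pi.mul_apply]
  rw [← mul_assoc]
  congr 1
  have := lintegral_heat_mul_heat n ht2 ht2 x y
  rw [add_halves] at this
  rw [← this]
  refine lintegral_congr fun z => ?_
  rw [← heat_neg n _ (x - z), neg_sub]

lemma energy_riesz_eq (h : RieszRange n α) (μ ν : Measure (Rn n)) [SFinite μ] [SFinite ν] :
    energy (riesz n α) μ ν = ∫⁻ q, (∫⁻ x, heat n (q.1 / 2) (q.2 - x) ∂μ) *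
      (∫⁻ x, heat n (q.1 / 2) (q.2 - x) ∂ν) ∂(heatMeasure n α) :=
  energy_eq_of_factorization (heatMeasure n α) (g := fun q x => heat n (q.1 / 2) (q.2 - x))
    measurable_heat_sub (riesz_eq_lintegral_heatMeasure h) μ ν

lemma energy_riesz_comm (h : RieszRange n α) (μ ν : Measure (Rn n)) [SFinite μ] [SFinite ν] :
    energy (riesz n α) μ ν = energy (riesz n α) ν μ := by
  rw [energy_riesz_eq h, energy_riesz_eq h]
  simp_rw [mul_comm]

/-- Stability of mutual energies with respect to the strong distance. -/
lemma energy_riesz_le_add (h : RieszRange n α) (ξ μ ν : Measure (Rn n)) [SFinite ξ] [SFinite μ]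
    [SFinite ν] (hμ : FiniteEnergy (riesz n α) μ) (hν : FiniteEnergy (riesz n α) ν) :
    energy (riesz n α) ξ μ ≤ energy (riesz n α) ξ ν +
      energy (riesz n α) ξ ξ ^ (1 / 2 : ℝ) * ENNReal.ofReal (sDist (riesz n α) μ ν) := by
  unfold FiniteEnergy at hμ hν
  unfold sDist
  rw [energy_riesz_eq h] at hμ hν
  have hm (μ : Measure (Rn n)) [SFinite μ] : Measurable fun q : ℝ × Rn n =>
      ∫⁻ x, heat n (q.1 / 2) (q.2 - x) ∂μ := measurable_heat_sub.lintegral_prod_right'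
  simp only [energy_riesz_eq h]
  exact lintegral_mul_le_of_sq_distance (heatMeasure n α) (hm ξ) (hm μ) (hm ν) hμ.ne hν.ne

lemma riesz_le_mul_riesz (h : RieszRange n α) {x y a b : Rn n} (hab : dist x y / 2 ≤ dist a b) :
    riesz n α a b ≤ ENNReal.ofReal ((1 / 2) ^ (α - (n : ℝ))) * riesz n α x y := by
  by_cases hxy : x = y
  · subst hxy
    rw [riesz_self, ENNReal.mul_top]
    · exact le_top
    · simp only [ne_eq, ENNReal.ofReal_eq_zero, not_le]; positivity
  · have hd : 0 < dist x y / 2 := half_pos (dist_pos.2 hxy)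
    refine (riesz_le_of_le_dist h hd hab).trans (le_of_eq ?_)
    simp only [riesz, hxy, if_false]
    rw [← ENNReal.ofReal_mul (by positivity), ← Real.mul_rpow (by norm_num) (norm_nonneg _),
      dist_eq_norm]
    congr 2
    ring

lemma riesz_mul_riesz_le (h : RieszRange n α) (x y z : Rn n) :
    riesz n α z x * riesz n α z y ≤ ENNReal.ofReal ((1 / 2) ^ (α - (n : ℝ))) * riesz n α x y *
      (riesz n α x z + riesz n α y z) := by
  have htri := dist_triangle x z y
  rcases le_total (dist x z) (dist z y) with hle | hle
  · have h1 := riesz_le_mul_riesz (α := α) h (x := x) (y := y) (a := z) (b := y) (by linarith)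
    calc _ ≤ riesz n α z x * (ENNReal.ofReal ((1 / 2) ^ (α - (n : ℝ))) * riesz n α x y) := by gcongr
      _ = ENNReal.ofReal ((1 / 2) ^ (α - (n : ℝ))) * riesz n α x y * riesz n α x z := by
          rw [mul_comm, riesz_comm z x]
      _ ≤ _ := by gcongr; exact le_self_add
  · have h1 := riesz_le_mul_riesz (α := α) h (x := x) (y := y) (a := z) (b := x) (by
      rw [dist_comm z x]; linarith)
    calc _ ≤ (ENNReal.ofReal ((1 / 2) ^ (α - (n : ℝ))) * riesz n α x y) * riesz n α z y := by gcongr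
      _ = ENNReal.ofReal ((1 / 2) ^ (α - (n : ℝ))) * riesz n α x y * riesz n α y z := by
          rw [riesz_comm z y]
      _ ≤ _ := by gcongr; exact le_add_self

lemma exists_setLIntegral_riesz_le (h : RieszRange n α) {S : Set (Rn n)} (hS : volume S ≠ ⊤) :
    ∃ M : ℝ≥0∞, M ≠ ⊤ ∧ ∀ x, ∫⁻ z in S, riesz n α x z ≤ M :=
  ⟨_, by finiteness, fun x => setLIntegral_riesz_le h one_pos x S⟩

lemma setLIntegral_potential_sq_ne_top (h : RieszRange n α) {S : Set (Rn n)} (hS : volume S ≠ ⊤)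
    (μ : Measure (Rn n)) [SFinite μ] (hμ : FiniteEnergy (riesz n α) μ) :
    ∫⁻ z in S, potential (riesz n α) μ z ^ 2 ≠ ⊤ := by
  obtain ⟨M, hM, hMb⟩ := exists_setLIntegral_riesz_le h hS
  have hr (z : Rn n) : Measurable (riesz n α z) :=
    (measurable_riesz h).comp (measurable_const.prodMk measurable_id)
  set c := ENNReal.ofReal ((1 / 2) ^ (α - (n : ℝ)))
  have hm3 : Measurable fun q : (Rn n × Rn n) × Rn n => riesz n α q.1.1 q.1.2 * riesz n α q.1.1 q.2 :=
    ((measurable_riesz h).comp measurable_fst).mul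
      ((measurable_riesz h).comp (measurable_fst.fst.prodMk measurable_snd))
  have key : ∫⁻ z in S, potential (riesz n α) μ z ^ 2 ≤ c * (2 * M) * energy (riesz n α) μ μ := by
    calc _ = ∫⁻ z in S, ∫⁻ x, ∫⁻ y, riesz n α z x * riesz n α z y ∂μ ∂μ := by
          refine lintegral_congr fun z => ?_
          unfold potential
          rw [sq, ← lintegral_mul_const _ (hr z)]
          refine lintegral_congr fun x => ?_
          rw [lintegral_const_mul _ (hr z)]
      _ = ∫⁻ x, ∫⁻ z in S, ∫⁻ y, riesz n α z x * riesz n α z y ∂μ ∂volume ∂μ := by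
          rw [lintegral_lintegral_swap]
          exact hm3.lintegral_prod_right'.aemeasurable
      _ = ∫⁻ x, ∫⁻ y, ∫⁻ z in S, riesz n α z x * riesz n α z y ∂volume ∂μ ∂μ := by
          refine lintegral_congr fun x => ?_
          rw [lintegral_lintegral_swap]
          exact (hm3.comp ((measurable_fst.prodMk measurable_const).prodMk
            measurable_snd)).aemeasurable
      _ ≤ ∫⁻ x, ∫⁻ y, c * (2 * M) * riesz n α x y ∂μ ∂μ := by
          refine lintegral_mono fun x => lintegral_mono fun y => ?_
          calc _ ≤ ∫⁻ z in S, c * riesz n α x y * (riesz n α x z + riesz n α y z) :=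
                lintegral_mono fun z => riesz_mul_riesz_le h x y z
            _ = c * riesz n α x y * ((∫⁻ z in S, riesz n α x z) + ∫⁻ z in S, riesz n α y z) := by
                rw [lintegral_const_mul _ (f := fun z => riesz n α x z + riesz n α y z) ((hr x).add (hr y)),
                  lintegral_add_left (hr x)]
            _ ≤ c * riesz n α x y * (M + M) := by
                gcongr
                · exact hMb x
                · exact hMb y
            _ = _ := by ring
      _ = _ := by
          unfold energy potential
          rw [← lintegral_const_mul' _ _ (by finiteness)]
          refine lintegral_congr fun x => ?_
          rw [lintegral_const_mul _ (hr x)]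
  refine ne_top_of_le_ne_top ?_ key
  have : energy (riesz n α) μ μ ≠ ⊤ := hμ.ne
  finiteness

/-- Measures of finite energy do not charge sets of inner capacity zero. -/
lemma measure_eq_zero_of_innerCap_eq_zero {κ : Rn n → Rn n → ℝ≥0∞} {μ : Measure (Rn n)}
    (hμ : memE κ μ) {N : Set (Rn n)} (hN : MeasurableSet N) (hcap : innerCap κ N = 0) : μ N = 0 := by
  obtain ⟨hreg, hfin⟩ := hμ
  have : μ.Regular := hreg
  by_contra hne
  obtain ⟨K, hKN, hK, hpos⟩ := hN.exists_lt_isCompact (μ := μ) (r := 0) (pos_iff_ne_zero.2 hne)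
  have hKfin : μ K ≠ ⊤ := hK.measure_lt_top.ne
  set ν : Measure (Rn n) := (μ K)⁻¹ • μ.restrict K with hν
  have hνprob : IsProbabilityMeasure ν := ⟨by
    rw [hν, Measure.smul_apply, Measure.restrict_apply_univ, smul_eq_mul,
      ENNReal.inv_mul_cancel hpos.ne' hKfin]⟩
  have hνK : ν Kᶜ = 0 := by
    rw [hν, Measure.smul_apply, Measure.restrict_apply hK.measurableSet.compl, compl_inter_self,
      measure_empty, smul_zero]
  have hinv : (μ K)⁻¹ ≠ ⊤ := ENNReal.inv_ne_top.2 hpos.ne'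
  have hen : energy κ ν ν ≠ ⊤ := by
    have h1 : energy κ ν ν ≤ (μ K)⁻¹ * ((μ K)⁻¹ * energy κ μ μ) := by
      unfold energy potential
      rw [hν, lintegral_smul_measure, smul_eq_mul]
      refine mul_le_mul_right ?_ _
      simp_rw [lintegral_smul_measure, smul_eq_mul]
      rw [lintegral_const_mul' _ _ hinv]
      refine mul_le_mul_right ?_ _
      refine (setLIntegral_le_lintegral _ _).trans (lintegral_mono fun x => ?_)
      exact setLIntegral_le_lintegral _ _
    refine ne_top_of_le_ne_top ?_ h1
    have : energy κ μ μ ≠ ⊤ := hfin.ne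
    finiteness
  have hc : capC κ K ≤ 0 := by
    rw [← hcap]
    unfold innerCap
    exact le_iSup_of_le K (le_iSup_of_le hK (le_iSup_of_le hKN le_rfl))
  have hc0 : capC κ K = 0 := le_antisymm hc zero_le
  unfold capC at hc0
  rw [ENNReal.inv_eq_zero] at hc0
  apply hen
  rw [eq_top_iff, ← hc0]
  exact iInf_le_of_le ν (iInf_le_of_le hνprob (iInf_le_of_le hνK le_rfl))

lemma finiteEnergy_restrict_volume (h : RieszRange n α) {S : Set (Rn n)} (hS : volume S ≠ ⊤) :
    FiniteEnergy (riesz n α) (volume.restrict S) := by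
  obtain ⟨M, hM, hMb⟩ := exists_setLIntegral_riesz_le h hS
  unfold FiniteEnergy energy potential
  refine (lintegral_mono hMb).trans_lt ?_
  rw [setLIntegral_const]
  exact ENNReal.mul_lt_top hM.lt_top hS.lt_top

lemma volume_eq_zero_of_innerCap_eq_zero (h : RieszRange n α) {N : Set (Rn n)}
    (hN : MeasurableSet N) (hcap : innerCap (riesz n α) N = 0) : volume N = 0 := by
  have h1 : ∀ R : ℕ, volume (N ∩ Metric.ball 0 R) = 0 := by
    intro R
    have hfin : volume (Metric.ball (0 : Rn n) R) ≠ ⊤ := measure_ball_lt_top.ne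
    have : IsFiniteMeasure (volume.restrict (Metric.ball (0 : Rn n) R)) := ⟨by simpa using hfin.lt_top⟩
    have hreg : (volume.restrict (Metric.ball (0 : Rn n) R)).Regular := inferInstance
    rw [← Measure.restrict_apply hN]
    exact measure_eq_zero_of_innerCap_eq_zero ⟨hreg, finiteEnergy_restrict_volume h hfin⟩ hN hcap
  have h2 : N = ⋃ R : ℕ, N ∩ Metric.ball 0 R := by
    rw [← inter_iUnion, Metric.iUnion_ball_nat, inter_univ]
  rw [h2]
  exact measure_iUnion_null h1

end energy

section support
variable {n : ℕ} {α : ℝ}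

lemma sDist_riesz_comm (h : RieszRange n α) (μ ν : Measure (Rn n)) [SFinite μ] [SFinite ν] :
    sDist (riesz n α) μ ν = sDist (riesz n α) ν μ := by
  unfold sDist
  rw [energy_riesz_comm h μ ν, add_comm (energy _ μ μ).toReal]

lemma ENNReal.le_one_add_sq (a : ℝ≥0∞) : a ≤ 1 + a ^ 2 := by
  rcases le_total a 1 with ha | ha
  · exact ha.trans le_self_add
  · exact (le_self_pow₀ ha two_ne_zero).trans le_add_self

lemma lintegral_ne_top_of_sq {Ω : Type*} [MeasurableSpace Ω] {m : Measure Ω} [IsFiniteMeasure m]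
    {f : Ω → ℝ≥0∞} (hf : ∫⁻ x, f x ^ 2 ∂m ≠ ⊤) : ∫⁻ x, f x ∂m ≠ ⊤ := by
  refine ne_top_of_le_ne_top ?_ (lintegral_mono fun x => ENNReal.le_one_add_sq (f x))
  rw [lintegral_add_left measurable_const, lintegral_const, one_mul]
  exact ENNReal.add_ne_top.2 ⟨measure_ne_top _ _, hf⟩

lemma setLIntegral_potential_ne_top (h : RieszRange n α) {S : Set (Rn n)} (hS : volume S ≠ ⊤)
    (μ : Measure (Rn n)) [SFinite μ] (hμ : FiniteEnergy (riesz n α) μ) :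
    ∫⁻ z in S, potential (riesz n α) μ z ≠ ⊤ := by
  have : IsFiniteMeasure (volume.restrict S) := ⟨by simpa using hS.lt_top⟩
  exact lintegral_ne_top_of_sq (setLIntegral_potential_sq_ne_top h hS μ hμ)

lemma potential_dirac (κ : Rn n → Rn n → ℝ≥0∞) (x y : Rn n) :
    potential κ (Measure.dirac y) x = κ x y := by
  unfold potential
  rw [lintegral_dirac]

lemma lintegral_kconv_mul {K : Rn n → ℝ≥0∞} (hK : Measurable K) (hKn : ∀ z, K (-z) = K z)
    {f g : Rn n → ℝ≥0∞} (hf : Measurable f) (hg : Measurable g) :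
    ∫⁻ z, kconv K f z * g z = ∫⁻ z, f z * kconv K g z := by
  unfold kconv
  have hm : Measurable fun q : Rn n × Rn n => K (q.1 - q.2) * f q.2 * g q.1 := by fun_prop
  calc _ = ∫⁻ z, ∫⁻ w, K (z - w) * f w * g z := by
        refine lintegral_congr fun z => ?_
        rw [lintegral_mul_const _ (by fun_prop)]
    _ = ∫⁻ w, ∫⁻ z, K (z - w) * f w * g z := lintegral_lintegral_swap hm.aemeasurable
    _ = _ := by
        refine lintegral_congr fun w => ?_
        rw [← lintegral_const_mul _ (by fun_prop)]
        refine lintegral_congr fun z => ?_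
        rw [← neg_sub w z, hKn]
        ring

lemma setLIntegral_resKer_swap (j : ℕ) (μ : Measure (Rn n)) [SFinite μ] (B : Set (Rn n)) :
    ∫⁻ z in B, ∫⁻ w, resKer n α j (z - w) ∂μ ∂volume =
      ∫⁻ w, ∫⁻ z in B, resKer n α j (w - z) ∂volume ∂μ := by
  have hm := measurable_resKer (n := n) (α := α) j
  rw [lintegral_lintegral_swap]
  · refine lintegral_congr fun w => lintegral_congr fun z => ?_
    rw [resKer_sub_comm]
  · exact (hm.comp (measurable_fst.sub measurable_snd)).aemeasurable

lemma setLIntegral_levyMass_potential (h : RieszRange n α) (j : ℕ) (μ : Measure (Rn n)) [SFinite μ]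
    (B : Set (Rn n)) :
    levyMass α j * ∫⁻ z in B, potential (riesz n α) μ z =
      (∫⁻ z in B, kconv (levyKer n α j) (potential (riesz n α) μ) z) +
        ∫⁻ z in B, ∫⁻ w, resKer n α j (z - w) ∂μ ∂volume := by
  have hU := measurable_potential_riesz h μ
  rw [← lintegral_const_mul _ hU, ← lintegral_add_left (measurable_kconv (measurable_levyKer j) hU)]
  exact lintegral_congr fun z => levyMass_mul_potential h j μ z

/-- The strong closure of the cone of measures on a closed set consists of measures on that set. -/
lemma setLIntegral_resKer_le_of_memEClos (h : RieszRange n α) {A : Set (Rn n)}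
    {μ : Measure (Rn n)} [SFinite μ] (hμ : memEClos (riesz n α) A μ) {p : Rn n} {d : ℝ} (hd : 0 < d)
    (hp : ∀ z ∈ Metric.ball p d, ∀ w ∈ A, d ≤ dist z w) (j : ℕ) :
    ∫⁻ z in Metric.ball p d, ∫⁻ w, resKer n α j (z - w) ∂μ ∂volume ≤
      ENNReal.ofReal (resDecay n α j * d ^ (-2 : ℝ)) *
        ∫⁻ z in Metric.ball p d, potential (riesz n α) μ z := by
  set B := Metric.ball p d with hB
  have hBfin : volume B ≠ ⊤ := measure_ball_lt_top.ne
  set η := ENNReal.ofReal (resDecay n α j * d ^ (-2 : ℝ)) with hη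
  have hηtop : η ≠ ⊤ := ENNReal.ofReal_ne_top
  have hL := measurable_levyKer (n := n) (α := α) j
  set oneB : Rn n → ℝ≥0∞ := B.indicator 1 with honeB
  have honeBm : Measurable oneB := measurable_one.indicator measurableSet_ball
  have hfB (f : Rn n → ℝ≥0∞) : ∫⁻ z in B, f z = ∫⁻ z, f z * oneB z := by
    rw [← lintegral_indicator measurableSet_ball]
    refine lintegral_congr fun z => ?_
    by_cases hz : z ∈ B <;> simp_all
  set lam1 : Measure (Rn n) := volume.restrict B
  set lam2 : Measure (Rn n) := volume.withDensity (kconv (levyKer n α j) oneB)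
  have hkm : Measurable (kconv (levyKer n α j) oneB) := measurable_kconv hL honeBm
  have hen2 (ξ : Measure (Rn n)) [SFinite ξ] : energy (riesz n α) lam2 ξ =
      ∫⁻ z in B, kconv (levyKer n α j) (potential (riesz n α) ξ) z := by
    have hU := measurable_potential_riesz h ξ
    unfold energy
    rw [lintegral_withDensity_eq_lintegral_mul _ hkm hU, hfB,
      lintegral_kconv_mul hL (levyKer_neg j) hU honeBm]
    simp only [Pi.mul_apply, mul_comm]
  have hen2le (ξ : Measure (Rn n)) [SFinite ξ] : energy (riesz n α) lam2 ξ ≤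
      levyMass α j * energy (riesz n α) lam1 ξ := by
    rw [hen2]
    unfold energy
    rw [setLIntegral_levyMass_potential h j ξ B]
    exact le_self_add
  have hf1 : FiniteEnergy (riesz n α) lam1 := finiteEnergy_restrict_volume h hBfin
  have hc := levyMass_ne_top (α := α) j
  have hf2 : energy (riesz n α) lam2 lam2 ≠ ⊤ := by
    refine ne_top_of_le_ne_top ?_ (hen2le lam2)
    rw [energy_riesz_comm h]
    refine ENNReal.mul_ne_top hc (ne_top_of_le_ne_top ?_ (hen2le lam1))
    exact ENNReal.mul_ne_top hc hf1.ne
  set e1 := energy (riesz n α) lam1 lam1 ^ (1 / 2 : ℝ)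
  set e2 := energy (riesz n α) lam2 lam2 ^ (1 / 2 : ℝ)
  have he1 : e1 ≠ ⊤ := ENNReal.rpow_ne_top_of_nonneg (by norm_num) hf1.ne
  have he2 : e2 ≠ ⊤ := ENNReal.rpow_ne_top_of_nonneg (by norm_num) hf2
  have hUB : ∫⁻ z in B, potential (riesz n α) μ z ≠ ⊤ :=
    setLIntegral_potential_ne_top h hBfin μ hμ.1.2
  have hmain : ∀ δ : ℝ, 0 < δ → ∫⁻ z in B, ∫⁻ w, resKer n α j (z - w) ∂μ ∂volume ≤
      η * (∫⁻ z in B, potential (riesz n α) μ z) +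
        (η * e1 + levyMass α j * e1 + e2) * ENNReal.ofReal δ := by
    intro δ hδ
    obtain ⟨ν, ⟨hν, hνA⟩, hdist⟩ := hμ.2 δ hδ
    have : ν.Regular := hν.1
    have hδle : ENNReal.ofReal (sDist (riesz n α) μ ν) ≤ ENNReal.ofReal δ :=
      ENNReal.ofReal_le_ofReal hdist.le
    have hδle' : ENNReal.ofReal (sDist (riesz n α) ν μ) ≤ ENNReal.ofReal δ := by
      rwa [sDist_riesz_comm h]
    have i1 : energy (riesz n α) lam1 μ ≤ energy (riesz n α) lam1 ν + e1 * ENNReal.ofReal δ :=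
      (energy_riesz_le_add h lam1 μ ν hμ.1.2 hν.2).trans (by gcongr)
    have i1' : energy (riesz n α) lam1 ν ≤ energy (riesz n α) lam1 μ + e1 * ENNReal.ofReal δ :=
      (energy_riesz_le_add h lam1 ν μ hν.2 hμ.1.2).trans (by gcongr)
    have i2 : energy (riesz n α) lam2 ν ≤ energy (riesz n α) lam2 μ + e2 * ENNReal.ofReal δ :=
      (energy_riesz_le_add h lam2 ν μ hν.2 hμ.1.2).trans (by gcongr)
    have hJν : ∫⁻ z in B, ∫⁻ w, resKer n α j (z - w) ∂ν ∂volume ≤ η * energy (riesz n α) lam1 ν := by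
      unfold energy
      rw [← lintegral_const_mul _ (measurable_potential_riesz h ν)]
      refine setLIntegral_mono (measurable_const.mul (measurable_potential_riesz h ν))
        fun z hz => ?_
      unfold potential
      rw [← lintegral_const_mul' _ _ hηtop]
      refine lintegral_mono_ae ?_
      have : ∀ᵐ w ∂ν, w ∈ A := hνA
      filter_upwards [this] with w hw
      exact resKer_le_riesz h hd j (hp z hz w hw)
    have eμ := setLIntegral_levyMass_potential h j μ B
    have eν := setLIntegral_levyMass_potential h j ν B
    rw [← hen2] at eμ eν
    have hb : energy (riesz n α) lam2 μ ≠ ⊤ :=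
      ne_top_of_le_ne_top (ENNReal.mul_ne_top hc hUB) (hen2le μ)
    refine (ENNReal.add_le_add_iff_left hb).1 ?_
    rw [← eμ]
    calc _ ≤ levyMass α j * (energy (riesz n α) lam1 ν + e1 * ENNReal.ofReal δ) :=
          mul_le_mul_right i1 _
      _ = (energy (riesz n α) lam2 ν + ∫⁻ z in B, ∫⁻ w, resKer n α j (z - w) ∂ν ∂volume) +
          levyMass α j * (e1 * ENNReal.ofReal δ) := by
          rw [mul_add, ← eν]; rfl
      _ ≤ (energy (riesz n α) lam2 μ + e2 * ENNReal.ofReal δ) +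
          η * (energy (riesz n α) lam1 μ + e1 * ENNReal.ofReal δ) +
          levyMass α j * (e1 * ENNReal.ofReal δ) := by
          gcongr
          exact hJν.trans (mul_le_mul_right i1' _)
      _ = energy (riesz n α) lam2 μ + (η * energy (riesz n α) lam1 μ +
          (η * e1 + levyMass α j * e1 + e2) * ENNReal.ofReal δ) := by ring
  have hlim : Tendsto (fun k : ℕ => η * (∫⁻ z in B, potential (riesz n α) μ z) +
        (η * e1 + levyMass α j * e1 + e2) * ENNReal.ofReal (trunc k)) atTop
        (𝓝 (η * (∫⁻ z in B, potential (riesz n α) μ z) +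
        (η * e1 + levyMass α j * e1 + e2) * ENNReal.ofReal 0)) := by
    refine Tendsto.const_add _ (ENNReal.Tendsto.const_mul ?_ (Or.inr (by finiteness)))
    exact ENNReal.tendsto_ofReal tendsto_trunc
  rw [ENNReal.ofReal_zero, mul_zero, add_zero] at hlim
  exact ge_of_tendsto' hlim fun k => hmain _ (trunc_pos k)

lemma measure_compl_eq_zero_of_memEClos (h : RieszRange n α) {A : Set (Rn n)} (hA : IsClosed A)
    {μ : Measure (Rn n)} (hμ : memEClos (riesz n α) A μ) : μ Aᶜ = 0 := by
  have : μ.Regular := hμ.1.1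
  refine measure_null_of_locally_null _ fun p hp => ?_
  obtain ⟨r, hr, hball⟩ := Metric.isOpen_iff.1 hA.isOpen_compl p hp
  set d := r / 2 with hd
  have hd0 : 0 < d := by positivity
  refine ⟨Metric.ball p d, mem_nhdsWithin_of_mem_nhds (Metric.ball_mem_nhds p hd0), ?_⟩
  have hsep : ∀ z ∈ Metric.ball p d, ∀ w ∈ A, d ≤ dist z w := by
    intro z hz w hw
    by_contra! hlt
    have : w ∈ Metric.ball p r := by
      rw [Metric.mem_ball] at hz ⊢
      calc dist w p ≤ dist w z + dist z p := dist_triangle _ _ _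
        _ < r := by rw [dist_comm w z]; linarith
    exact hball this hw
  have hfin : ∫⁻ z in Metric.ball p d, potential (riesz n α) μ z ≠ ⊤ :=
    setLIntegral_potential_ne_top h measure_ball_lt_top.ne μ hμ.1.2
  have hm := measurable_resKer (n := n) (α := α)
  have hJm (j : ℕ) : Measurable fun w : Rn n => ∫⁻ z in Metric.ball p d, resKer n α j (w - z) :=
    ((hm j).comp (measurable_fst.sub measurable_snd)).lintegral_prod_right'
  have hFatou : resMass n α * μ (Metric.ball p d) ≤ 0 := by
    calc resMass n α * μ (Metric.ball p d) = ∫⁻ w in Metric.ball p d, resMass n α ∂μ := by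
          rw [setLIntegral_const]
      _ ≤ ∫⁻ w in Metric.ball p d, liminf (fun j =>
          ∫⁻ z in Metric.ball p d, resKer n α j (w - z)) atTop ∂μ := by
          refine setLIntegral_mono' measurableSet_ball fun w hw => ?_
          obtain ⟨s, hs, hsub⟩ := Metric.isOpen_iff.1 (Metric.isOpen_ball (x := p) (ε := d)) w hw
          rw [← (tendsto_resKer_sub_ball h hs w).liminf_eq]
          exact liminf_le_liminf (Eventually.of_forall fun j => lintegral_mono_set hsub)
      _ ≤ liminf (fun j => ∫⁻ w in Metric.ball p d,
          ∫⁻ z in Metric.ball p d, resKer n α j (w - z) ∂volume ∂μ) atTop :=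
          lintegral_liminf_le hJm
      _ ≤ liminf (fun j => ENNReal.ofReal (resDecay n α j * d ^ (-2 : ℝ)) *
        ∫⁻ z in Metric.ball p d, potential (riesz n α) μ z) atTop := by
          refine liminf_le_liminf (Eventually.of_forall fun j => ?_)
          refine (setLIntegral_le_lintegral _ _).trans ?_
          rw [← setLIntegral_resKer_swap]
          exact setLIntegral_resKer_le_of_memEClos h hμ hd0 hsep j
      _ = 0 := by
          have := ENNReal.Tendsto.mul_const (tendsto_ofReal_resDecay_mul h (d ^ (-2 : ℝ)))
            (Or.inr hfin)
          rw [zero_mul] at this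
          exact this.liminf_eq
  have := nonpos_iff_eq_zero.1 hFatou
  exact (mul_eq_zero.1 this).resolve_left (resMass_ne_zero h)

end support

section minimumPrinciple
variable {n : ℕ} {α : ℝ}

lemma lowerSemicontinuousAt_lintegral {κ : Rn n → Rn n → ℝ≥0∞} {μ : Measure (Rn n)} {p : Rn n}
    (hm : ∀ z, Measurable (κ z)) (hκ : ∀ᵐ y ∂μ, LowerSemicontinuousAt (fun z => κ z y) p) :
    LowerSemicontinuousAt (fun z => ∫⁻ y, κ z y ∂μ) p := by
  rw [lowerSemicontinuousAt_iff_le_liminf]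
  refine le_trans (lintegral_mono_ae ?_) (lintegral_liminf_le hm)
  filter_upwards [hκ] with y hy
  exact hy.le_liminf

lemma lowerSemicontinuousAt_potential_riesz (h : RieszRange n α) (μ : Measure (Rn n)) (p : Rn n) :
    LowerSemicontinuousAt (potential (riesz n α) μ) p := by
  refine lowerSemicontinuousAt_lintegral
    (fun z => (measurable_riesz h).comp (measurable_const.prodMk measurable_id))
    (ae_of_all _ fun y => ContinuousAt.lowerSemicontinuousAt ?_)
  exact ((continuous_riesz h).comp (continuous_id.prodMk continuous_const)).continuousAt

lemma lintegral_mul_resKer_measure (j : ℕ) (θ : Measure (Rn n)) [SFinite θ] {v : Rn n → ℝ≥0∞}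
    (hv : Measurable v) :
    ∫⁻ z, v z * ∫⁻ w, resKer n α j (z - w) ∂θ = ∫⁻ w, kconv (resKer n α j) v w ∂θ := by
  have hm := measurable_resKer (n := n) (α := α) j
  calc _ = ∫⁻ z, ∫⁻ w, v z * resKer n α j (z - w) ∂θ ∂volume := by
        refine lintegral_congr fun z => ?_
        rw [lintegral_const_mul _ (measurable_kernel_sub hm z)]
    _ = ∫⁻ w, ∫⁻ z, v z * resKer n α j (z - w) ∂volume ∂θ := by
        refine lintegral_lintegral_swap (Measurable.aemeasurable ?_)
        exact (hv.comp measurable_fst).mul (hm.comp (measurable_fst.sub measurable_snd))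
    _ = _ := by
        refine lintegral_congr fun w => lintegral_congr fun z => ?_
        rw [resKer_sub_comm, mul_comm]

/-- Minimum principle for the truncated fractional Laplacian. -/
lemma ae_eq_zero_of_levyMass_mul_le (h : RieszRange n α) {D : Set (Rn n)} (hD : MeasurableSet D)
    (hDc : volume Dᶜ ≠ 0) {v : Rn n → ℝ≥0∞} (hv : Measurable v) (hv0 : ∀ᵐ z, z ∉ D → v z = 0)
    (hv2 : ∫⁻ z, v z ^ 2 ≠ ⊤) (θ : Measure (Rn n)) [SFinite θ]
    (hsub : ∀ j, ∀ᵐ z, v z ≠ 0 → levyMass α j * v z ≤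
      kconv (levyKer n α j) v z + ∫⁻ w, resKer n α j (z - w) ∂θ)
    (hlim : Tendsto (fun j => ∫⁻ w, kconv (resKer n α j) v w ∂θ) atTop (𝓝 0)) :
    v =ᵐ[volume] 0 := by
  set oneD : Rn n → ℝ≥0∞ := D.indicator 1 with hone
  set oneC : Rn n → ℝ≥0∞ := Dᶜ.indicator 1 with honeC
  have hDm : Measurable oneD := measurable_one.indicator hD
  have hCm : Measurable oneC := measurable_one.indicator hD.compl
  have hv2m : Measurable fun z => v z ^ 2 := hv.pow_const 2
  have hle (j : ℕ) : ∫⁻ z, v z ^ 2 * kconv (levyKer n α 0) oneC z ≤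
      ∫⁻ w, kconv (resKer n α j) v w ∂θ := by
    have hL := measurable_levyKer (n := n) (α := α) j
    have hmass (z : Rn n) : kconv (levyKer n α j) oneD z + kconv (levyKer n α j) oneC z =
        levyMass α j := by
      rw [← kconv_add hL hDm]
      unfold kconv
      rw [← lintegral_levyKer h j, ← lintegral_sub_left_eq_self (levyKer n α j) z]
      refine lintegral_congr fun w => ?_
      by_cases hw : w ∈ D <;> simp [hone, honeC, hw]
    have hcross : 2 * ∫⁻ z, v z * kconv (levyKer n α j) v z ≤
        2 * ∫⁻ z, v z ^ 2 * kconv (levyKer n α j) oneD z := by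
      calc 2 * ∫⁻ z, v z * kconv (levyKer n α j) v z
          = ∫⁻ z, 2 * (v z * kconv (levyKer n α j) v z) :=
            (lintegral_const_mul' _ _ (by norm_num)).symm
        _ ≤ ∫⁻ z, (v z ^ 2 * kconv (levyKer n α j) oneD z +
              oneD z * kconv (levyKer n α j) (fun w => v w ^ 2) z) := by
            refine lintegral_mono_ae ?_
            filter_upwards [hv0] with z hz
            unfold kconv
            rw [← lintegral_const_mul _ (by fun_prop), ← lintegral_const_mul _ (by fun_prop),
              ← lintegral_const_mul _ (by fun_prop), ← lintegral_const_mul _ (by fun_prop),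
              ← lintegral_add_left (by fun_prop)]
            refine lintegral_mono_ae ?_
            filter_upwards [hv0] with w hw
            by_cases hzD : z ∈ D
            · by_cases hwD : w ∈ D
              · have := ENNReal.two_mul_mul_le_sq_add_sq (v z) (v w)
                simp only [hone, indicator_of_mem hzD, indicator_of_mem hwD, Pi.one_apply, mul_one,
                  one_mul]
                calc 2 * (v z * (levyKer n α j (z - w) * v w))
                    = levyKer n α j (z - w) * (2 * (v z * v w)) := by ring
                  _ ≤ levyKer n α j (z - w) * (v z ^ 2 + v w ^ 2) := mul_le_mul_right this _
                  _ = _ := by ring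
              · simp [hw hwD]
            · simp [hz hzD]
        _ = (∫⁻ z, v z ^ 2 * kconv (levyKer n α j) oneD z) +
              ∫⁻ z, oneD z * kconv (levyKer n α j) (fun w => v w ^ 2) z :=
            lintegral_add_left (hv2m.mul (measurable_kconv hL hDm)) _
        _ = _ := by
            rw [← lintegral_kconv_mul hL (levyKer_neg j) hDm hv2m, two_mul]
            simp only [mul_comm]
    have hcross' : ∫⁻ z, v z * kconv (levyKer n α j) v z ≤
        ∫⁻ z, v z ^ 2 * kconv (levyKer n α j) oneD z :=
      (ENNReal.mul_le_mul_iff_right (by norm_num) (by norm_num)).1 hcross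
    have hfin : ∫⁻ z, v z ^ 2 * kconv (levyKer n α j) oneD z ≠ ⊤ := by
      refine ne_top_of_le_ne_top (b := ∫⁻ z, v z ^ 2 * levyMass α j) ?_
        (lintegral_mono fun z => ?_)
      · rw [lintegral_mul_const _ hv2m]
        exact ENNReal.mul_ne_top hv2 (levyMass_ne_top j)
      · exact mul_le_mul_right ((hmass z) ▸ le_self_add) _
    refine (lintegral_mono fun z => mul_le_mul_right (lintegral_mono fun w =>
      mul_le_mul' (levyKer_mono (Nat.zero_le j) (z - w)) le_rfl) _).trans ?_
    change ∫⁻ z, v z ^ 2 * kconv (levyKer n α j) oneC z ≤ _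
    refine (ENNReal.add_le_add_iff_left hfin).1 ?_
    calc _ = ∫⁻ z, v z ^ 2 * levyMass α j := by
          rw [← lintegral_add_left (f := fun z => v z ^ 2 * kconv (levyKer n α j) oneD z)
            (hv2m.mul (measurable_kconv hL hDm))]
          refine lintegral_congr fun z => ?_
          rw [← mul_add, hmass]
      _ ≤ ∫⁻ z, (v z * kconv (levyKer n α j) v z + v z * ∫⁻ w, resKer n α j (z - w) ∂θ) := by
          refine lintegral_mono_ae ?_
          filter_upwards [hsub j] with z hz
          by_cases h0 : v z = 0
          · simp [h0]
          · rw [← mul_add]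
            calc v z ^ 2 * levyMass α j = v z * (levyMass α j * v z) := by ring
              _ ≤ _ := mul_le_mul_right (hz h0) _
      _ = (∫⁻ z, v z * kconv (levyKer n α j) v z) + ∫⁻ w, kconv (resKer n α j) v w ∂θ := by
          rw [lintegral_add_left (f := fun z => v z * kconv (levyKer n α j) v z)
              (hv.mul (measurable_kconv hL hv)),
            lintegral_mul_resKer_measure j θ hv]
      _ ≤ _ := add_le_add hcross' le_rfl
  have hzero : ∫⁻ z, v z ^ 2 * kconv (levyKer n α 0) oneC z = 0 :=
    le_antisymm (ge_of_tendsto' hlim hle) zero_le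
  rw [lintegral_eq_zero_iff (f := fun z => v z ^ 2 * kconv (levyKer n α 0) oneC z)
    (hv2m.mul (measurable_kconv (measurable_levyKer 0) hCm))] at hzero
  filter_upwards [hzero] with z hz
  have hpos : kconv (levyKer n α 0) oneC z ≠ 0 := by
    intro h0
    unfold kconv at h0
    rw [lintegral_eq_zero_iff (f := fun w => levyKer n α 0 (z - w) * oneC w)
      ((measurable_kernel_sub (measurable_levyKer 0) z).mul hCm)] at h0
    refine hDc (measure_mono_null ?_ h0)
    intro w hw
    simp only [honeC, mem_compl_iff, mem_ofPred_eq, indicator_of_mem hw, Pi.one_apply,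
      mul_one, Pi.zero_apply]
    exact (levyKer_pos 0 _).ne'
  simpa [hpos] using hz

lemma tendsto_kconv_resKer_zero (h : RieszRange n α) {v m b : Rn n → ℝ≥0∞} {p : Rn n}
    (hv : Measurable v) (hsum : ∀ z, v z + m z = b z) (hbp : b p ≠ ⊤)
    (hb : Tendsto (fun j => kconv (resKer n α j) b p) atTop (𝓝 (resMass n α * b p)))
    (hm : resMass n α * b p ≤ liminf (fun j => kconv (resKer n α j) m p) atTop) :
    Tendsto (fun j => kconv (resKer n α j) v p) atTop (𝓝 0) := by
  have hadd (j : ℕ) : kconv (resKer n α j) v p + kconv (resKer n α j) m p =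
      kconv (resKer n α j) b p := by
    rw [← kconv_add (measurable_resKer j) hv]
    exact congrArg (kconv (resKer n α j) · p) (funext hsum)
  have htop : resMass n α * b p ≠ ⊤ := ENNReal.mul_ne_top (resMass_ne_top h) hbp
  have hmlim : Tendsto (fun j => kconv (resKer n α j) m p) atTop (𝓝 (resMass n α * b p)) := by
    refine tendsto_of_le_liminf_of_limsup_le hm ?_
    rw [← hb.limsup_eq]
    exact limsup_le_limsup (Eventually.of_forall fun j => le_add_self.trans (hadd j).le)
  have hsub := ENNReal.Tendsto.sub hb hmlim (Or.inl htop)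
  rw [tsub_self] at hsub
  refine hsub.congr' ?_
  filter_upwards [hmlim.eventually_ne htop] with j hj
  rw [← hadd j, ENNReal.add_sub_cancel_right hj]

/-- The properties of the sweeping of `ε_y` onto the complement of an open set. -/
structure SweptDirac (n : ℕ) (α : ℝ) (D : Set (Rn n)) (y : Rn n) (μ : Measure (Rn n)) : Prop where
  memE : memE (riesz n α) μ
  null : μ D = 0
  ae_volume : ∀ᵐ z, z ∉ D → potential (riesz n α) μ z = riesz n α y z
  ae_memE : ∀ ν, Balayage.memE (riesz n α) ν → ∀ᵐ z ∂ν, z ∉ D →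
    potential (riesz n α) μ z = riesz n α y z

lemma SweptDirac.of_isInnerBalayage (h : RieszRange n α) {D : Set (Rn n)} (hD : IsOpen D) {y : Rn n}
    {μ : Measure (Rn n)} (hμ : IsInnerBalayage (riesz n α) Dᶜ (Measure.dirac y) μ) :
    SweptDirac n α D y μ := by
  have : μ.Regular := hμ.1.1.1
  set N := {z ∈ Dᶜ | potential (riesz n α) μ z ≠ potential (riesz n α) (Measure.dirac y) z} with hN
  have hNm : MeasurableSet N := hD.measurableSet.compl.inter
    (measurableSet_eq_fun (measurable_potential_riesz h μ) (measurable_potential_riesz h _)).compl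
  have hae {ν : Measure (Rn n)} (hν : ν N = 0) : ∀ᵐ z ∂ν, z ∉ D →
      potential (riesz n α) μ z = riesz n α y z := by
    have : ∀ᵐ z ∂ν, z ∉ N := measure_eq_zero_iff_ae_notMem.1 hν
    filter_upwards [this] with z hz hzD
    by_contra hne
    exact hz ⟨hzD, by rwa [potential_dirac, riesz_comm]⟩
  refine ⟨hμ.1.1, ?_, hae (volume_eq_zero_of_innerCap_eq_zero h hNm hμ.2),
    fun ν hν => hae (measure_eq_zero_of_innerCap_eq_zero hν hNm hμ.2)⟩
  simpa using measure_compl_eq_zero_of_memEClos h hD.isClosed_compl hμ.1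

lemma volume_compl_ne_zero_of_isBounded (h : RieszRange n α) {D : Set (Rn n)}
    (hDb : Bornology.IsBounded D) : volume Dᶜ ≠ 0 := by
  intro h0
  have hn : 0 < n := by have := h.two_le; omega
  have : Nonempty (Fin n) := ⟨⟨0, hn⟩⟩
  have h1 : volume (univ : Set (Rn n)) ≤ volume D + volume Dᶜ := by
    rw [← union_compl_self D]; exact measure_union_le _ _
  rw [h0, add_zero, measure_univ_of_isAddLeftInvariant] at h1
  exact hDb.measure_lt_top.not_ge h1

lemma measurable_riesz_left (h : RieszRange n α) (y : Rn n) : Measurable (riesz n α y) :=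
  (measurable_riesz h).comp (measurable_const.prodMk measurable_id)

lemma continuous_riesz_left (h : RieszRange n α) (y : Rn n) : Continuous (riesz n α y) :=
  (continuous_riesz h).comp (continuous_const.prodMk continuous_id)

lemma ae_potential_ne_top (h : RieszRange n α) (μ : Measure (Rn n)) [SFinite μ]
    (hμ : FiniteEnergy (riesz n α) μ) : ∀ᵐ z, potential (riesz n α) μ z ≠ ⊤ := by
  have h1 (R : ℕ) : ∀ᵐ z, z ∈ Metric.ball (0 : Rn n) R → potential (riesz n α) μ z ≠ ⊤ := by
    rw [← ae_restrict_iff' measurableSet_ball]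
    filter_upwards [ae_lt_top (measurable_potential_riesz h μ)
      (setLIntegral_potential_ne_top h measure_ball_lt_top.ne μ hμ)] with z hz
    exact hz.ne
  filter_upwards [ae_all_iff.2 h1] with z hz
  obtain ⟨R, hR⟩ := exists_nat_gt ‖z‖
  exact hz R (by simpa using hR)

lemma kconv_levyKer_riesz_add (h : RieszRange n α) (j : ℕ) (x z : Rn n) :
    levyMass α j * riesz n α x z =
      kconv (levyKer n α j) (riesz n α x) z + resKer n α j (z - x) := by
  rw [riesz_comm, levyMass_mul_riesz h]
  unfold kconv
  simp_rw [riesz_comm (α := α) _ x]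

/-- The potential of the swept measure is dominated by the kernel. -/
lemma SweptDirac.ae_potential_le (h : RieszRange n α) {D : Set (Rn n)} (hD : IsOpen D)
    (hDb : Bornology.IsBounded D) {y : Rn n} {μ : Measure (Rn n)} (hμ : SweptDirac n α D y μ) :
    ∀ᵐ z, potential (riesz n α) μ z ≤ riesz n α y z := by
  have : μ.Regular := hμ.memE.1
  have hU := measurable_potential_riesz h μ
  have hk := measurable_riesz_left h y
  set v : Rn n → ℝ≥0∞ := fun z => potential (riesz n α) μ z - riesz n α y z with hvdef
  set m : Rn n → ℝ≥0∞ := fun z => min (potential (riesz n α) μ z) (riesz n α y z) with hmdef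
  have hv : Measurable v := hU.sub hk
  have hsum (z : Rn n) : v z + m z = potential (riesz n α) μ z := by
    simp only [hvdef, hmdef]
    rcases le_total (potential (riesz n α) μ z) (riesz n α y z) with hle | hle
    · rw [tsub_eq_zero_of_le hle, min_eq_left hle, zero_add]
    · rw [min_eq_right hle, tsub_add_cancel_of_le hle]
  have hv0 : ∀ᵐ z, z ∉ D → v z = 0 := by
    filter_upwards [hμ.ae_volume] with z hz hzD
    simp [hvdef, hz hzD]
  have hv2 : ∫⁻ z, v z ^ 2 ≠ ⊤ := by
    refine ne_top_of_le_ne_top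
      (setLIntegral_potential_sq_ne_top h hDb.measure_lt_top.ne μ hμ.memE.2) ?_
    rw [← lintegral_indicator hD.measurableSet]
    refine lintegral_mono_ae ?_
    filter_upwards [hv0] with z hz
    by_cases hzD : z ∈ D
    · rw [indicator_of_mem hzD]
      exact pow_le_pow_left₀ zero_le tsub_le_self 2
    · simp [hz hzD]
  have hsub (j : ℕ) : ∀ᵐ z, v z ≠ 0 → levyMass α j * v z ≤
      kconv (levyKer n α j) v z + ∫⁻ w, resKer n α j (z - w) ∂μ := by
    filter_upwards [ae_potential_ne_top h μ hμ.memE.2] with z hz hvz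
    have hlt : riesz n α y z < potential (riesz n α) μ z := by
      by_contra! hle
      exact hvz (tsub_eq_zero_of_le hle)
    have hfin : levyMass α j * riesz n α y z ≠ ⊤ := ENNReal.mul_ne_top (levyMass_ne_top j) hlt.ne_top
    refine (ENNReal.add_le_add_iff_right hfin).1 ?_
    have hL := measurable_levyKer (n := n) (α := α) j
    calc levyMass α j * v z + levyMass α j * riesz n α y z
        = levyMass α j * potential (riesz n α) μ z := by
          rw [← mul_add, tsub_add_cancel_of_le hlt.le]
      _ = kconv (levyKer n α j) v z + kconv (levyKer n α j) m z +
            ∫⁻ w, resKer n α j (z - w) ∂μ := by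
          rw [levyMass_mul_potential h, ← kconv_add hL hv]
          congr 2
          exact (funext hsum).symm
      _ ≤ kconv (levyKer n α j) v z + levyMass α j * riesz n α y z +
            ∫⁻ w, resKer n α j (z - w) ∂μ := by
          gcongr
          rw [kconv_levyKer_riesz_add h]
          exact (kconv_mono (fun w => min_le_right _ _) z).trans le_self_add
      _ = _ := by ring
  have hlim : Tendsto (fun j => ∫⁻ w, kconv (resKer n α j) v w ∂μ) atTop (𝓝 0) := by
    have hen : ∫⁻ w, potential (riesz n α) μ w ∂μ ≠ ⊤ := hμ.memE.2.ne
    have := tendsto_lintegral_of_dominated_convergence (μ := μ)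
      (F := fun j w => kconv (resKer n α j) v w) (f := fun _ => 0)
      (fun w => resBound h * potential (riesz n α) μ w)
      (fun j => measurable_kconv (measurable_resKer j) hv)
      (fun j => ae_of_all _ fun w => (kconv_mono (fun z => tsub_le_self) w).trans
        (kconv_resKer_potential_le h j μ w))
      (by
        rw [lintegral_const_mul _ hU]
        exact ENNReal.mul_ne_top (resBound_ne_top h) hen) ?_
    · simpa using this
    · have hnD : ∀ᵐ w ∂μ, w ∉ D := measure_eq_zero_iff_ae_notMem.1 hμ.null
      filter_upwards [hμ.ae_memE μ hμ.memE, hnD, ae_lt_top hU hen] with p hp hpD hpt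
      refine tendsto_kconv_resKer_zero h hv hsum hpt.ne (tendsto_kconv_resKer_potential h μ hpt.ne) ?_
      have : potential (riesz n α) μ p = m p := by simp [hmdef, hp hpD]
      rw [this]
      refine le_liminf_kconv_resKer h ?_
      exact (lowerSemicontinuousAt_potential_riesz h μ p).inf
        (continuous_riesz_left h y).continuousAt.lowerSemicontinuousAt
  filter_upwards [ae_eq_zero_of_levyMass_mul_le h hD.measurableSet
    (volume_compl_ne_zero_of_isBounded h hDb) hv hv0 hv2 μ hsub hlim] with z hz
  exact tsub_eq_zero_iff_le.1 hz

end minimumPrinciple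

section greenFunction
variable {n : ℕ} {α : ℝ}

section single
variable {D : Set (Rn n)} {y : Rn n} {μ : Measure (Rn n)}

lemma SweptDirac.ae_notMem (hμ : SweptDirac n α D y μ) : ∀ᵐ w ∂μ, w ∉ D :=
  measure_eq_zero_iff_ae_notMem.1 hμ.null

lemma riesz_le_mul_riesz_of_mem_ball (h : RieszRange n α) {z z' w : Rn n} {r : ℝ}
    (hz' : dist z' z < r / 2) (hw : r ≤ dist z w) :
    riesz n α z' w ≤ ENNReal.ofReal ((1 / 2) ^ (α - (n : ℝ))) * riesz n α z w ∧
    riesz n α z w ≤ ENNReal.ofReal ((1 / 2) ^ (α - (n : ℝ))) * riesz n α z' w := by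
  have h1 := dist_triangle z z' w
  have h2 := dist_triangle z' z w
  rw [dist_comm z z'] at h1
  have h0 := dist_nonneg (x := z') (y := z)
  exact ⟨riesz_le_mul_riesz h (by linarith), riesz_le_mul_riesz h (by linarith)⟩

lemma le_dist_of_ball_subset {z w : Rn n} {r : ℝ} (hr : Metric.ball z r ⊆ D) (hw : w ∉ D) :
    r ≤ dist z w := by
  by_contra! hlt
  exact hw (hr (by rwa [Metric.mem_ball, dist_comm]))

lemma SweptDirac.potential_le_mul (h : RieszRange n α) (hμ : SweptDirac n α D y μ) {z z' : Rn n}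
    {r : ℝ} (hr : Metric.ball z r ⊆ D) (hz' : dist z' z < r / 2) :
    potential (riesz n α) μ z ≤
      ENNReal.ofReal ((1 / 2) ^ (α - (n : ℝ))) * potential (riesz n α) μ z' := by
  unfold potential
  rw [← lintegral_const_mul' _ _ ENNReal.ofReal_ne_top]
  refine lintegral_mono_ae ?_
  filter_upwards [hμ.ae_notMem] with w hw
  exact (riesz_le_mul_riesz_of_mem_ball h hz' (le_dist_of_ball_subset hr hw)).2

lemma SweptDirac.potential_ne_top (h : RieszRange n α) (hD : IsOpen D) (hμ : SweptDirac n α D y μ)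
    {z : Rn n} (hz : z ∈ D) : potential (riesz n α) μ z ≠ ⊤ := by
  have : μ.Regular := hμ.memE.1
  obtain ⟨r, hr, hball⟩ := Metric.isOpen_iff.1 hD z hz
  obtain ⟨z', hz', hfin⟩ := (Measure.dense_of_ae (ae_potential_ne_top h μ hμ.memE.2)).inter_open_nonempty
    _ (Metric.isOpen_ball (x := z) (ε := r / 2)) ⟨z, Metric.mem_ball_self (half_pos hr)⟩
  exact ne_top_of_le_ne_top (ENNReal.mul_ne_top ENNReal.ofReal_ne_top hfin)
    (hμ.potential_le_mul h hball hz')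

lemma SweptDirac.continuousAt_potential (h : RieszRange n α) (hD : IsOpen D)
    (hμ : SweptDirac n α D y μ) {z : Rn n} (hz : z ∈ D) :
    ContinuousAt (potential (riesz n α) μ) z := by
  obtain ⟨r, hr, hball⟩ := Metric.isOpen_iff.1 hD z hz
  have hm (z : Rn n) : Measurable (riesz n α z) := measurable_riesz_left h z
  refine tendsto_lintegral_filter_of_dominated_convergence
    (fun w => ENNReal.ofReal ((1 / 2) ^ (α - (n : ℝ))) * riesz n α z w)
    (Eventually.of_forall hm) ?_ ?_ ?_
  · filter_upwards [Metric.ball_mem_nhds z (half_pos hr)] with z' hz'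
    filter_upwards [hμ.ae_notMem] with w hw
    exact (riesz_le_mul_riesz_of_mem_ball h hz' (le_dist_of_ball_subset hball hw)).1
  · rw [lintegral_const_mul _ (hm z)]
    exact ENNReal.mul_ne_top ENNReal.ofReal_ne_top (hμ.potential_ne_top h hD hz)
  · refine ae_of_all _ fun w => ?_
    exact ((continuous_riesz h).comp (continuous_id.prodMk continuous_const)).tendsto z

lemma SweptDirac.potential_le (h : RieszRange n α) (hD : IsOpen D) (hDb : Bornology.IsBounded D)
    (hμ : SweptDirac n α D y μ) {z : Rn n} (hz : z ∈ D) :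
    potential (riesz n α) μ z ≤ riesz n α y z := by
  by_contra! hlt
  have hev := (continuous_riesz_left h y).continuousAt.eventually_lt
    (hμ.continuousAt_potential h hD hz) hlt
  obtain ⟨U, hU, hUo, hzU⟩ := mem_nhds_iff.1 hev
  obtain ⟨z', hz', hle⟩ := (Measure.dense_of_ae (hμ.ae_potential_le h hD hDb)).inter_open_nonempty
    _ hUo ⟨z, hzU⟩
  have hlt' : riesz n α y z' < potential (riesz n α) μ z' := hU hz'
  have hle' : potential (riesz n α) μ z' ≤ riesz n α y z' := hle
  exact hlt'.not_ge hle'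

/-- The function `z ↦ |y - z|^{α-n} - U^μ(z)`. -/
noncomputable def greenFun (n : ℕ) (α : ℝ) (y : Rn n) (μ : Measure (Rn n)) (z : Rn n) : ℝ≥0∞ :=
  riesz n α y z - potential (riesz n α) μ z

lemma measurable_greenFun (h : RieszRange n α) (y : Rn n) (μ : Measure (Rn n)) [SFinite μ] :
    Measurable (greenFun n α y μ) :=
  (measurable_riesz_left h y).sub (measurable_potential_riesz h μ)

lemma greenFun_le (z : Rn n) : greenFun n α y μ z ≤ riesz n α y z := tsub_le_self

lemma SweptDirac.ae_greenFun_eq_zero (hμ : SweptDirac n α D y μ) :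
    ∀ᵐ z, z ∉ D → greenFun n α y μ z = 0 := by
  filter_upwards [hμ.ae_volume] with z hz hzD
  simp [greenFun, hz hzD]

lemma SweptDirac.greenFun_add (h : RieszRange n α) (hD : IsOpen D) (hDb : Bornology.IsBounded D)
    (hμ : SweptDirac n α D y μ) {z : Rn n} (hz : z ∈ D) :
    greenFun n α y μ z + potential (riesz n α) μ z = riesz n α y z :=
  tsub_add_cancel_of_le (hμ.potential_le h hD hDb hz)

lemma SweptDirac.ae_greenFun_add (h : RieszRange n α) (hD : IsOpen D) (hDb : Bornology.IsBounded D)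
    (hμ : SweptDirac n α D y μ) :
    ∀ᵐ z, greenFun n α y μ z + potential (riesz n α) μ z = riesz n α y z := by
  filter_upwards [hμ.ae_potential_le h hD hDb] with z hz
  exact tsub_add_cancel_of_le hz

lemma SweptDirac.continuousAt_greenFun (h : RieszRange n α) (hD : IsOpen D)
    (hμ : SweptDirac n α D y μ) {z : Rn n} (hz : z ∈ D) : ContinuousAt (greenFun n α y μ) z :=
  ENNReal.Tendsto.sub (continuous_riesz_left h y).continuousAt (hμ.continuousAt_potential h hD hz)
    (Or.inr (hμ.potential_ne_top h hD hz))

lemma SweptDirac.levyMass_mul_greenFun (h : RieszRange n α) (hD : IsOpen D)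
    (hDb : Bornology.IsBounded D) (hμ : SweptDirac n α D y μ) (j : ℕ) {z : Rn n}
    (hz : potential (riesz n α) μ z ≠ ⊤)
    (hzadd : greenFun n α y μ z + potential (riesz n α) μ z = riesz n α y z) :
    levyMass α j * greenFun n α y μ z + ∫⁻ w, resKer n α j (z - w) ∂μ =
      kconv (levyKer n α j) (greenFun n α y μ) z + resKer n α j (z - y) := by
  have : μ.Regular := hμ.memE.1
  have hpot := levyMass_mul_potential h j μ z
  have hfin : kconv (levyKer n α j) (potential (riesz n α) μ) z ≠ ⊤ :=
    ne_top_of_le_ne_top (ENNReal.mul_ne_top (levyMass_ne_top j) hz) (hpot ▸ le_self_add)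
  refine (ENNReal.add_right_inj hfin).1 ?_
  calc _ = levyMass α j * greenFun n α y μ z +
        (kconv (levyKer n α j) (potential (riesz n α) μ) z + ∫⁻ w, resKer n α j (z - w) ∂μ) := by ring
    _ = levyMass α j * riesz n α y z := by rw [← hpot, ← mul_add, hzadd]
    _ = kconv (levyKer n α j) (riesz n α y) z + resKer n α j (z - y) := kconv_levyKer_riesz_add h ..
    _ = kconv (levyKer n α j) (greenFun n α y μ) z +
        kconv (levyKer n α j) (potential (riesz n α) μ) z + resKer n α j (z - y) := by
        rw [← kconv_add (measurable_levyKer j) (measurable_greenFun h y μ)]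
        congr 1
        refine (kconv_congr ?_ z).symm
        exact hμ.ae_greenFun_add h hD hDb
    _ = _ := by ring

/-- Weak form of the equation satisfied by the Green function. -/
lemma SweptDirac.lintegral_greenFun (h : RieszRange n α) (hD : IsOpen D)
    (hDb : Bornology.IsBounded D) (hμ : SweptDirac n α D y μ) (j : ℕ) {φ : Rn n → ℝ≥0∞}
    (hφ : Measurable φ) :
    levyMass α j * (∫⁻ z, φ z * greenFun n α y μ z) + ∫⁻ w, kconv (resKer n α j) φ w ∂μ =
      (∫⁻ z, kconv (levyKer n α j) φ z * greenFun n α y μ z) + kconv (resKer n α j) φ y := by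
  have : μ.Regular := hμ.memE.1
  have hg := measurable_greenFun h y μ
  have hL := measurable_levyKer (n := n) (α := α) j
  rw [← lintegral_mul_resKer_measure j μ hφ, lintegral_kconv_mul hL (levyKer_neg j) hφ hg,
    ← lintegral_const_mul _ (f := fun z => φ z * greenFun n α y μ z) (hφ.mul hg)]
  have hy : kconv (resKer n α j) φ y = ∫⁻ z, resKer n α j (y - z) * φ z := rfl
  rw [hy, ← lintegral_add_left (f := fun z => levyMass α j * (φ z * greenFun n α y μ z))
      (measurable_const.mul (hφ.mul hg)),
    ← lintegral_add_left (f := fun z => φ z * kconv (levyKer n α j) (greenFun n α y μ) z)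
      (hφ.mul (measurable_kconv hL hg))]
  refine lintegral_congr_ae ?_
  filter_upwards [hμ.ae_greenFun_add h hD hDb, ae_potential_ne_top h μ hμ.memE.2] with z hz hfin
  have := hμ.levyMass_mul_greenFun h hD hDb j hfin hz
  calc _ = φ z * (levyMass α j * greenFun n α y μ z + ∫⁻ w, resKer n α j (z - w) ∂μ) := by ring
    _ = φ z * (kconv (levyKer n α j) (greenFun n α y μ) z + resKer n α j (z - y)) := by rw [this]
    _ = _ := by rw [resKer_sub_comm j y z]; ring

lemma SweptDirac.lintegral_greenFun_ne_top (h : RieszRange n α) (hD : IsOpen D)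
    (hDb : Bornology.IsBounded D) (hμ : SweptDirac n α D y μ) :
    ∫⁻ z, greenFun n α y μ z ≠ ⊤ := by
  obtain ⟨M, hM, hMb⟩ := exists_setLIntegral_riesz_le h hDb.measure_lt_top.ne
  refine ne_top_of_le_ne_top hM (le_trans ?_ (hMb y))
  rw [← lintegral_indicator hD.measurableSet]
  refine lintegral_mono_ae ?_
  filter_upwards [hμ.ae_greenFun_eq_zero] with z hz
  by_cases hzD : z ∈ D
  · rw [indicator_of_mem hzD]
    exact greenFun_le z
  · simp [hz hzD]

lemma kconv_levyKer_one (h : RieszRange n α) (j : ℕ) (z : Rn n) :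
    kconv (levyKer n α j) 1 z = levyMass α j := by
  unfold kconv
  simp only [Pi.one_apply, mul_one]
  rw [lintegral_sub_left_eq_self (levyKer n α j) z, lintegral_levyKer h]

lemma kconv_resKer_one (j : ℕ) (z : Rn n) : kconv (resKer n α j) 1 z = resMass n α := by
  unfold kconv
  simp only [Pi.one_apply, mul_one]
  exact lintegral_resKer_sub j z

/-- Sweeping onto the complement of a bounded set preserves the mass. -/
lemma SweptDirac.measure_univ (h : RieszRange n α) (hD : IsOpen D)
    (hDb : Bornology.IsBounded D) (hμ : SweptDirac n α D y μ) : μ univ = 1 := by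
  have key := hμ.lintegral_greenFun h hD hDb 0 measurable_one
  simp only [kconv_levyKer_one h, kconv_resKer_one, Pi.one_apply, one_mul, lintegral_const] at key
  have hg := hμ.lintegral_greenFun_ne_top h hD hDb
  rw [lintegral_const_mul' _ _ (levyMass_ne_top 0)] at key
  have := (ENNReal.add_right_inj (ENNReal.mul_ne_top (levyMass_ne_top 0) hg)).1 key
  have h2 : resMass n α * μ univ = resMass n α * 1 := by rw [this, mul_one]
  exact (ENNReal.mul_right_inj (resMass_ne_zero h) (resMass_ne_top h)).1 h2

lemma SweptDirac.potential_le_of_le_dist (h : RieszRange n α) (hD : IsOpen D)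
    (hDb : Bornology.IsBounded D) (hμ : SweptDirac n α D y μ) {z : Rn n} {d : ℝ} (hd : 0 < d)
    (hz : ∀ w ∉ D, d ≤ dist z w) :
    potential (riesz n α) μ z ≤ ENNReal.ofReal (d ^ (α - (n : ℝ))) := by
  calc potential (riesz n α) μ z ≤ ∫⁻ _, ENNReal.ofReal (d ^ (α - (n : ℝ))) ∂μ := by
        refine lintegral_mono_ae ?_
        filter_upwards [hμ.ae_notMem] with w hw
        exact riesz_le_of_le_dist h hd (hz w hw)
    _ = _ := by rw [lintegral_const, hμ.measure_univ h hD hDb, mul_one]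

end single

lemma SweptDirac.potential_comm (h : RieszRange n α) {D : Set (Rn n)} {x y : Rn n}
    {μ ν : Measure (Rn n)} (hμ : SweptDirac n α D x μ) (hν : SweptDirac n α D y ν) :
    potential (riesz n α) μ y = potential (riesz n α) ν x := by
  have : μ.Regular := hμ.memE.1
  have : ν.Regular := hν.memE.1
  have key {x y : Rn n} {μ ν : Measure (Rn n)} (hμ : SweptDirac n α D x μ)
      (hν : SweptDirac n α D y ν) : potential (riesz n α) μ y = energy (riesz n α) μ ν := by
    unfold energy
    conv_lhs => unfold potential
    refine lintegral_congr_ae ?_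
    filter_upwards [hμ.ae_notMem, hν.ae_memE μ hμ.memE] with w hw hw'
    exact (hw' hw).symm
  rw [key hμ hν, key hν hμ, energy_riesz_comm h]

end greenFunction

section killing
variable {n : ℕ} {α : ℝ}

/-- The Lévy kernel of the fractional Laplacian, as the supremum of its truncations. -/
noncomputable def levyKerSup (n : ℕ) (α : ℝ) (x : Rn n) : ℝ≥0∞ := ⨆ j, levyKer n α j x

lemma measurable_levyKerSup : Measurable (levyKerSup n α) := Measurable.iSup measurable_levyKer

lemma levyKerSup_neg (x : Rn n) : levyKerSup n α (-x) = levyKerSup n α x := by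
  simp only [levyKerSup, levyKer_neg]

lemma levyKer_le_levyKerSup (j : ℕ) (x : Rn n) : levyKer n α j x ≤ levyKerSup n α x :=
  le_iSup (fun j => levyKer n α j x) j

lemma kconv_levyKer_mono {i j : ℕ} (hij : i ≤ j) (f : Rn n → ℝ≥0∞) (z : Rn n) :
    kconv (levyKer n α i) f z ≤ kconv (levyKer n α j) f z :=
  lintegral_mono fun _ => mul_le_mul' (levyKer_mono hij _) le_rfl

lemma kconv_levyKerSup {f : Rn n → ℝ≥0∞} (hf : Measurable f) (z : Rn n) :
    kconv (levyKerSup n α) f z = ⨆ j, kconv (levyKer n α j) f z := by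
  unfold kconv levyKerSup
  rw [← lintegral_iSup (f := fun j w => levyKer n α j (z - w) * f w)
    (fun j => (measurable_kernel_sub (measurable_levyKer j) z).mul hf)]
  · refine lintegral_congr fun w => ?_
    rw [ENNReal.iSup_mul]
  · intro i j hij w
    exact mul_le_mul' (levyKer_mono hij _) le_rfl

lemma tendsto_kconv_resKer_indicator_zero (h : RieszRange n α) {A : Set (Rn n)} {p : Rn n} {r : ℝ}
    (hr : 0 < r) (hA : Disjoint (Metric.ball p r) A) :
    Tendsto (fun j => kconv (resKer n α j) (A.indicator 1) p) atTop (𝓝 0) := by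
  refine tendsto_of_tendsto_of_tendsto_of_le_of_le tendsto_const_nhds
    (tendsto_resKer_sub_tail h hr p) (fun _ => zero_le) fun j => ?_
  simp only [kconv]
  rw [← lintegral_indicator measurableSet_ball.compl]
  refine lintegral_mono fun z => ?_
  by_cases hz : z ∈ A
  · have : z ∈ (Metric.ball p r)ᶜ := fun hz' => disjoint_left.1 hA hz' hz
    rw [indicator_of_mem this, indicator_of_mem hz]
    simp
  · simp [indicator_of_notMem hz]

lemma kconv_resKer_indicator_le (j : ℕ) (A : Set (Rn n)) (p : Rn n) :
    kconv (resKer n α j) (A.indicator 1) p ≤ resMass n α := by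
  rw [← kconv_resKer_one (α := α) j p]
  exact kconv_mono (fun z => indicator_le_self' (fun _ _ => zero_le) z) p

lemma tendsto_kconv_resKer_indicator (h : RieszRange n α) {A : Set (Rn n)} {p : Rn n} {r : ℝ}
    (hr : 0 < r) (hA : Metric.ball p r ⊆ A) :
    Tendsto (fun j => kconv (resKer n α j) (A.indicator 1) p) atTop (𝓝 (resMass n α)) := by
  refine tendsto_of_tendsto_of_tendsto_of_le_of_le (tendsto_resKer_sub_ball h hr p)
    tendsto_const_nhds (fun j => ?_) fun j => kconv_resKer_indicator_le j A p
  simp only [kconv]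
  rw [← lintegral_indicator measurableSet_ball]
  refine lintegral_mono fun z => ?_
  by_cases hz : z ∈ Metric.ball p r
  · rw [indicator_of_mem hz, indicator_of_mem (hA hz)]
    simp
  · simp [indicator_of_notMem hz]

/-- The killing rate of the process killed on leaving `D`. -/
noncomputable def killingRate (n : ℕ) (α : ℝ) (D : Set (Rn n)) : Rn n → ℝ≥0∞ :=
  kconv (levyKerSup n α) (Dᶜ.indicator 1)

lemma measurable_killingRate {D : Set (Rn n)} (hD : IsOpen D) : Measurable (killingRate n α D) :=
  measurable_kconv measurable_levyKerSup (measurable_one.indicator hD.measurableSet.compl)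

section single
variable {D : Set (Rn n)} {y : Rn n} {μ : Measure (Rn n)}

lemma SweptDirac.lintegral_levyKer_greenFun (h : RieszRange n α) (hD : IsOpen D)
    (hDb : Bornology.IsBounded D) (hμ : SweptDirac n α D y μ) (j : ℕ) :
    (∫⁻ z, kconv (levyKer n α j) (Dᶜ.indicator 1) z * greenFun n α y μ z) +
      ∫⁻ w, kconv (resKer n α j) (D.indicator 1) w ∂μ =
      kconv (resKer n α j) (D.indicator 1) y := by
  have : μ.Regular := hμ.memE.1
  have hg := measurable_greenFun h y μ
  have hL := measurable_levyKer (n := n) (α := α) j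
  have hDm : Measurable (D.indicator (1 : Rn n → ℝ≥0∞)) := measurable_one.indicator hD.measurableSet
  have key := hμ.lintegral_greenFun h hD hDb j hDm
  have hmass (z : Rn n) : kconv (levyKer n α j) (D.indicator 1) z +
      kconv (levyKer n α j) (Dᶜ.indicator 1) z = levyMass α j := by
    rw [← kconv_add hL hDm, ← kconv_levyKer_one h j z]
    congr 1
    exact funext fun w => indicator_self_add_compl_apply D 1 w
  have hone : levyMass α j * ∫⁻ z, D.indicator 1 z * greenFun n α y μ z =
      (∫⁻ z, kconv (levyKer n α j) (D.indicator 1) z * greenFun n α y μ z) +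
      ∫⁻ z, kconv (levyKer n α j) (Dᶜ.indicator 1) z * greenFun n α y μ z := by
    rw [← lintegral_add_left (f := fun z => kconv (levyKer n α j) (D.indicator 1) z *
      greenFun n α y μ z) ((measurable_kconv hL hDm).mul hg),
      ← lintegral_const_mul' _ _ (levyMass_ne_top j)]
    refine lintegral_congr_ae ?_
    filter_upwards [hμ.ae_greenFun_eq_zero] with z hz
    rw [← add_mul, hmass]
    by_cases hzD : z ∈ D
    · simp [hzD]
    · simp [hz hzD]
  have hfin : ∫⁻ z, kconv (levyKer n α j) (D.indicator 1) z * greenFun n α y μ z ≠ ⊤ := by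
    refine ne_top_of_le_ne_top (ENNReal.mul_ne_top (levyMass_ne_top (α := α) j)
      (hμ.lintegral_greenFun_ne_top h hD hDb)) ?_
    rw [← lintegral_const_mul' _ _ (levyMass_ne_top j)]
    exact lintegral_mono fun z => mul_le_mul' (le_self_add.trans (hmass z).le) le_rfl
  rw [hone, add_assoc] at key
  exact (ENNReal.add_right_inj hfin).1 key

lemma SweptDirac.tendsto_lintegral_levyKer (h : RieszRange n α) (hD : IsOpen D)
    (hμ : SweptDirac n α D y μ) :
    Tendsto (fun j => ∫⁻ z, kconv (levyKer n α j) (Dᶜ.indicator 1) z * greenFun n α y μ z) atTop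
      (𝓝 (∫⁻ z, killingRate n α D z * greenFun n α y μ z)) := by
  have : μ.Regular := hμ.memE.1
  have hC : Measurable (Dᶜ.indicator (1 : Rn n → ℝ≥0∞)) :=
    measurable_one.indicator hD.measurableSet.compl
  refine lintegral_tendsto_of_tendsto_of_monotone
    (fun j => ((measurable_kconv (measurable_levyKer j) hC).mul
      (measurable_greenFun h y μ)).aemeasurable)
    (ae_of_all _ fun z i j hij => mul_le_mul' (kconv_levyKer_mono hij _ z) le_rfl) ?_
  filter_upwards [] with z
  have hmono : Monotone fun j => kconv (levyKer n α j) (Dᶜ.indicator 1) z * greenFun n α y μ z :=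
    fun i j hij => mul_le_mul' (kconv_levyKer_mono hij _ z) le_rfl
  have := tendsto_atTop_iSup hmono
  rwa [← ENNReal.iSup_mul, ← kconv_levyKerSup hC] at this

lemma SweptDirac.lintegral_killingRate_le (h : RieszRange n α) (hD : IsOpen D)
    (hDb : Bornology.IsBounded D) (hμ : SweptDirac n α D y μ) :
    ∫⁻ z, killingRate n α D z * greenFun n α y μ z ≤ resMass n α :=
  le_of_tendsto' (hμ.tendsto_lintegral_levyKer h hD) fun j =>
    (le_self_add.trans (hμ.lintegral_levyKer_greenFun h hD hDb j).le).trans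
      (kconv_resKer_indicator_le j D y)

lemma SweptDirac.lintegral_kconv_resKer_indicator_le (h : RieszRange n α) (hD : IsOpen D)
    (hDb : Bornology.IsBounded D) (hμ : SweptDirac n α D y μ) (j : ℕ) {A : Set (Rn n)}
    (hA : MeasurableSet A) :
    ∫⁻ w, kconv (resKer n α j) (A.indicator 1) w ∂μ ≤
      volume.withDensity (kconv (levyKerSup n α) (greenFun n α y μ)) A +
        kconv (resKer n α j) (A.indicator 1) y := by
  have : μ.Regular := hμ.memE.1
  have hAm : Measurable (A.indicator (1 : Rn n → ℝ≥0∞)) := measurable_one.indicator hA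
  have hg := measurable_greenFun h y μ
  refine (le_add_self.trans (hμ.lintegral_greenFun h hD hDb j hAm).le).trans
    (add_le_add ?_ le_rfl)
  rw [withDensity_apply _ hA, ← lintegral_indicator hA]
  calc _ ≤ ∫⁻ z, kconv (levyKerSup n α) (A.indicator 1) z * greenFun n α y μ z :=
        lintegral_mono fun z => mul_le_mul' (lintegral_mono fun w =>
          mul_le_mul' (levyKer_le_levyKerSup j _) le_rfl) le_rfl
    _ = ∫⁻ z, A.indicator 1 z * kconv (levyKerSup n α) (greenFun n α y μ) z :=
        lintegral_kconv_mul measurable_levyKerSup levyKerSup_neg hAm hg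
    _ ≤ _ := by
        refine lintegral_mono fun z => ?_
        by_cases hz : z ∈ A <;> simp [hz]

/-- An exterior tangent ball at `p` carries a fixed part of the mass of the residual kernels. -/
lemma exists_eventually_le_kconv_resKer (h : RieszRange n α) :
    ∃ θ : ℝ≥0∞, θ ≠ 0 ∧ ∀ (p q : Rn n) (R r : ℝ), 0 < R → dist p q = R → 0 < r →
      ∀ A : Set (Rn n), Metric.ball q R ∩ Metric.ball p r ⊆ A →
      ∀ᶠ j in atTop, θ ≤ kconv (resKer n α j) (A.indicator 1) p := by
  obtain ⟨θ, hθ, s, hs, hslim, hball⟩ := exists_le_setLIntegral_resKer_ball h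
  refine ⟨θ, hθ, fun p q R r hR hpq hr A hA => ?_⟩
  filter_upwards [hslim.eventually_lt_const hR, hslim.eventually_lt_const (half_pos hr)]
    with j hjR hjr
  have hqp : ‖q - p‖ = R := by rw [← hpq, dist_comm, dist_eq_norm]
  set u : Rn n := (s j / R) • (q - p) with hu
  have hunorm : ‖u‖ = s j := by
    rw [hu, norm_smul, hqp, Real.norm_of_nonneg (div_nonneg (hs j).le hR.le),
      div_mul_cancel₀ _ hR.ne']
  have hq : ‖q - p - u‖ = R - s j := by
    have : q - p - u = (1 - s j / R) • (q - p) := by rw [hu, sub_smul, one_smul]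
    rw [this, norm_smul, hqp, Real.norm_of_nonneg (by
      rw [sub_nonneg, div_le_one hR]; exact hjR.le)]
    field_simp
  refine (hball j (-u) (by rw [norm_neg, hunorm])).trans ?_
  unfold kconv
  rw [← lintegral_sub_left_eq_self (fun z => resKer n α j (p - z) * A.indicator 1 z) p,
    ← lintegral_indicator measurableSet_ball]
  refine lintegral_mono fun z => ?_
  by_cases hz : z ∈ Metric.ball (-u) (s j)
  · have hz' : ‖z + u‖ < s j := by simpa [dist_eq_norm] using hz
    have hmem : p - z ∈ A := by
      refine hA ⟨?_, ?_⟩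
      · rw [Metric.mem_ball, dist_eq_norm]
        calc ‖p - z - q‖ = ‖-(q - p - u) - (z + u)‖ := by congr 1; abel
          _ ≤ ‖-(q - p - u)‖ + ‖z + u‖ := norm_sub_le _ _
          _ < R := by rw [norm_neg, hq]; linarith
      · rw [Metric.mem_ball, dist_eq_norm]
        calc ‖p - z - p‖ = ‖u - (z + u)‖ := by congr 1; abel
          _ ≤ ‖u‖ + ‖z + u‖ := norm_sub_le _ _
          _ < r := by rw [hunorm]; linarith
    rw [indicator_of_mem hz]
    simp [hmem]
  · simp [indicator_of_notMem hz]

lemma SweptDirac.measure_frontier (h : RieszRange n α) (hD : IsOpen D)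
    (hDb : Bornology.IsBounded D) (hD11 : C11 n D) (hy : y ∈ D) (hμ : SweptDirac n α D y μ) :
    μ (frontier D) = 0 := by
  have : μ.Regular := hμ.memE.1
  have hg := measurable_greenFun h y μ
  obtain ⟨θ, hθ, hball⟩ := exists_eventually_le_kconv_resKer h
  obtain ⟨r, hr, hry⟩ := Metric.isOpen_iff.1 hD y hy
  set Λ := volume.withDensity (kconv (levyKerSup n α) (greenFun n α y μ)) with hΛ
  have hCm : Measurable (Dᶜ.indicator (1 : Rn n → ℝ≥0∞)) :=
    measurable_one.indicator hD.measurableSet.compl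
  have hΛfin : Λ Dᶜ ≠ ⊤ := by
    refine ne_top_of_le_ne_top (resMass_ne_top h)
      (le_trans (le_of_eq ?_) (hμ.lintegral_killingRate_le h hD hDb))
    unfold killingRate
    rw [hΛ, withDensity_apply _ hD.measurableSet.compl,
      ← lintegral_indicator hD.measurableSet.compl,
      lintegral_kconv_mul measurable_levyKerSup levyKerSup_neg hCm hg]
    refine lintegral_congr fun z => ?_
    by_cases hz : z ∈ D <;> simp [hz]
  set A : ℕ → Set (Rn n) := fun k => (closure D)ᶜ ∩ Metric.thickening (trunc k) D with hAdef
  have hAm (k : ℕ) : MeasurableSet (A k) :=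
    isClosed_closure.isOpen_compl.measurableSet.inter Metric.isOpen_thickening.measurableSet
  have hAD (k : ℕ) : A k ⊆ Dᶜ := fun z hz hzD => hz.1 (subset_closure hzD)
  have hlow (k : ℕ) : θ * μ (frontier D) ≤ Λ (A k) := by
    have hAind : Measurable ((A k).indicator (1 : Rn n → ℝ≥0∞)) := measurable_one.indicator (hAm k)
    have hylim : Tendsto (fun j => kconv (resKer n α j) ((A k).indicator 1) y) atTop (𝓝 0) :=
      tendsto_kconv_resKer_indicator_zero h hr
        (disjoint_left.2 fun z hz hzA => hAD k hzA (hry hz))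
    calc θ * μ (frontier D) = ∫⁻ w in frontier D, θ ∂μ := by rw [setLIntegral_const]
      _ ≤ ∫⁻ w in frontier D, liminf (fun j => kconv (resKer n α j) ((A k).indicator 1) w) atTop ∂μ := by
          refine setLIntegral_mono' isClosed_frontier.measurableSet fun w hw => ?_
          obtain ⟨-, q, R, hR, -, hq, -, hwq⟩ := hD11 w hw
          refine le_liminf_of_le (by isBoundedDefault)
            (hball w q R (trunc k) hR hwq (trunc_pos k) (A k) ?_)
          rintro z ⟨hzq, hzw⟩
          refine ⟨fun hzc => ?_, ?_⟩
          · obtain ⟨t, htq, htD⟩ := mem_closure_iff.1 hzc _ Metric.isOpen_ball hzq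
            exact hq htq htD
          · obtain ⟨t, htw, htD⟩ := mem_closure_iff.1 (frontier_subset_closure hw) _
              Metric.isOpen_ball (show w ∈ Metric.ball z (trunc k) by
                rwa [Metric.mem_ball, dist_comm])
            rw [Metric.mem_thickening_iff]
            exact ⟨t, htD, by rwa [Metric.mem_ball, dist_comm] at htw⟩
      _ ≤ liminf (fun j => ∫⁻ w in frontier D, kconv (resKer n α j) ((A k).indicator 1) w ∂μ) atTop :=
          lintegral_liminf_le fun j => measurable_kconv (measurable_resKer j) hAind
      _ ≤ liminf (fun j => Λ (A k) + kconv (resKer n α j) ((A k).indicator 1) y) atTop :=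
          liminf_le_liminf (Eventually.of_forall fun j => (setLIntegral_le_lintegral _ _).trans
            (hμ.lintegral_kconv_resKer_indicator_le h hD hDb j (hAm k)))
      _ = Λ (A k) := by
          have := (tendsto_const_nhds (x := Λ (A k))).add hylim
          rw [add_zero] at this
          exact this.liminf_eq
  have hempty : ⋂ k, A k = ∅ := by
    refine eq_empty_of_forall_notMem fun z hz => ?_
    have hz' := mem_iInter.1 hz
    refine (hz' 0).1 (Metric.mem_closure_iff.2 fun ε hε => ?_)
    obtain ⟨k, hk⟩ := (tendsto_trunc.eventually_lt_const hε).exists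
    obtain ⟨t, htD, ht⟩ := Metric.mem_thickening_iff.1 (hz' k).2
    exact ⟨t, htD, ht.trans hk⟩
  have hlim : Tendsto (fun k => Λ (A k)) atTop (𝓝 0) := by
    have := tendsto_measure_iInter_atTop (μ := Λ) (s := A) (fun k => (hAm k).nullMeasurableSet)
      (fun i j hij => inter_subset_inter_right _ (Metric.thickening_mono (trunc_anti hij) D))
      ⟨0, ne_top_of_le_ne_top hΛfin (measure_mono (hAD 0))⟩
    rwa [hempty, measure_empty] at this
  have hz := le_antisymm (ge_of_tendsto' hlim hlow) zero_le
  exact (mul_eq_zero.1 hz).resolve_left hθ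

/-- The killed process dies almost surely by jumping out of `D`. -/
lemma SweptDirac.lintegral_killingRate (h : RieszRange n α) (hD : IsOpen D)
    (hDb : Bornology.IsBounded D) (hD11 : C11 n D) (hy : y ∈ D) (hμ : SweptDirac n α D y μ) :
    ∫⁻ z, killingRate n α D z * greenFun n α y μ z = resMass n α := by
  have : μ.Regular := hμ.memE.1
  have hDm : Measurable (D.indicator (1 : Rn n → ℝ≥0∞)) := measurable_one.indicator hD.measurableSet
  obtain ⟨r, hr, hry⟩ := Metric.isOpen_iff.1 hD y hy
  have hJ : Tendsto (fun j => ∫⁻ w, kconv (resKer n α j) (D.indicator 1) w ∂μ) atTop (𝓝 0) := by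
    have := tendsto_lintegral_of_dominated_convergence (μ := μ)
      (F := fun j w => kconv (resKer n α j) (D.indicator 1) w) (f := fun _ => 0)
      (fun _ => resMass n α) (fun j => measurable_kconv (measurable_resKer j) hDm)
      (fun j => ae_of_all _ fun w => kconv_resKer_indicator_le j D w)
      (by
        rw [lintegral_const, hμ.measure_univ h hD hDb, mul_one]
        exact resMass_ne_top h) ?_
    · simpa using this
    · filter_upwards [hμ.ae_notMem,
        measure_eq_zero_iff_ae_notMem.1 (hμ.measure_frontier h hD hDb hD11 hy)] with w hw hwf
      have hwc : w ∈ (closure D)ᶜ := by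
        rw [closure_eq_self_union_frontier]
        exact fun hmem => hmem.elim hw hwf
      obtain ⟨s, hs, hsub⟩ := Metric.isOpen_iff.1 isClosed_closure.isOpen_compl w hwc
      exact tendsto_kconv_resKer_indicator_zero h hs
        (disjoint_left.2 fun z hz hzD => hsub hz (subset_closure hzD))
  have hsum := (hμ.tendsto_lintegral_levyKer h hD).add hJ
  simp only [hμ.lintegral_levyKer_greenFun h hD hDb, add_zero] at hsum
  exact tendsto_nhds_unique hsum (tendsto_kconv_resKer_indicator h hr hry)

end single

end killing

section greenKernel
variable {n : ℕ} {α : ℝ} {D : Set (Rn n)} {ε : Rn n → Measure (Rn n)}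

lemma green_of_mem {z y : Rn n} (hz : z ∈ D) (hy : y ∈ D) :
    green n α D ε z y = greenFun n α y (ε y) z := by
  rw [green, if_pos ⟨hz, hy⟩, greenFun, riesz_comm z y, potential]

lemma green_of_notMem_left {z : Rn n} (y : Rn n) (hz : z ∉ D) : green n α D ε z y = 0 :=
  if_neg fun hmem => hz hmem.1

lemma green_of_notMem_right (z : Rn n) {y : Rn n} (hy : y ∉ D) : green n α D ε z y = 0 :=
  if_neg fun hmem => hy hmem.2

lemma green_le_riesz (z y : Rn n) : green n α D ε z y ≤ riesz n α y z := by
  unfold green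
  split_ifs
  · rw [riesz_comm y z]
    exact tsub_le_self
  · exact zero_le

lemma green_comm (h : RieszRange n α) (hε : ∀ y ∈ D, SweptDirac n α D y (ε y)) (z y : Rn n) :
    green n α D ε z y = green n α D ε y z := by
  by_cases hz : z ∈ D
  · by_cases hy : y ∈ D
    · rw [green_of_mem hz hy, green_of_mem hy hz, greenFun, greenFun, riesz_comm z y,
        SweptDirac.potential_comm h (hε y hy) (hε z hz)]
    · rw [green_of_notMem_right z hy, green_of_notMem_left z hy]
  · rw [green_of_notMem_left y hz, green_of_notMem_right y hz]

lemma continuousAt_green (h : RieszRange n α) (hD : IsOpen D)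
    (hε : ∀ y ∈ D, SweptDirac n α D y (ε y)) {z : Rn n} (hz : z ∈ D) (y : Rn n) :
    ContinuousAt (fun z => green n α D ε z y) z := by
  by_cases hy : y ∈ D
  · refine ((hε y hy).continuousAt_greenFun h hD hz).congr ?_
    filter_upwards [hD.mem_nhds hz] with z' hz'
    exact (green_of_mem hz' hy).symm
  · simp only [green_of_notMem_right _ hy]
    exact continuousAt_const

lemma ae_green_eq_greenFun (hε : ∀ y ∈ D, SweptDirac n α D y (ε y)) {y : Rn n} (hy : y ∈ D) :
    (fun z => green n α D ε z y) =ᵐ[volume] greenFun n α y (ε y) := by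
  filter_upwards [(hε y hy).ae_greenFun_eq_zero] with z hz
  by_cases hzD : z ∈ D
  · exact green_of_mem hzD hy
  · simp only [green_of_notMem_left y hzD, hz hzD]

lemma measurable_green (h : RieszRange n α) (hD : IsOpen D)
    (hε : ∀ y ∈ D, SweptDirac n α D y (ε y)) :
    Measurable fun p : Rn n × Rn n => green n α D ε p.1 p.2 := by
  have hDD : MeasurableSet (D ×ˢ D) := hD.measurableSet.prod hD.measurableSet
  refine measurable_of_restrict_of_restrict_compl hDD ?_ ?_
  · have key : Measurable (Function.uncurry fun z y : D => green n α D ε z y) := by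
      refine measurable_uncurry_of_continuous_of_measurable (fun y => ?_) fun z => ?_
      · refine continuous_iff_continuousAt.2 fun z => ?_
        exact (continuousAt_green h hD hε z.2 y).comp continuous_subtype_val.continuousAt
      · have : (ε z).Regular := (hε z z.2).memE.1
        have heq : (fun y : D => green n α D ε z y) = fun y : D => greenFun n α z (ε z) y :=
          funext fun y => (green_comm h hε _ _).trans (green_of_mem y.2 z.2)
        rw [heq]
        exact (measurable_greenFun h _ _).comp measurable_subtype_coe
    have hmap : Measurable fun p : ↥(D ×ˢ D) => ((⟨p.1.1, p.2.1⟩, ⟨p.1.2, p.2.2⟩) : D × D) :=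
      (measurable_subtype_coe.fst.subtype_mk).prodMk (measurable_subtype_coe.snd.subtype_mk)
    exact key.comp hmap
  · have : (D ×ˢ D)ᶜ.domRestrict (fun p : Rn n × Rn n => green n α D ε p.1 p.2) = fun _ => 0 :=
      funext fun p => if_neg p.2
    rw [this]
    exact measurable_const

lemma measurable_green_left (h : RieszRange n α) (hD : IsOpen D)
    (hε : ∀ y ∈ D, SweptDirac n α D y (ε y)) (y : Rn n) :
    Measurable fun z => green n α D ε z y :=
  (measurable_green h hD hε).comp (measurable_id.prodMk measurable_const)

lemma measurable_green_right (h : RieszRange n α) (hD : IsOpen D)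
    (hε : ∀ y ∈ D, SweptDirac n α D y (ε y)) (z : Rn n) :
    Measurable (green n α D ε z) :=
  (measurable_green h hD hε).comp (measurable_const.prodMk measurable_id)

lemma measurable_potential_green (h : RieszRange n α) (hD : IsOpen D)
    (hε : ∀ y ∈ D, SweptDirac n α D y (ε y)) (ρ : Measure (Rn n)) [SFinite ρ] :
    Measurable (potential (green n α D ε) ρ) :=
  (measurable_green h hD hε).lintegral_prod_right'

lemma potential_green_of_notMem {ρ : Measure (Rn n)} {z : Rn n} (hz : z ∉ D) :
    potential (green n α D ε) ρ z = 0 := by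
  simp [potential, green_of_notMem_left _ hz]

lemma potential_green_le_riesz (ρ : Measure (Rn n)) (z : Rn n) :
    potential (green n α D ε) ρ z ≤ potential (riesz n α) ρ z :=
  lintegral_mono fun y => (green_le_riesz z y).trans (riesz_comm y z).le

lemma lowerSemicontinuousAt_potential_green (h : RieszRange n α) (hD : IsOpen D)
    (hε : ∀ y ∈ D, SweptDirac n α D y (ε y)) (ρ : Measure (Rn n)) {p : Rn n} (hp : p ∈ D) :
    LowerSemicontinuousAt (potential (green n α D ε) ρ) p :=
  lowerSemicontinuousAt_lintegral (fun z => measurable_green_right h hD hε z)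
    (ae_of_all _ fun y => (continuousAt_green h hD hε hp y).lowerSemicontinuousAt)

lemma kconv_potential_green (h : RieszRange n α) (hD : IsOpen D)
    (hε : ∀ y ∈ D, SweptDirac n α D y (ε y)) {J : Rn n → ℝ≥0∞} (hJ : Measurable J)
    (ρ : Measure (Rn n)) [SFinite ρ] (p : Rn n) :
    kconv J (potential (green n α D ε) ρ) p =
      ∫⁻ y, kconv J (fun z => green n α D ε z y) p ∂ρ := by
  unfold kconv potential
  have hm : Measurable fun q : Rn n × Rn n => J (p - q.1) * green n α D ε q.1 q.2 :=
    ((measurable_kernel_sub hJ p).comp measurable_fst).mul (measurable_green h hD hε)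
  rw [← lintegral_lintegral_swap hm.aemeasurable]
  exact lintegral_congr fun z => (lintegral_const_mul _ (measurable_green_right h hD hε z)).symm

lemma levyMass_mul_green (h : RieszRange n α) (hD : IsOpen D) (hDb : Bornology.IsBounded D)
    (hε : ∀ y ∈ D, SweptDirac n α D y (ε y)) (j : ℕ) {z y : Rn n} (hz : z ∈ D) (hy : y ∈ D) :
    levyMass α j * green n α D ε z y + ∫⁻ w, resKer n α j (z - w) ∂(ε y) =
      kconv (levyKer n α j) (fun z => green n α D ε z y) z + resKer n α j (z - y) := by
  rw [green_of_mem hz hy, kconv_congr (ae_green_eq_greenFun hε hy),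
    (hε y hy).levyMass_mul_greenFun h hD hDb j ((hε y hy).potential_ne_top h hD hz)
      ((hε y hy).greenFun_add h hD hDb hz)]

lemma levyMass_mul_potential_green_le (h : RieszRange n α) (hD : IsOpen D)
    (hDb : Bornology.IsBounded D) (hε : ∀ y ∈ D, SweptDirac n α D y (ε y)) (j : ℕ)
    (ρ : Measure (Rn n)) [SFinite ρ] (hρ : ∀ᵐ y ∂ρ, y ∈ D) {z : Rn n} (hz : z ∈ D) :
    levyMass α j * potential (green n α D ε) ρ z ≤
      kconv (levyKer n α j) (potential (green n α D ε) ρ) z + ∫⁻ y, resKer n α j (z - y) ∂ρ := by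
  rw [kconv_potential_green h hD hε (measurable_levyKer j),
    ← lintegral_add_right _ (measurable_kernel_sub (measurable_resKer j) z), potential,
    ← lintegral_const_mul' _ _ (levyMass_ne_top j)]
  refine lintegral_mono_ae ?_
  filter_upwards [hρ] with y hy
  exact le_self_add.trans (levyMass_mul_green h hD hDb hε j hz hy).le

lemma kconv_resKer_green_le (h : RieszRange n α) (j : ℕ) (p y : Rn n) :
    kconv (resKer n α j) (fun z => green n α D ε z y) p ≤ resBound h * riesz n α y p :=
  (kconv_mono (fun z => green_le_riesz z y) p).trans (kconv_resKer_riesz_le h j p y)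

lemma tendsto_kconv_resKer_green (h : RieszRange n α) (hD : IsOpen D) (hDb : Bornology.IsBounded D)
    (hε : ∀ y ∈ D, SweptDirac n α D y (ε y)) {p y : Rn n} (hp : p ∈ D) (hy : y ∈ D) :
    Tendsto (fun j => kconv (resKer n α j) (fun z => green n α D ε z y) p) atTop
      (𝓝 (resMass n α * green n α D ε p y)) := by
  have hμ := hε y hy
  have : (ε y).Regular := hμ.memE.1
  have hUp := hμ.potential_ne_top h hD hp
  have hUlim := tendsto_kconv_resKer_potential h (ε y) hUp
  have htop : resMass n α * potential (riesz n α) (ε y) p ≠ ⊤ :=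
    ENNReal.mul_ne_top (resMass_ne_top h) hUp
  have hsub := ENNReal.Tendsto.sub (tendsto_kconv_resKer_riesz h p y) hUlim (Or.inr htop)
  rw [← ENNReal.mul_sub (fun _ _ => resMass_ne_top h), ← greenFun, ← green_of_mem hp hy] at hsub
  refine hsub.congr' ?_
  filter_upwards [hUlim.eventually_ne htop] with j hj
  have hadd : kconv (resKer n α j) (fun z => green n α D ε z y) p +
      kconv (resKer n α j) (potential (riesz n α) (ε y)) p = kconv (resKer n α j) (riesz n α y) p := by
    rw [kconv_congr (ae_green_eq_greenFun hε hy),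
      ← kconv_add (measurable_resKer j) (measurable_greenFun h y (ε y))]
    exact kconv_congr (hμ.ae_greenFun_add h hD hDb) p
  rw [← hadd, ENNReal.add_sub_cancel_right hj]

lemma tendsto_kconv_resKer_green_zero (h : RieszRange n α)
    (hε : ∀ y ∈ D, SweptDirac n α D y (ε y)) {p y : Rn n} (hy : y ∈ D) (hpy : y ≠ p)
    (hp : potential (riesz n α) (ε y) p = riesz n α y p) :
    Tendsto (fun j => kconv (resKer n α j) (fun z => green n α D ε z y) p) atTop (𝓝 0) := by
  have : (ε y).Regular := (hε y hy).memE.1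
  simp only [kconv_congr (ae_green_eq_greenFun hε hy)]
  refine tendsto_kconv_resKer_zero h (measurable_greenFun h y (ε y)) (b := riesz n α y)
    (m := fun z => min (potential (riesz n α) (ε y) z) (riesz n α y z)) (fun z => ?_)
    (riesz_ne_top hpy) (tendsto_kconv_resKer_riesz h p y) ?_
  · simp only [greenFun]
    rcases le_total (potential (riesz n α) (ε y) z) (riesz n α y z) with hle | hle
    · rw [min_eq_left hle, tsub_add_cancel_of_le hle]
    · rw [min_eq_right hle, tsub_eq_zero_of_le hle, zero_add]
  · have heq : riesz n α y p = min (potential (riesz n α) (ε y) p) (riesz n α y p) := by simp [hp]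
    rw [heq]
    refine le_liminf_kconv_resKer h ?_
    exact (lowerSemicontinuousAt_potential_riesz h (ε y) p).inf
      (continuous_riesz_left h y).continuousAt.lowerSemicontinuousAt

end greenKernel

section domination
variable {n : ℕ} {α : ℝ} {D : Set (Rn n)} {ε : Rn n → Measure (Rn n)}

lemma exists_pos_forall_le_dist {K U : Set (Rn n)} (hK : IsCompact K) (hU : IsOpen U)
    (hKU : K ⊆ U) : ∃ d : ℝ, 0 < d ∧ ∀ z ∈ K, ∀ w ∉ U, d ≤ dist z w := by
  obtain ⟨d, hd, hsub⟩ := hK.exists_thickening_subset_open hU hKU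
  refine ⟨d, hd, fun z hz w hw => ?_⟩
  by_contra! hlt
  exact hw (hsub (Metric.mem_thickening_iff.2 ⟨z, hz, by rwa [dist_comm]⟩))

lemma exists_potential_le_of_green_le (h : RieszRange n α) (hD : IsOpen D)
    (hDb : Bornology.IsBounded D) (hε : ∀ y ∈ D, SweptDirac n α D y (ε y)) {K : Set (Rn n)}
    (hK : IsCompact K) (hKD : K ⊆ D) (ρ : Measure (Rn n)) [IsFiniteMeasure ρ]
    (hρ : ∀ᵐ y ∂ρ, y ∈ K) {x : Rn n} (hxK : x ∉ K)
    (hq : ∀ᵐ z ∂ρ, potential (green n α D ε) ρ z ≤ green n α D ε z x) :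
    ∃ M : ℝ≥0∞, M ≠ ⊤ ∧ ∀ᵐ z ∂ρ, potential (riesz n α) ρ z ≤ M := by
  obtain ⟨d, hd, hdist⟩ := exists_pos_forall_le_dist hK hD hKD
  obtain ⟨d', hd', hdist'⟩ := exists_pos_forall_le_dist hK isOpen_compl_singleton
    (subset_compl_singleton_iff.2 hxK)
  refine ⟨ENNReal.ofReal (d' ^ (α - (n : ℝ))) + ENNReal.ofReal (d ^ (α - (n : ℝ))) * ρ univ,
    ENNReal.add_ne_top.2 ⟨ENNReal.ofReal_ne_top,
      ENNReal.mul_ne_top ENNReal.ofReal_ne_top (measure_ne_top ρ univ)⟩, ?_⟩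
  filter_upwards [hρ, hq] with z hzK hz
  calc potential (riesz n α) ρ z
      ≤ ∫⁻ y, (green n α D ε z y + ENNReal.ofReal (d ^ (α - (n : ℝ)))) ∂ρ := by
        refine lintegral_mono_ae ?_
        filter_upwards [hρ] with y hy
        rw [green_of_mem (hKD hzK) (hKD hy), riesz_comm z y,
          ← (hε y (hKD hy)).greenFun_add h hD hDb (hKD hzK)]
        gcongr
        exact (hε y (hKD hy)).potential_le_of_le_dist h hD hDb hd (hdist z hzK)
    _ = potential (green n α D ε) ρ z + ENNReal.ofReal (d ^ (α - (n : ℝ))) * ρ univ := by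
        rw [lintegral_add_right _ measurable_const, lintegral_const, potential]
    _ ≤ _ := by
        gcongr
        refine (hz.trans (green_le_riesz z x)).trans ?_
        rw [riesz_comm]
        exact riesz_le_of_le_dist h hd' (hdist' z hzK x (by simp))

lemma tendsto_lintegral_kconv_resKer_potential_green (h : RieszRange n α) (hD : IsOpen D)
    (hDb : Bornology.IsBounded D) (hε : ∀ y ∈ D, SweptDirac n α D y (ε y)) {K : Set (Rn n)}
    (hK : IsCompact K) (hKD : K ⊆ D) (ρ : Measure (Rn n)) [IsFiniteMeasure ρ]
    (hρ : ∀ᵐ y ∂ρ, y ∈ K) {x : Rn n} (hx : x ∈ D) :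
    Tendsto (fun j => ∫⁻ w, kconv (resKer n α j) (potential (green n α D ε) ρ) w ∂(ε x)) atTop
      (𝓝 0) := by
  obtain ⟨d, hd, hdist⟩ := exists_pos_forall_le_dist hK hD hKD
  have hμ := hε x hx
  have : (ε x).Regular := hμ.memE.1
  have hJ (j : ℕ) : Measurable fun p : Rn n × Rn n =>
      kconv (resKer n α j) (fun z => green n α D ε z p.2) p.1 := by
    unfold kconv
    refine Measurable.lintegral_prod_right'
      (f := fun q : (Rn n × Rn n) × Rn n => resKer n α j (q.1.1 - q.2) * green n α D ε q.2 q.1.2)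
      (Measurable.mul ?_ ?_)
    · exact (measurable_resKer j).comp (measurable_fst.fst.sub measurable_snd)
    · exact (measurable_green h hD hε).comp (measurable_snd.prodMk measurable_fst.snd)
  have hswap (j : ℕ) : ∫⁻ w, kconv (resKer n α j) (potential (green n α D ε) ρ) w ∂(ε x) =
      ∫⁻ y, ∫⁻ w, kconv (resKer n α j) (fun z => green n α D ε z y) w ∂(ε x) ∂ρ := by
    rw [← lintegral_lintegral_swap (hJ j).aemeasurable]
    exact lintegral_congr fun w => kconv_potential_green h hD hε (measurable_resKer j) ρ w
  have hbound (j : ℕ) (y : Rn n) :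
      ∫⁻ w, kconv (resKer n α j) (fun z => green n α D ε z y) w ∂(ε x) ≤
        resBound h * potential (riesz n α) (ε x) y := by
    rw [potential, ← lintegral_const_mul' _ _ (resBound_ne_top h)]
    exact lintegral_mono fun w => kconv_resKer_green_le h j w y
  simp only [hswap]
  have := tendsto_lintegral_of_dominated_convergence (μ := ρ)
    (F := fun j y => ∫⁻ w, kconv (resKer n α j) (fun z => green n α D ε z y) w ∂(ε x))
    (f := fun _ => 0) (fun _ => resBound h * ENNReal.ofReal (d ^ (α - (n : ℝ))))
    (fun j => (hJ j).lintegral_prod_left') (fun j => ?_) ?_ ?_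
  · simpa using this
  · filter_upwards [hρ] with y hy
    refine (hbound j y).trans (mul_le_mul' le_rfl ?_)
    exact hμ.potential_le_of_le_dist h hD hDb hd (hdist y hy)
  · rw [lintegral_const]
    exact ENNReal.mul_ne_top (ENNReal.mul_ne_top (resBound_ne_top h) ENNReal.ofReal_ne_top)
      (measure_ne_top ρ univ)
  · filter_upwards [hρ] with y hy
    have hyD := hKD hy
    have := tendsto_lintegral_of_dominated_convergence (μ := ε x)
      (F := fun j w => kconv (resKer n α j) (fun z => green n α D ε z y) w)
      (f := fun _ => 0) (fun w => resBound h * riesz n α y w)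
      (fun j => measurable_kconv (measurable_resKer j) (measurable_green_left h hD hε y))
      (fun j => ae_of_all _ fun w => kconv_resKer_green_le h j w y) (by
        rw [lintegral_const_mul' _ _ (resBound_ne_top h)]
        exact ENNReal.mul_ne_top (resBound_ne_top h) (hμ.potential_ne_top h hD hyD)) ?_
    · simpa using this
    · filter_upwards [(hε y hyD).ae_memE (ε x) hμ.memE, hμ.ae_notMem] with w hw hwD
      exact tendsto_kconv_resKer_green_zero h hε hyD (fun heq => hwD (heq ▸ hyD)) (hw hwD)

lemma tendsto_kconv_resKer_potential_green (h : RieszRange n α) (hD : IsOpen D)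
    (hDb : Bornology.IsBounded D) (hε : ∀ y ∈ D, SweptDirac n α D y (ε y))
    (ρ : Measure (Rn n)) [SFinite ρ] (hρ : ∀ᵐ y ∂ρ, y ∈ D) {p : Rn n} (hp : p ∈ D)
    (hpt : potential (riesz n α) ρ p ≠ ⊤) :
    Tendsto (fun j => kconv (resKer n α j) (potential (green n α D ε) ρ) p) atTop
      (𝓝 (resMass n α * potential (green n α D ε) ρ p)) := by
  have hJ (j : ℕ) : Measurable fun y => kconv (resKer n α j) (fun z => green n α D ε z y) p := by
    unfold kconv
    refine Measurable.lintegral_prod_right'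
      (f := fun q : Rn n × Rn n => resKer n α j (p - q.2) * green n α D ε q.2 q.1)
      (Measurable.mul ?_ ?_)
    · exact (measurable_resKer j).comp (measurable_const.sub measurable_snd)
    · exact (measurable_green h hD hε).comp measurable_swap
  simp only [kconv_potential_green h hD hε (measurable_resKer _)]
  rw [potential, ← lintegral_const_mul' _ _ (resMass_ne_top h)]
  refine tendsto_lintegral_of_dominated_convergence (fun y => resBound h * riesz n α y p) hJ
    (fun j => ae_of_all _ fun y => kconv_resKer_green_le h j p y) ?_ ?_
  · rw [lintegral_const_mul' _ _ (resBound_ne_top h)]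
    simp only [riesz_comm _ p]
    exact ENNReal.mul_ne_top (resBound_ne_top h) hpt
  · filter_upwards [hρ] with y hy
    exact tendsto_kconv_resKer_green h hD hDb hε hp hy

/-- A domination principle for Green potentials of compactly supported measures. -/
lemma ae_potential_green_le (h : RieszRange n α) (hD : IsOpen D)
    (hDb : Bornology.IsBounded D) (hε : ∀ y ∈ D, SweptDirac n α D y (ε y)) {K : Set (Rn n)}
    (hK : IsCompact K) (hKD : K ⊆ D) (ρ : Measure (Rn n)) [IsFiniteMeasure ρ]
    (hρ : ∀ᵐ y ∂ρ, y ∈ K) {x : Rn n} (hx : x ∈ D) (hxK : x ∉ K)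
    (hq : ∀ᵐ z ∂ρ, potential (green n α D ε) ρ z ≤ green n α D ε z x) :
    ∀ᵐ z, potential (green n α D ε) ρ z ≤ green n α D ε z x := by
  obtain ⟨M, hM, hUM⟩ := exists_potential_le_of_green_le h hD hDb hε hK hKD ρ hρ hxK hq
  have hμ := hε x hx
  have : (ε x).Regular := hμ.memE.1
  have hρD : ∀ᵐ y ∂ρ, y ∈ D := hρ.mono fun y hy => hKD hy
  have hfinE : FiniteEnergy (riesz n α) ρ := by
    refine (lintegral_mono_ae hUM).trans_lt ?_
    rw [lintegral_const]
    exact (ENNReal.mul_ne_top hM (measure_ne_top ρ univ)).lt_top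
  set q := potential (green n α D ε) ρ with hqdef
  have hqm : Measurable q := measurable_potential_green h hD hε ρ
  have hgm := measurable_green_left h hD hε x
  set v : Rn n → ℝ≥0∞ := fun z => q z - green n α D ε z x with hvdef
  set m : Rn n → ℝ≥0∞ := fun z => min (q z) (green n α D ε z x) with hmdef
  have hv : Measurable v := hqm.sub hgm
  have hsum (z : Rn n) : v z + m z = q z := by
    simp only [hvdef, hmdef]
    rcases le_total (q z) (green n α D ε z x) with hle | hle
    · rw [tsub_eq_zero_of_le hle, min_eq_left hle, zero_add]
    · rw [min_eq_right hle, tsub_add_cancel_of_le hle]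
  have hvD (z : Rn n) (hz : z ∉ D) : v z = 0 := by
    simp only [hvdef, hqdef, potential_green_of_notMem hz, zero_tsub]
  have hv2 : ∫⁻ z, v z ^ 2 ≠ ⊤ := by
    refine ne_top_of_le_ne_top
      (setLIntegral_potential_sq_ne_top h hDb.measure_lt_top.ne ρ hfinE) ?_
    rw [← lintegral_indicator hD.measurableSet]
    refine lintegral_mono fun z => ?_
    by_cases hzD : z ∈ D
    · rw [indicator_of_mem hzD]
      exact pow_le_pow_left₀ zero_le (tsub_le_self.trans (potential_green_le_riesz ρ z)) 2
    · simp [hvD z hzD]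
  have hsub (j : ℕ) : ∀ᵐ z, v z ≠ 0 → levyMass α j * v z ≤
      kconv (levyKer n α j) v z + ∫⁻ w, resKer n α j (z - w) ∂(ε x + ρ) := by
    refine ae_of_all _ fun z hvz => ?_
    have hz : z ∈ D := by
      by_contra hz
      exact hvz (hvD z hz)
    have hlt : green n α D ε z x < q z := by
      by_contra! hle
      exact hvz (tsub_eq_zero_of_le hle)
    have hfin : levyMass α j * green n α D ε z x ≠ ⊤ :=
      ENNReal.mul_ne_top (levyMass_ne_top j) hlt.ne_top
    refine (ENNReal.add_le_add_iff_right hfin).1 ?_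
    have hL := measurable_levyKer (n := n) (α := α) j
    calc levyMass α j * v z + levyMass α j * green n α D ε z x
        = levyMass α j * q z := by
          rw [← mul_add, tsub_add_cancel_of_le hlt.le]
      _ ≤ kconv (levyKer n α j) q z + ∫⁻ w, resKer n α j (z - w) ∂ρ :=
          levyMass_mul_potential_green_le h hD hDb hε j ρ hρD hz
      _ = kconv (levyKer n α j) v z + kconv (levyKer n α j) m z +
            ∫⁻ w, resKer n α j (z - w) ∂ρ := by
          rw [← kconv_add hL hv]
          congr 2
          exact (funext hsum).symm
      _ ≤ kconv (levyKer n α j) v z + (levyMass α j * green n α D ε z x +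
            ∫⁻ w, resKer n α j (z - w) ∂(ε x)) + ∫⁻ w, resKer n α j (z - w) ∂ρ := by
          gcongr
          rw [levyMass_mul_green h hD hDb hε j hz hx]
          exact (kconv_mono (fun w => min_le_right _ _) z).trans le_self_add
      _ = _ := by
          rw [lintegral_add_measure]
          ring
  have hlimρ : Tendsto (fun j => ∫⁻ w, kconv (resKer n α j) v w ∂ρ) atTop (𝓝 0) := by
    have := tendsto_lintegral_of_dominated_convergence (μ := ρ)
      (F := fun j w => kconv (resKer n α j) v w) (f := fun _ => 0)
      (fun w => resBound h * potential (riesz n α) ρ w)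
      (fun j => measurable_kconv (measurable_resKer j) hv)
      (fun j => ae_of_all _ fun w => (kconv_mono (fun z => tsub_le_self.trans
        (potential_green_le_riesz ρ z)) w).trans (kconv_resKer_potential_le h j ρ w))
      (by
        rw [lintegral_const_mul' _ _ (resBound_ne_top h)]
        exact ENNReal.mul_ne_top (resBound_ne_top h) hfinE.ne) ?_
    · simpa using this
    · filter_upwards [hρD, hUM, hq] with p hpD hp hqp
      have hpt : potential (riesz n α) ρ p ≠ ⊤ := ne_top_of_le_ne_top hM hp
      refine tendsto_kconv_resKer_zero h hv hsum
        (ne_top_of_le_ne_top hpt (potential_green_le_riesz ρ p))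
        (tendsto_kconv_resKer_potential_green h hD hDb hε ρ hρD hpD hpt) ?_
      have heq : q p = m p := (min_eq_left hqp).symm
      rw [heq]
      refine le_liminf_kconv_resKer h ?_
      exact (lowerSemicontinuousAt_potential_green h hD hε ρ hpD).inf
        (continuousAt_green h hD hε hpD x).lowerSemicontinuousAt
  have hlim : Tendsto (fun j => ∫⁻ w, kconv (resKer n α j) v w ∂(ε x + ρ)) atTop (𝓝 0) := by
    simp only [lintegral_add_measure]
    have hεx := tendsto_of_tendsto_of_tendsto_of_le_of_le tendsto_const_nhds
      (tendsto_lintegral_kconv_resKer_potential_green h hD hDb hε hK hKD ρ hρ hx)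
      (fun _ => zero_le) fun j => lintegral_mono (μ := ε x) fun w =>
        kconv_mono (K := resKer n α j) (f := v) (fun z => tsub_le_self) w
    simpa using hεx.add hlimρ
  filter_upwards [ae_eq_zero_of_levyMass_mul_le h hD.measurableSet
    (volume_compl_ne_zero_of_isBounded h hDb) hv (ae_of_all _ hvD) hv2 (ε x + ρ) hsub hlim] with z hz
  exact tsub_eq_zero_iff_le.1 hz

end domination

section mass
variable {n : ℕ} {α : ℝ} {D : Set (Rn n)} {ε : Rn n → Measure (Rn n)}

lemma killingRate_pos (h : RieszRange n α) (hD : IsOpen D) (hDb : Bornology.IsBounded D)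
    (z : Rn n) : 0 < killingRate n α D z := by
  have hm : Measurable fun w => levyKerSup n α (z - w) :=
    measurable_kernel_sub measurable_levyKerSup z
  have heq : killingRate n α D z = ∫⁻ w in Dᶜ, levyKerSup n α (z - w) := by
    rw [killingRate, kconv, ← lintegral_indicator hD.measurableSet.compl]
    refine lintegral_congr fun w => ?_
    by_cases hw : w ∈ D <;> simp [hw]
  rw [heq, setLIntegral_pos_iff hm]
  refine lt_of_lt_of_le (pos_iff_ne_zero.2 (volume_compl_ne_zero_of_isBounded h hDb))
    (measure_mono fun w hw => ⟨?_, hw⟩)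
  exact ((levyKer_pos 0 _).trans_le (levyKer_le_levyKerSup 0 _)).ne'

lemma lintegral_killingRate_green (h : RieszRange n α) (hD : IsOpen D)
    (hDb : Bornology.IsBounded D) (hD11 : C11 n D) (hε : ∀ y ∈ D, SweptDirac n α D y (ε y))
    {y : Rn n} (hy : y ∈ D) :
    ∫⁻ z, killingRate n α D z * green n α D ε z y = resMass n α := by
  rw [← (hε y hy).lintegral_killingRate h hD hDb hD11 hy]
  refine lintegral_congr_ae ?_
  filter_upwards [ae_green_eq_greenFun hε hy] with z hz
  rw [hz]

lemma lintegral_killingRate_potential_green (h : RieszRange n α) (hD : IsOpen D)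
    (hDb : Bornology.IsBounded D) (hD11 : C11 n D) (hε : ∀ y ∈ D, SweptDirac n α D y (ε y))
    (ρ : Measure (Rn n)) [SFinite ρ] (hρ : ∀ᵐ y ∂ρ, y ∈ D) :
    ∫⁻ z, killingRate n α D z * potential (green n α D ε) ρ z = resMass n α * ρ univ := by
  have hm : Measurable fun q : Rn n × Rn n => killingRate n α D q.1 * green n α D ε q.1 q.2 :=
    ((measurable_killingRate hD).comp measurable_fst).mul (measurable_green h hD hε)
  calc _ = ∫⁻ z, ∫⁻ y, killingRate n α D z * green n α D ε z y ∂ρ :=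
        lintegral_congr fun z => (lintegral_const_mul _ (measurable_green_right h hD hε z)).symm
    _ = ∫⁻ y, (∫⁻ z, killingRate n α D z * green n α D ε z y) ∂ρ :=
        lintegral_lintegral_swap hm.aemeasurable
    _ = ∫⁻ _, resMass n α ∂ρ := by
        refine lintegral_congr_ae ?_
        filter_upwards [hρ] with y hy
        exact lintegral_killingRate_green h hD hDb hD11 hε hy
    _ = _ := lintegral_const _

lemma green_self (h : RieszRange n α) (hD : IsOpen D) (hε : ∀ y ∈ D, SweptDirac n α D y (ε y))
    {x : Rn n} (hx : x ∈ D) : green n α D ε x x = ⊤ := by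
  rw [green_of_mem hx hx, greenFun, riesz_self,
    ENNReal.top_sub ((hε x hx).potential_ne_top h hD hx)]

/-- A measure whose restrictions to compact subsets of `F` have Green potentials dominated by the
Green function with pole `x` away from `F` has mass less than one on `F`. -/
lemma measure_lt_one_of_ae_potential_green_le (h : RieszRange n α) (hD : IsOpen D)
    (hDb : Bornology.IsBounded D) (hD11 : C11 n D) (hε : ∀ y ∈ D, SweptDirac n α D y (ε y))
    {C : Set (Rn n)} (hC : IsClosed C) {x : Rn n} (hx : x ∈ D) (hxC : x ∉ C)
    (μ : Measure (Rn n)) [μ.Regular]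
    (hle : ∀ K, IsCompact K → K ⊆ C ∩ D →
      ∀ᵐ z, potential (green n α D ε) (μ.restrict K) z ≤ green n α D ε z x) :
    μ (C ∩ D) < 1 := by
  have hC0 := resMass_ne_zero h
  have hCt := resMass_ne_top h
  obtain ⟨r, hr, hrC⟩ := Metric.isOpen_iff.1 hC.isOpen_compl x hxC
  set M : ℝ≥0∞ := ENNReal.ofReal ((r / 2) ^ (α - (n : ℝ))) with hM
  have hnear : ∀ᶠ z in 𝓝 x, M + 1 < green n α D ε z x :=
    (continuousAt_green h hD hε hx x).eventually_const_lt
      (by simp only [green_self h hD hε hx]; exact ENNReal.add_lt_top.2 ⟨ENNReal.ofReal_lt_top, by simp⟩)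
  obtain ⟨s, hs, hsub⟩ := Metric.mem_nhds_iff.1
    (hnear.and (Metric.ball_mem_nhds x (half_pos hr)))
  set B := Metric.ball x s with hB
  set δ : ℝ≥0∞ := ∫⁻ z in B, killingRate n α D z with hδ
  have hδ0 : 0 < δ := by
    rw [hδ, setLIntegral_pos_iff (measurable_killingRate hD)]
    refine lt_of_lt_of_le (Metric.measure_ball_pos volume x hs) (measure_mono fun z hz => ⟨?_, hz⟩)
    exact (killingRate_pos h hD hDb z).ne'
  have hK (K : Set (Rn n)) (hK : IsCompact K) (hKF : K ⊆ C ∩ D) :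
      resMass n α * μ K + δ ≤ resMass n α := by
    have : IsFiniteMeasure (μ.restrict K) := ⟨by
      rw [Measure.restrict_apply_univ]; exact hK.measure_lt_top⟩
    set q := potential (green n α D ε) (μ.restrict K) with hqdef
    have hq := hle K hK hKF
    have hmemK : ∀ᵐ y ∂μ.restrict K, y ∈ K := ae_restrict_mem hK.measurableSet
    have hmass : ∫⁻ z, killingRate n α D z * q z = resMass n α * μ K := by
      rw [lintegral_killingRate_potential_green h hD hDb hD11 hε _
        (hmemK.mono fun y hy => (hKF hy).2), Measure.restrict_apply_univ]
    have hone : μ K ≤ 1 := by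
      refine (ENNReal.mul_le_mul_iff_right hC0 hCt).1 ?_
      rw [mul_one, ← hmass, ← lintegral_killingRate_green h hD hDb hD11 hε hx]
      refine lintegral_mono_ae ?_
      filter_upwards [hq] with z hz
      exact mul_le_mul' le_rfl hz
    have hqB (z : Rn n) (hz : z ∈ B) : q z ≤ M := by
      calc q z ≤ ∫⁻ _, M ∂μ.restrict K := by
            refine lintegral_mono_ae ?_
            filter_upwards [hmemK] with y hy
            refine (green_le_riesz z y).trans ?_
            rw [riesz_comm]
            refine riesz_le_of_le_dist h (half_pos hr) ?_
            have h1 : dist z x < r / 2 := (hsub hz).2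
            have h2 : r ≤ dist x y := le_dist_of_ball_subset hrC (not_not.2 (hKF hy).1)
            have h3 := dist_triangle x z y
            rw [dist_comm x z] at h3
            linarith
        _ ≤ M * 1 := by
            rw [lintegral_const, Measure.restrict_apply_univ]
            gcongr
        _ = M := mul_one M
    rw [← hmass, ← lintegral_killingRate_green h hD hDb hD11 hε hx, hδ,
      ← lintegral_indicator measurableSet_ball,
      ← lintegral_add_right _ ((measurable_killingRate hD).indicator measurableSet_ball)]
    refine lintegral_mono_ae ?_
    filter_upwards [hq] with z hz
    by_cases hzB : z ∈ B
    · rw [indicator_of_mem hzB]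
      calc killingRate n α D z * q z + killingRate n α D z
          = killingRate n α D z * (q z + 1) := by rw [mul_add, mul_one]
        _ ≤ _ := by
            refine mul_le_mul' le_rfl (le_trans ?_ (hsub hzB).1.le)
            gcongr
            exact hqB z hzB
    · rw [indicator_of_notMem hzB, add_zero]
      exact mul_le_mul' le_rfl hz
  by_contra! hge
  have hlt : (resMass n α - δ) / resMass n α < 1 := by
    rw [ENNReal.div_lt_iff (Or.inl hC0) (Or.inl hCt), one_mul]
    exact ENNReal.sub_lt_self hCt hC0 hδ0.ne'
  obtain ⟨K, hKF, hKc, hKlt⟩ :=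
    (hC.measurableSet.inter hD.measurableSet).exists_lt_isCompact (hlt.trans_le hge)
  refine hKlt.not_ge ?_
  rw [ENNReal.le_div_iff_mul_le (Or.inl hC0) (Or.inl hCt), mul_comm]
  have hδt : δ ≠ ⊤ := ne_top_of_le_ne_top hCt (le_add_self.trans (hK K hKc hKF))
  exact ENNReal.le_sub_of_add_le_right hδt (hK K hKc hKF)

end mass

/-- For the α-Green kernel of a bounded `C^{1,1}` open set `D ⊆ ℝⁿ`,
`1 < α < 2`, and `F` relatively closed in `D` of positive inner capacity: the α-Green
balayage of the Dirac measure `ε_x`, `x ∈ D ∖ F`, onto `F` has total mass `< 1`. -/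
theorem green_dirac_balayage_mass_lt_one
    (n : ℕ) (hn : 2 ≤ n) (α : ℝ) (hα1 : 1 < α) (hα2 : α < 2)
    (D : Set (Rn n)) (hDo : IsOpen D) (hDb : Bornology.IsBounded D) (hD11 : C11 n D)
    (εDc : Rn n → Measure (Rn n))
    (hεDc : ∀ y ∈ D, IsInnerBalayage (riesz n α) Dᶜ (Measure.dirac y) (εDc y))
    (F : Set (Rn n)) (hFD : F ⊆ D) (hFcl : ∃ C : Set (Rn n), IsClosed C ∧ F = C ∩ D)
    (hcap : 0 < innerCap (green n α D εDc) F)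
    (x : Rn n) (hx : x ∈ D \ F)
    (εF : Measure (Rn n))
    (hεF : IsInnerBalayage (green n α D εDc) F (Measure.dirac x) εF) :
    εF F < 1 := by
  have h : RieszRange n α := ⟨by linarith, hα2, hn⟩
  have hε (y : Rn n) (hy : y ∈ D) : SweptDirac n α D y (εDc y) :=
    SweptDirac.of_isInnerBalayage h hDo (hεDc y hy)
  have : εF.Regular := hεF.1.1.1
  obtain ⟨C, hC, rfl⟩ := hFcl
  have hxC : x ∉ C := fun hmem => hx.2 ⟨hmem, hx.1⟩
  refine measure_lt_one_of_ae_potential_green_le h hDo hDb hD11 hε hC hx.1 hxC εF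
    fun K hK hKF => ?_
  have : IsFiniteMeasure (εF.restrict K) := ⟨by
    rw [Measure.restrict_apply_univ]; exact hK.measure_lt_top⟩
  have hmemK : ∀ᵐ y ∂εF.restrict K, y ∈ K := ae_restrict_mem hK.measurableSet
  refine ae_potential_green_le h hDo hDb hε hK (fun y hy => (hKF hy).2) _ hmemK hx.1
    (fun hmem => hxC (hKF hmem).1) ?_
  have hN : MeasurableSet {z ∈ C ∩ D | potential (green n α D εDc) εF z ≠
      potential (green n α D εDc) (Measure.dirac x) z} :=
    (hC.measurableSet.inter hDo.measurableSet).inter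
      (measurableSet_eq_fun (measurable_potential_green h hDo hε εF)
        (measurable_potential_green h hDo hε _)).compl
  have hae := measure_eq_zero_iff_ae_notMem.1
    (measure_eq_zero_of_innerCap_eq_zero hεF.1.1 hN hεF.2)
  filter_upwards [hmemK, ae_restrict_of_ae hae] with z hzK hz
  have heq : potential (green n α D εDc) εF z = green n α D εDc z x := by
    rw [← potential_dirac (green n α D εDc) z x]
    by_contra hne
    exact hz ⟨hKF hzK, hne⟩
  rw [← heq]
  exact lintegral_mono' Measure.restrict_le_self le_rfl

end Balayage
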